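/- In the iterative scheme for the spherically symmetric Einstein–Vlasov–Maxwell system, define Pₙ(t) = sup{|v| : (x̃,v) ∈ supp fₙ(s), 0 ≤ s ≤ t} and Qₙ(t) = sup{e^{2λₙ(s,r)} : r ≥ 0, 0 ≤ s ≤ t}. Then there exists a constant C > 0 independent of n and of t such that, with u₀ = sup{|v| : (x̃,v) ∈ supp f̊}, q₀ = sup{e^{2λ̊(r)} : r ≥ 0}, r₀ = sup{|x̃| : (x̃,v) ∈ supp f̊}, and z₀ the maximal solution on [0,T⁰) of z₀(t) = u₀ + q₀ + C∫₀^t exp(C(1 + r₀ + s)⁸(1 + ‖f̊‖_∞)³ (1 + z₀(s))³⁵) ds, one has T⁰ > 0, Pₙ(t) + Qₙ(t) ≤ z₀(t) for all n ∈ ℕ and t ∈ [0,T⁰) ∩ [0,Tₙ), and Tₙ ≥ T⁰ for all n ∈ ℕ; in particular the sequences Pₙ and Qₙ are uniformly bounded on compact subintervals of [0,T⁰). -/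

import Mathlib

/- Common definitions for the spherically symmetric Einstein–Vlasov–Maxwell system. -/

noncomputable section
open Real MeasureTheory Filter Topology Matrix intervalIntegral
open scoped Classical ENNReal

namespace EVM

/-- Euclidean 3-space. -/
abbrev E3 : Type := EuclideanSpace ℝ (Fin 3)

/-- `√(1+|v|²)`. -/
def w (v : E3) : ℝ := Real.sqrt (1 + ‖v‖ ^ 2)

/-- Action of a 3×3 matrix on `E3`. -/
def act (A : Matrix (Fin 3) (Fin 3) ℝ) (x : E3) : E3 := WithLp.toLp 2 (fun i => ∑ j, A i j * x j)

/-- Membership in SO(3). -/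
def SO3 (A : Matrix (Fin 3) (Fin 3) ℝ) : Prop := Aᵀ * A = 1 ∧ A.det = 1

/-- A function on `ℝ³ × ℝ³` is spherically symmetric if it is invariant under
simultaneous rotations of both arguments. -/
def SphSymm (g : E3 → E3 → ℝ) : Prop :=
  ∀ A : Matrix (Fin 3) (Fin 3) ℝ, SO3 A → ∀ x v : E3, g (act A x) (act A v) = g x v

/-- The reference point of radius `r` on the first coordinate axis. -/
def pt (r : ℝ) : E3 := EuclideanSpace.single 0 r

/-- Euclidean divergence of a vector field on `ℝ³`. -/
def div3 (G : E3 → E3) (x : E3) : ℝ :=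
  ∑ i : Fin 3, fderiv ℝ (fun y => G y i) x (EuclideanSpace.single i 1)

/-! ### Regularity notions -/

/-- `C²` on `I × [0,∞)`. -/
def C2On (I : Set ℝ) (g : ℝ → ℝ → ℝ) : Prop :=
  ContDiffOn ℝ 2 (fun p : ℝ × ℝ => g p.1 p.2) (I ×ˢ Set.Ici (0:ℝ))

/-- `g(t,r) → 0` as `r → ∞`, for each `t ∈ I`. -/
def ZeroAtInfty (I : Set ℝ) (g : ℝ → ℝ → ℝ) : Prop :=
  ∀ t ∈ I, Tendsto (g t) atTop (nhds 0)

/-- Regularity of the metric pair `(λ, μ)` on `I × [0,∞)`, including the boundary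
conditions `λ(t,r), μ(t,r) → 0` as `r → ∞`, `λ(t,0) = 0`, and
`λ̇(t,0) = λ′(t,0) = μ′(t,0) = 0`. -/
def RegMetric2 (I : Set ℝ) (lam mu : ℝ → ℝ → ℝ) : Prop :=
  C2On I lam ∧ C2On I mu ∧ ZeroAtInfty I lam ∧ ZeroAtInfty I mu ∧
  (∀ t ∈ I, lam t 0 = 0) ∧
  (∀ t ∈ I, deriv (fun s => lam s 0) t = 0) ∧
  (∀ t ∈ I, deriv (lam t) 0 = 0) ∧
  (∀ t ∈ I, deriv (mu t) 0 = 0)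

/-- Regularity of the triple `(λ, μ, λ̃)` on `I × [0,∞)`: additionally `λ̃` is `C²`
with `λ̃′(t,0) = 0`. -/
def RegMetric3 (I : Set ℝ) (lam mu lamT : ℝ → ℝ → ℝ) : Prop :=
  RegMetric2 I lam mu ∧ C2On I lamT ∧ (∀ t ∈ I, deriv (lamT t) 0 = 0)

/-- Regularity of the electric field coefficient `e`: `e` and `e′` are continuous on
`I × [0,∞)`, `e(t,0) = 0` and `e(t,r) → 0` as `r → ∞`. -/
def RegField (I : Set ℝ) (e : ℝ → ℝ → ℝ) : Prop :=
  ContinuousOn (fun p : ℝ × ℝ => e p.1 p.2) (I ×ˢ Set.Ici (0:ℝ)) ∧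
  ContinuousOn (fun p : ℝ × ℝ => deriv (e p.1) p.2) (I ×ˢ Set.Ici (0:ℝ)) ∧
  (∀ t ∈ I, e t 0 = 0) ∧ ZeroAtInfty I e

/-- Regularity of a distribution function: `C¹`, nonnegative, spherically symmetric
with compact support at each time. -/
def RegDist (I : Set ℝ) (f : ℝ → E3 → E3 → ℝ) : Prop :=
  ContDiffOn ℝ 1 (fun p : ℝ × (E3 × E3) => f p.1 p.2.1 p.2.2)
    (I ×ˢ (Set.univ : Set (E3 × E3))) ∧
  (∀ t ∈ I, ∀ x v : E3, 0 ≤ f t x v) ∧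
  (∀ t ∈ I, SphSymm (f t)) ∧
  (∀ t ∈ I, HasCompactSupport (fun z : E3 × E3 => f t z.1 z.2))

/-! ### The characteristic field -/

/-- Spatial part of the characteristic field. -/
def F1 (lam mu : ℝ → ℝ → ℝ) (s : ℝ) (x v : E3) : E3 :=
  (Real.exp (mu s ‖x‖ - lam s ‖x‖) / w v) • v

/-- Momentum part of the characteristic field. -/
def F2 (q : ℝ) (lam mu lamT e : ℝ → ℝ → ℝ) (s : ℝ) (x v : E3) : E3 :=
  if x = 0 then 0 else
    (-(lamT s ‖x‖ * ((inner ℝ x v : ℝ) / ‖x‖)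
        + Real.exp (mu s ‖x‖ - lam s ‖x‖) * deriv (mu s) ‖x‖ * w v
        - q * Real.exp (mu s ‖x‖ + lam s ‖x‖) * e s ‖x‖) / ‖x‖) • x

/-- The full characteristic field `F = (F₁, F₂)`. -/
def Fchar (q : ℝ) (lam mu lamT e : ℝ → ℝ → ℝ) (s : ℝ) (z : E3 × E3) : E3 × E3 :=
  (F1 lam mu s z.1 z.2, F2 q lam mu lamT e s z.1 z.2)

/-- The (modified) Vlasov equation with time-derivative coefficient `λ̃ = lamT`. -/
def VlasovEq (q : ℝ) (I : Set ℝ) (lam mu lamT e : ℝ → ℝ → ℝ)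
    (f : ℝ → E3 → E3 → ℝ) : Prop :=
  ∀ t ∈ I, ∀ x v : E3,
    deriv (fun s => f s x v) t
      + fderiv ℝ (fun y => f t y v) x (F1 lam mu t x v)
      + fderiv ℝ (fun u => f t x u) v (F2 q lam mu lamT e t x v) = 0

/-! ### Source terms (as functions of `(t,r)`, evaluated along the first axis) -/

/-- Energy density `ρ`. -/
def rho (lam e : ℝ → ℝ → ℝ) (f : ℝ → E3 → E3 → ℝ) (t r : ℝ) : ℝ :=
  (∫ v : E3, w v * f t (pt r) v) + (1/2) * Real.exp (2 * lam t r) * (e t r) ^ 2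

/-- Radial pressure `p`. -/
def prs (lam e : ℝ → ℝ → ℝ) (f : ℝ → E3 → E3 → ℝ) (t r : ℝ) : ℝ :=
  (∫ v : E3, (v 0) ^ 2 / w v * f t (pt r) v) - (1/2) * Real.exp (2 * lam t r) * (e t r) ^ 2

/-- Momentum density `k`. -/
def kk (f : ℝ → E3 → E3 → ℝ) (t r : ℝ) : ℝ := ∫ v : E3, (v 0) * f t (pt r) v

/-- Tangential pressure term `q̄`. -/
def qbar (lam e : ℝ → ℝ → ℝ) (f : ℝ → E3 → E3 → ℝ) (t r : ℝ) : ℝ :=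
  (∫ v : E3, (‖v‖ ^ 2 - (v 0) ^ 2) / w v * f t (pt r) v)
    + Real.exp (2 * lam t r) * (e t r) ^ 2

/-- Charge density `M`. -/
def Mch (f : ℝ → E3 → E3 → ℝ) (t r : ℝ) : ℝ := ∫ v : E3, f t (pt r) v

/-- Current term `N`. -/
def Ncur (f : ℝ → E3 → E3 → ℝ) (t r : ℝ) : ℝ := ∫ v : E3, (r * v 0) / w v * f t (pt r) v

/-- Quasi-local mass `m(t,r) = 4π ∫₀ʳ s² ρ(t,s) ds`. -/
def mqm (lam e : ℝ → ℝ → ℝ) (f : ℝ → E3 → E3 → ℝ) (t r : ℝ) : ℝ :=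
  4 * π * ∫ s in (0:ℝ)..r, s ^ 2 * rho lam e f t s

/-! ### The field equations -/

/-- Einstein equation (2.6): `e^{−2λ}(2rλ′ − 1) + 1 = 8πr²ρ`. -/
def Eq2_6 (I : Set ℝ) (lam e : ℝ → ℝ → ℝ) (f : ℝ → E3 → E3 → ℝ) : Prop :=
  ∀ t ∈ I, ∀ r : ℝ, 0 ≤ r →
    Real.exp (-2 * lam t r) * (2 * r * deriv (lam t) r - 1) + 1
      = 8 * π * r ^ 2 * rho lam e f t r

/-- Einstein equation (2.7): `λ̇ = −4πr e^{λ+μ} k`. -/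
def Eq2_7 (I : Set ℝ) (lam mu : ℝ → ℝ → ℝ) (f : ℝ → E3 → E3 → ℝ) : Prop :=
  ∀ t ∈ I, ∀ r : ℝ, 0 ≤ r →
    deriv (fun s => lam s r) t
      = -(4 * π) * r * Real.exp (lam t r + mu t r) * kk f t r

/-- Einstein equation (2.8) in the form `e^{−2λ}(2rμ′ + 1) − 1 = 8πr²p`. -/
def Eq2_8 (I : Set ℝ) (lam mu e : ℝ → ℝ → ℝ) (f : ℝ → E3 → E3 → ℝ) : Prop :=
  ∀ t ∈ I, ∀ r : ℝ, 0 ≤ r →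
    Real.exp (-2 * lam t r) * (2 * r * deriv (mu t) r + 1) - 1
      = 8 * π * r ^ 2 * prs lam e f t r

/-- Einstein equation (2.9) (second order). -/
def Eq2_9 (I : Set ℝ) (lam mu e : ℝ → ℝ → ℝ) (f : ℝ → E3 → E3 → ℝ) : Prop :=
  ∀ t ∈ I, ∀ r : ℝ, 0 < r →
    Real.exp (-2 * lam t r) *
        (deriv (deriv (mu t)) r
          + (deriv (mu t) r - deriv (lam t) r) * (deriv (mu t) r + 1 / r))
      - Real.exp (-2 * mu t r) *
        (deriv (fun s => deriv (fun τ => lam τ r) s) t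
          + deriv (fun s => lam s r) t
            * (deriv (fun s => lam s r) t - deriv (fun s => mu s r) t))
      = 4 * π * qbar lam e f t r

/-- Maxwell equation (2.11): `∂ᵣ(r² e^{λ} e) = q r² e^{λ} M`. -/
def Max2_11 (q : ℝ) (I : Set ℝ) (lam e : ℝ → ℝ → ℝ) (f : ℝ → E3 → E3 → ℝ) : Prop :=
  ∀ t ∈ I, ∀ r : ℝ, 0 ≤ r →
    deriv (fun s => s ^ 2 * Real.exp (lam t s) * e t s) r
      = q * r ^ 2 * Real.exp (lam t r) * Mch f t r

/-- Maxwell equation (2.12): `∂ₜ(e^{λ} e) = −(q/r) e^{μ} N`. -/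
def Max2_12 (q : ℝ) (I : Set ℝ) (lam mu e : ℝ → ℝ → ℝ) (f : ℝ → E3 → E3 → ℝ) : Prop :=
  ∀ t ∈ I, ∀ r : ℝ, 0 < r →
    deriv (fun s => Real.exp (lam s r) * e s r) t
      = -(q / r) * Real.exp (mu t r) * Ncur f t r

/-- The full spherically symmetric Einstein–Vlasov–Maxwell system
(2.6)–(2.12), the Vlasov equation taken with `λ̃ = λ̇`. -/
def FullSystem (q : ℝ) (I : Set ℝ) (lam mu e : ℝ → ℝ → ℝ) (f : ℝ → E3 → E3 → ℝ) : Prop :=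
  Eq2_6 I lam e f ∧ Eq2_7 I lam mu f ∧ Eq2_8 I lam mu e f ∧ Eq2_9 I lam mu e f ∧
  VlasovEq q I lam mu (fun t r => deriv (fun s => lam s r) t) e f ∧
  Max2_11 q I lam e f ∧ Max2_12 q I lam mu e f

/-- A regular solution of the full system on `I` (regularity includes the
asymptotically flat boundary conditions). -/
def RegularSolution (q : ℝ) (I : Set ℝ) (lam mu e : ℝ → ℝ → ℝ)
    (f : ℝ → E3 → E3 → ℝ) : Prop :=
  RegMetric2 I lam mu ∧ RegField I e ∧ RegDist I f ∧ FullSystem q I lam mu e f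



/-- The half-open interval `[0, T)` of real times below an extended real `T`. -/
def Iv (T : ℝ≥0∞) : Set ℝ := {t : ℝ | 0 ≤ t ∧ (ENNReal.ofReal t) < T}

/-- The initial data for the iterative scheme: a smooth, nonnegative, compactly
supported, spherically symmetric `f̊` satisfying the smallness condition (4.1),
and a smooth regular solution `(λ̊, μ̊, e̊)` of the constraint equations
(3.17), (3.18), (3.19). -/
def InitialData (q : ℝ) (f0 : E3 → E3 → ℝ) (lam0 mu0 e0 : ℝ → ℝ) : Prop :=
  ContDiff ℝ (⊤ : ℕ∞) (fun z : E3 × E3 => f0 z.1 z.2) ∧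
  (∀ x v : E3, 0 ≤ f0 x v) ∧
  HasCompactSupport (fun z : E3 × E3 => f0 z.1 z.2) ∧ SphSymm f0 ∧
  (∀ r : ℝ, 0 < r →
    8 * π * (∫ s in (0:ℝ)..r, s ^ 2 * ∫ v : E3, w v * f0 (pt s) v) < r) ∧
  ContDiff ℝ (⊤ : ℕ∞) lam0 ∧ ContDiff ℝ (⊤ : ℕ∞) mu0 ∧ ContDiff ℝ (⊤ : ℕ∞) e0 ∧
  lam0 0 = 0 ∧ e0 0 = 0 ∧
  Tendsto lam0 atTop (nhds 0) ∧ Tendsto mu0 atTop (nhds 0) ∧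
  Tendsto e0 atTop (nhds 0) ∧
  (∀ r : ℝ, 0 < r →
    Real.exp (-2 * lam0 r) * (2 * r * deriv lam0 r - 1) + 1
      = 8 * π * r ^ 2 * ((∫ v : E3, w v * f0 (pt r) v)
          + 1/2 * Real.exp (2 * lam0 r) * (e0 r) ^ 2)) ∧
  (∀ r : ℝ, 0 < r →
    Real.exp (-2 * lam0 r) * (2 * r * deriv mu0 r + 1) - 1
      = 8 * π * r ^ 2 * ((∫ v : E3, (v 0) ^ 2 / w v * f0 (pt r) v)
          - 1/2 * Real.exp (2 * lam0 r) * (e0 r) ^ 2)) ∧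
  (∀ r : ℝ, 0 < r →
    deriv (fun s => s ^ 2 * Real.exp (lam0 s) * e0 s) r
      = q * r ^ 2 * Real.exp (lam0 r) * ∫ v : E3, f0 (pt r) v)

/-- The iterative scheme of Section 4.1: the sequences
`(fₙ, λₙ, μₙ, λ̃ₙ, eₙ, Tₙ, Zₙ)` satisfy the defining relations of the iterates. -/
def IsScheme (q : ℝ) (f0 : E3 → E3 → ℝ) (lam0 mu0 e0 : ℝ → ℝ)
    (fI : ℕ → ℝ → E3 → E3 → ℝ) (lamI muI lamTI eI : ℕ → ℝ → ℝ → ℝ)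
    (T : ℕ → ℝ≥0∞) (Z : ℕ → ℝ → ℝ → E3 × E3 → E3 × E3) : Prop :=
  -- zeroth iterates
  (∀ t : ℝ, ∀ x v : E3, fI 0 t x v = f0 x v) ∧
  (∀ t r : ℝ, lamI 0 t r = lam0 r) ∧ (∀ t r : ℝ, muI 0 t r = mu0 r) ∧
  (∀ t r : ℝ, eI 0 t r = e0 r) ∧ T 0 = ⊤ ∧
  -- λ̃ₙ from (4.15)
  (∀ n : ℕ, ∀ t r : ℝ,
    lamTI n t r = -(4 * π) * r * Real.exp (lamI n t r + muI n t r) * kk (fI n) t r) ∧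
  -- Zₙ₊₁ is the flow of the characteristic field built from the n-th iterates
  (∀ n : ℕ, ∀ t ∈ Iv (T n), ∀ z : E3 × E3, Z (n + 1) t t z = z) ∧
  (∀ n : ℕ, ∀ t ∈ Iv (T n), ∀ z : E3 × E3, ∀ s ∈ Iv (T n),
    HasDerivAt (fun τ => Z (n + 1) τ t z)
      (Fchar q (lamI n) (muI n) (lamTI n) (eI n) s (Z (n + 1) s t z)) s) ∧
  -- fₙ₊₁(t,z) = f̊(Zₙ₊₁(0,t,z))
  (∀ n : ℕ, ∀ t ∈ Iv (T n), ∀ x v : E3,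
    fI (n + 1) t x v = f0 (Z (n + 1) 0 t (x, v)).1 (Z (n + 1) 0 t (x, v)).2) ∧
  -- Tₙ₊₁ from (4.11)
  (∀ n : ℕ, T (n + 1) = sSup {τ : ℝ≥0∞ | ∃ t : ℝ, τ = ENNReal.ofReal t ∧
      t ∈ Iv (T n) ∧ ∀ s ∈ Set.Icc (0:ℝ) t, ∀ r : ℝ, 0 < r →
        2 * mqm (lamI n) (eI n) (fI (n + 1)) s r < r}) ∧
  -- λₙ₊₁ from (4.12)
  (∀ n : ℕ, ∀ t ∈ Iv (T (n + 1)), ∀ r : ℝ, 0 < r →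
    Real.exp (-2 * lamI (n + 1) t r)
      = 1 - 2 * mqm (lamI n) (eI n) (fI (n + 1)) t r / r) ∧
  (∀ n : ℕ, ∀ t ∈ Iv (T (n + 1)), lamI (n + 1) t 0 = 0) ∧
  -- μₙ₊₁ from (4.13), (4.14)
  (∀ n : ℕ, ∀ t ∈ Iv (T (n + 1)), ∀ r : ℝ, 0 < r →
    deriv (muI (n + 1) t) r = Real.exp (2 * lamI (n + 1) t r) *
      (mqm (lamI n) (eI n) (fI (n + 1)) t r / r ^ 2
        + 4 * π * r * prs (lamI n) (eI n) (fI (n + 1)) t r)) ∧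
  (∀ n : ℕ, ∀ t ∈ Iv (T (n + 1)), ∀ r : ℝ, 0 ≤ r →
    muI (n + 1) t r = -∫ s in Set.Ioi r, deriv (muI (n + 1) t) s) ∧
  -- eₙ₊₁ from (4.16)
  (∀ n : ℕ, ∀ t ∈ Iv (T (n + 1)), ∀ r : ℝ, 0 < r →
    eI (n + 1) t r = q / r ^ 2 * Real.exp (-(lamI (n + 1) t r)) *
      ∫ s in (0:ℝ)..r, s ^ 2 * Real.exp (lamI (n + 1) t s) * Mch (fI (n + 1)) t s) ∧
  (∀ n : ℕ, ∀ t ∈ Iv (T (n + 1)), eI (n + 1) t 0 = 0)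

/-- Maximal momentum `Pₙ(t)` in the support of `fₙ` up to time `t`. -/
def Pmax (fI : ℕ → ℝ → E3 → E3 → ℝ) (n : ℕ) (t : ℝ) : ℝ :=
  sSup {c : ℝ | ∃ s ∈ Set.Icc (0:ℝ) t, ∃ x v : E3, fI n s x v ≠ 0 ∧ c = ‖v‖}

/-- `Qₙ(t) = sup {e^{2λₙ(s,r)} : r ≥ 0, 0 ≤ s ≤ t}`. -/
def Qmax (lamI : ℕ → ℝ → ℝ → ℝ) (n : ℕ) (t : ℝ) : ℝ :=
  sSup {c : ℝ | ∃ s ∈ Set.Icc (0:ℝ) t, ∃ r : ℝ, 0 ≤ r ∧ c = Real.exp (2 * lamI n s r)}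

/-- `u₀`: maximal momentum in the support of the initial datum. -/
def suppMom (f0 : E3 → E3 → ℝ) : ℝ :=
  sSup {c : ℝ | ∃ x v : E3, f0 x v ≠ 0 ∧ c = ‖v‖}

/-- `r₀`: maximal radius in the support of the initial datum. -/
def suppRad (f0 : E3 → E3 → ℝ) : ℝ :=
  sSup {c : ℝ | ∃ x v : E3, f0 x v ≠ 0 ∧ c = ‖x‖}

/-- `q₀ = sup {e^{2λ̊(r)} : r ≥ 0}`. -/
def q0max (lam0 : ℝ → ℝ) : ℝ :=
  sSup {c : ℝ | ∃ r : ℝ, 0 ≤ r ∧ c = Real.exp (2 * lam0 r)}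

/-- The supremum norm of the initial datum. -/
def supNorm (f0 : E3 → E3 → ℝ) : ℝ := ⨆ z : E3 × E3, |f0 z.1 z.2|

/-- The supremum norm of the full gradient of the initial datum. -/
def gradSupNorm (f0 : E3 → E3 → ℝ) : ℝ :=
  ⨆ z : E3 × E3, ‖fderiv ℝ (fun p : E3 × E3 => f0 p.1 p.2) z‖

/-- Sup norm of the spatial gradient of `fₙ(t)`. -/
def gradxSup (fI : ℕ → ℝ → E3 → E3 → ℝ) (n : ℕ) (t : ℝ) : ℝ :=
  ⨆ x : E3, ⨆ v : E3, ‖fderiv ℝ (fun y => fI n t y v) x‖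

/-! ### Part A: the maximal solution of the comparison equation -/

theorem ftc_right {g : ℝ → ℝ} {T : ℝ} (hg : ContinuousOn g (Set.Ico 0 T)) {t : ℝ}
    (ht : t ∈ Set.Ico 0 T) :
    HasDerivWithinAt (fun u => ∫ s in (0:ℝ)..u, g s) (g t) (Set.Ici t) t := by
  obtain ⟨b, hb1, hb2⟩ := exists_between ht.2
  have hIntg : IntervalIntegrable g volume 0 t := by
    apply ContinuousOn.intervalIntegrable
    rw [Set.uIcc_of_le ht.1]
    exact hg.mono (fun x hx => ⟨hx.1, hx.2.trans_lt ht.2⟩)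
  have hsub : Set.Ioo t b ⊆ Set.Ico 0 T := fun x hx => ⟨ht.1.trans hx.1.le, hx.2.trans hb2⟩
  refine intervalIntegral.integral_hasDerivWithinAt_right hIntg (t := Set.Ioi t) ?_ ?_
  · refine ⟨Set.Ioo t b, Ioo_mem_nhdsGT hb1, ?_⟩
    exact (hg.mono hsub).aestronglyMeasurable measurableSet_Ioo
  · have h1 : ContinuousWithinAt g (Set.Ico t b) t :=
      (hg t ht).mono (fun x hx => ⟨ht.1.trans hx.1, hx.2.trans hb2⟩)
    have h2 : ContinuousWithinAt g (Set.Ioo t b) t := h1.mono Set.Ioo_subset_Ico_self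
    exact h2.mono_of_mem_nhdsWithin (Ioo_mem_nhdsGT hb1)

theorem cont_prim {g : ℝ → ℝ} {T : ℝ} (hg : ContinuousOn g (Set.Ico 0 T)) :
    ContinuousOn (fun u => ∫ s in (0:ℝ)..u, g s) (Set.Ico 0 T) := by
  intro t ht
  obtain ⟨b, hb1, hb2⟩ := exists_between ht.2
  have h0b : (0:ℝ) ≤ b := ht.1.trans hb1.le
  have hIntg : IntegrableOn g (Set.uIcc 0 b) := by
    rw [Set.uIcc_of_le h0b]
    exact (hg.mono (fun x hx => ⟨hx.1, hx.2.trans_lt hb2⟩)).integrableOn_Icc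
  have := intervalIntegral.continuousOn_primitive_interval hIntg
  rw [Set.uIcc_of_le h0b] at this
  refine (this t ⟨ht.1, hb1.le⟩).mono_of_mem_nhdsWithin ?_
  have : Set.Icc 0 b = Set.Ici 0 ∩ Set.Iic b := rfl
  rw [this]
  refine inter_mem ?_ (mem_nhdsWithin_of_mem_nhds (Iic_mem_nhds hb1))
  exact mem_of_superset self_mem_nhdsWithin (fun x hx => hx.1)

/-- `z` solves the integral equation on `[0,T)`. -/
def SolOn (a C : ℝ) (Φ : ℝ → ℝ → ℝ) (T : ℝ) (z : ℝ → ℝ) : Prop :=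
  ContinuousOn z (Set.Ico 0 T) ∧
  ∀ t ∈ Set.Ico (0:ℝ) T, z t = a + C * ∫ s in (0:ℝ)..t, Φ s (z s)

theorem SolOn.mono {a C : ℝ} {Φ : ℝ → ℝ → ℝ} {T T' : ℝ} {z : ℝ → ℝ} (h : SolOn a C Φ T z)
    (hT : T' ≤ T) : SolOn a C Φ T' z :=
  ⟨h.1.mono (Set.Ico_subset_Ico_right hT), fun t ht => h.2 t ⟨ht.1, ht.2.trans_le hT⟩⟩

theorem SolOn.contΦ {a C : ℝ} {Φ : ℝ → ℝ → ℝ} {T : ℝ} {z : ℝ → ℝ}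
    (hΦ : ContDiff ℝ 1 (fun p : ℝ × ℝ => Φ p.1 p.2)) (h : SolOn a C Φ T z) :
    ContinuousOn (fun s => Φ s (z s)) (Set.Ico 0 T) :=
  hΦ.continuous.comp_continuousOn (continuousOn_id.prodMk h.1)

theorem SolOn.deriv {a C : ℝ} {Φ : ℝ → ℝ → ℝ} {T : ℝ} {z : ℝ → ℝ}
    (hΦ : ContDiff ℝ 1 (fun p : ℝ × ℝ => Φ p.1 p.2)) (h : SolOn a C Φ T z) {t : ℝ}
    (ht : t ∈ Set.Ico 0 T) : HasDerivWithinAt z (C * Φ t (z t)) (Set.Ici t) t := by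
  have h1 := ((ftc_right (h.contΦ hΦ) ht).const_mul C).const_add a
  refine h1.congr_of_eventuallyEq ?_ (h.2 t ht)
  have : Set.Ico t T ∈ 𝓝[≥] t := Ico_mem_nhdsGE ht.2
  filter_upwards [this] with u hu
  exact h.2 u ⟨ht.1.trans hu.1, hu.2⟩

theorem SolOn.unique {a C : ℝ} {Φ : ℝ → ℝ → ℝ} {T : ℝ} {z y : ℝ → ℝ}
    (hΦ : ContDiff ℝ 1 (fun p : ℝ × ℝ => Φ p.1 p.2)) (h : SolOn a C Φ T z)
    (h' : SolOn a C Φ T y) {t : ℝ} (ht : t ∈ Set.Ico 0 T) : z t = y t := by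
  have hsub : Set.Icc 0 t ⊆ Set.Ico 0 T := fun x hx => ⟨hx.1, hx.2.trans_lt ht.2⟩
  have hz := h.1.mono hsub
  have hy := h'.1.mono hsub
  obtain ⟨B1, hB1⟩ := (isCompact_Icc.bddAbove_image hz.norm)
  obtain ⟨B2, hB2⟩ := (isCompact_Icc.bddAbove_image hy.norm)
  set B := max B1 B2
  have hzB : ∀ s ∈ Set.Icc 0 t, z s ∈ Metric.closedBall (0:ℝ) B := fun s hs => by
    rw [mem_closedBall_zero_iff]
    exact (hB1 ⟨s, hs, rfl⟩).trans (le_max_left _ _)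
  have hyB : ∀ s ∈ Set.Icc 0 t, y s ∈ Metric.closedBall (0:ℝ) B := fun s hs => by
    rw [mem_closedBall_zero_iff]
    exact (hB2 ⟨s, hs, rfl⟩).trans (le_max_right _ _)
  have hloc : LocallyLipschitz (fun p : ℝ × ℝ => C * Φ p.1 p.2) :=
    (contDiff_const.mul hΦ).locallyLipschitz
  obtain ⟨K, hK⟩ := (hloc.locallyLipschitzOn
    (s := Set.Icc 0 t ×ˢ Metric.closedBall (0:ℝ) B)).exists_lipschitzOnWith_of_compact
    (isCompact_Icc.prod (isCompact_closedBall _ _))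
  have hL : ∀ s ∈ Set.Ico 0 t, LipschitzOnWith K (fun x => C * Φ s x)
      (Metric.closedBall (0:ℝ) B) := by
    intro s hs
    have hss : s ∈ Set.Icc 0 t := Set.Ico_subset_Icc_self hs
    intro u hu v hv
    have := hK (x := (s, u)) ⟨hss, hu⟩ (y := (s, v)) ⟨hss, hv⟩
    simpa [Prod.edist_eq] using this
  have h0 : (0:ℝ) ∈ Set.Ico 0 T := ⟨le_rfl, ht.1.trans_lt ht.2⟩
  refine ODE_solution_unique_of_mem_Icc_right (v := fun s x => C * Φ s x) (K := K)
    (s := fun _ => Metric.closedBall (0:ℝ) B) hL hz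
    (fun s hs => h.deriv hΦ (hsub (Set.Ico_subset_Icc_self hs)))
    (fun s hs => hzB s (Set.Ico_subset_Icc_self hs)) hy
    (fun s hs => h'.deriv hΦ (hsub (Set.Ico_subset_Icc_self hs)))
    (fun s hs => hyB s (Set.Ico_subset_Icc_self hs)) ?_ ⟨ht.1, le_rfl⟩
  rw [h.2 0 h0, h'.2 0 h0]
  simp

theorem SolOn.ge {a C : ℝ} {Φ : ℝ → ℝ → ℝ} {T : ℝ} {z : ℝ → ℝ} (hC : 0 ≤ C)
    (hpos : ∀ s x, 0 ≤ Φ s x) (h : SolOn a C Φ T z) {t : ℝ}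
    (ht : t ∈ Set.Ico 0 T) : a ≤ z t := by
  rw [h.2 t ht]
  have : 0 ≤ ∫ s in (0:ℝ)..t, Φ s (z s) :=
    intervalIntegral.integral_nonneg ht.1 (fun s _ => hpos _ _)
  nlinarith

theorem SolOn.le_one {a C : ℝ} {Φ : ℝ → ℝ → ℝ} {T : ℝ} {z : ℝ → ℝ} (hC : 1 ≤ C) (ha : 1 ≤ a)
    (hΦ : ContDiff ℝ 1 (fun p : ℝ × ℝ => Φ p.1 p.2))
    (hpos : ∀ s x, 0 ≤ Φ s x) (hexp : ∀ s x, 0 ≤ s → 1 ≤ x → rexp x ≤ Φ s x)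
    (h : SolOn a C Φ T z) : T ≤ 1 / C := by
  by_contra hT
  push Not at hT
  have hC0 : 0 < C := by linarith
  have hC1 : 0 ≤ 1 / C := by positivity
  have hsub : Set.Icc (0:ℝ) (1/C) ⊆ Set.Ico 0 T := fun x hx => ⟨hx.1, hx.2.trans_lt hT⟩
  have hz := h.1.mono hsub
  have key := image_le_of_deriv_right_le_deriv_boundary (a := 0) (b := 1/C)
    (f := fun t => rexp (- z t)) (f' := fun t => rexp (- z t) * (-(C * Φ t (z t))))
    (B := fun t => rexp (- a) - C * t) (B' := fun _ => -C)
    (Real.continuous_exp.comp_continuousOn hz.neg)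
    (fun x hx => ((h.deriv hΦ (hsub (Set.Ico_subset_Icc_self hx))).neg).exp)
    (by
      have : z 0 = a := by rw [h.2 0 (hsub ⟨le_rfl, hC1⟩)]; simp
      simp [this])
    (by fun_prop)
    (fun x hx => by
      have := (((hasDerivAt_id x).const_mul C).const_sub (rexp (-a))).hasDerivWithinAt
        (s := Set.Ici x)
      simpa using this)
    (fun x hx => by
      have hx' := hsub (Set.Ico_subset_Icc_self hx)
      have h1 : 1 ≤ z x := ha.trans (h.ge (by linarith) hpos hx')
      have h2 := hexp x (z x) hx.1 h1
      have h3 : rexp (- z x) * rexp (z x) = 1 := by rw [← Real.exp_add]; simp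
      have h4 := Real.exp_pos (- z x)
      have h5 : C * rexp (z x) ≤ C * Φ x (z x) := by nlinarith [hpos x (z x)]
      nlinarith)
    (x := 1/C) ⟨hC1, le_rfl⟩
  have key' : rexp (-z (1/C)) ≤ rexp (-a) - C * (1/C) := key
  have h1 := Real.exp_pos (-z (1/C))
  have h2 : rexp (-a) ≤ 1 := Real.exp_le_one_iff.2 (by linarith)
  have h3 : C * (1 / C) = 1 := by field_simp
  linarith

theorem SolOn.exists_local {a C : ℝ} {Φ : ℝ → ℝ → ℝ}
    (hΦ : ContDiff ℝ 1 (fun p : ℝ × ℝ => Φ p.1 p.2)) :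
    ∃ T > 0, ∃ z, SolOn a C Φ T z := by
  have hF : ContDiff ℝ 1 (fun p : ℝ × ℝ => ((1:ℝ), C * Φ p.1 p.2)) :=
    contDiff_const.prodMk (contDiff_const.mul hΦ)
  obtain ⟨α, hα0, ε, hε, hα⟩ :=
    ContDiffAt.exists_forall_mem_closedBall_exists_eq_forall_mem_Ioo_hasDerivAt₀
      (hF.contDiffAt (x := ((0:ℝ), a))) 0
  have hd : ∀ t ∈ Set.Ioo (-ε) ε, HasDerivAt α ((1:ℝ), C * Φ (α t).1 (α t).2) t := by
    intro t ht
    exact hα t (by simpa using ht)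
  have h1 : ∀ t ∈ Set.Ioo (-ε) ε, HasDerivAt (fun t => (α t).1) 1 t := fun t ht => by
    have := (hasFDerivAt_fst (𝕜 := ℝ) (p := α t)).comp_hasDerivAt t (hd t ht)
    simpa [Function.comp_def] using this
  have h2 : ∀ t ∈ Set.Ioo (-ε) ε, HasDerivAt (fun t => (α t).2) (C * Φ (α t).1 (α t).2) t :=
    fun t ht => by
    have := (hasFDerivAt_snd (𝕜 := ℝ) (p := α t)).comp_hasDerivAt t (hd t ht)
    simpa [Function.comp_def] using this
  have h0 : (0:ℝ) ∈ Set.Ioo (-ε) ε := ⟨by linarith, hε⟩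
  have hfst : ∀ t ∈ Set.Ioo (-ε) ε, (α t).1 = t := by
    intro t ht
    have hc := (convex_Ioo (-ε) ε).is_const_of_fderivWithin_eq_zero
      (𝕜 := ℝ) (f := fun t => (α t).1 - t)
      (fun s hs => ((h1 s hs).sub (hasDerivAt_id s)).differentiableAt.differentiableWithinAt)
      (fun s hs => by
        have hh : HasDerivAt (fun t => (α t).1 - t) 0 s := by
          have h := (h1 s hs).sub (hasDerivAt_id s)
          rw [sub_self] at h
          exact h
        have := hh.hasFDerivAt.hasFDerivWithinAt (s := Set.Ioo (-ε) ε)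
        rw [this.fderivWithin (isOpen_Ioo.uniqueDiffWithinAt hs)]
        ext; simp) ht h0
    simp only [hα0] at hc
    linarith
  refine ⟨ε, hε, fun t => (α t).2, ?_, ?_⟩
  · intro t ht
    exact (h2 t ⟨by linarith [ht.1], ht.2⟩).continuousAt.continuousWithinAt
  · intro t ht
    have hsub : Set.uIcc 0 t ⊆ Set.Ioo (-ε) ε := by
      rw [Set.uIcc_of_le ht.1]
      exact fun x hx => ⟨by linarith [hx.1], hx.2.trans_lt ht.2⟩
    have hcz : ContinuousOn (fun t => (α t).2) (Set.uIcc 0 t) := fun s hs =>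
      (h2 s (hsub hs)).continuousAt.continuousWithinAt
    have hcont : ContinuousOn (fun s => C * Φ s (α s).2) (Set.uIcc 0 t) :=
      continuousOn_const.mul (hΦ.continuous.comp_continuousOn (continuousOn_id.prodMk hcz))
    have := intervalIntegral.integral_eq_sub_of_hasDerivAt (a := 0) (b := t)
      (f := fun t => (α t).2) (f' := fun s => C * Φ s (α s).2)
      (fun s hs => by
        have := h2 s (hsub hs)
        rwa [hfst s (hsub hs)] at this) hcont.intervalIntegrable
    rw [intervalIntegral.integral_const_mul] at this
    rw [this, hα0]
    ring

theorem SolOn.exists_max {a C : ℝ} {Φ : ℝ → ℝ → ℝ} (hC : 1 ≤ C) (ha : 1 ≤ a)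
    (hΦ : ContDiff ℝ 1 (fun p : ℝ × ℝ => Φ p.1 p.2))
    (hpos : ∀ s x, 0 ≤ Φ s x) (hexp : ∀ s x, 0 ≤ s → 1 ≤ x → rexp x ≤ Φ s x) :
    ∃ T0, 0 < T0 ∧ T0 ≤ 1 / C ∧ ∃ z, SolOn a C Φ T0 z ∧
      ∀ T' z', SolOn a C Φ T' z' → T' ≤ T0 := by
  obtain ⟨T1, hT1, z1, hz1⟩ := SolOn.exists_local (a := a) (C := C) hΦ
  set S : Set ℝ := {T' | ∃ z', SolOn a C Φ T' z'} with hS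
  have hbdd : BddAbove S := ⟨1 / C, fun T' ⟨z', hz'⟩ => hz'.le_one hC ha hΦ hpos hexp⟩
  have hne : S.Nonempty := ⟨T1, z1, hz1⟩
  have hex : ∀ t, t < sSup S → ∃ T', t < T' ∧ ∃ z', SolOn a C Φ T' z' := by
    intro t ht
    obtain ⟨T', hT', h⟩ := exists_lt_of_lt_csSup hne ht
    exact ⟨T', h, hT'⟩
  choose! τ hτ ζ hζ using hex
  refine ⟨sSup S, hT1.trans_le (le_csSup hbdd ⟨z1, hz1⟩),
    csSup_le hne (fun T' ⟨z', hz'⟩ => hz'.le_one hC ha hΦ hpos hexp),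
    fun t => ζ t t, ?_, fun T' z' h => le_csSup hbdd ⟨z', h⟩⟩
  have hag : ∀ b, b < sSup S → ∀ t ∈ Set.Icc 0 b, ζ t t = ζ b t := by
    intro b hb t ht
    have htS := ht.2.trans_lt hb
    exact ((hζ t htS).mono (min_le_left (τ t) (τ b))).unique hΦ
      ((hζ b hb).mono (min_le_right _ _)) ⟨ht.1, lt_min (hτ t htS) (ht.2.trans_lt (hτ b hb))⟩
  constructor
  · intro t ht
    obtain ⟨b, hb1, hb2⟩ := exists_between ht.2
    have hc : ContinuousWithinAt (ζ b) (Set.Icc 0 b) t :=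
      ((hζ b hb2).1 t ⟨ht.1, hb1.trans (hτ b hb2)⟩).mono
        (fun x hx => ⟨hx.1, hx.2.trans_lt (hτ b hb2)⟩)
    have hc' : ContinuousWithinAt (fun t => ζ t t) (Set.Icc 0 b) t :=
      hc.congr (fun x hx => hag b hb2 x hx) (hag b hb2 t ⟨ht.1, hb1.le⟩)
    refine hc'.mono_of_mem_nhdsWithin ?_
    have : Set.Icc 0 b = Set.Ici 0 ∩ Set.Iic b := rfl
    rw [this]
    refine inter_mem ?_ (mem_nhdsWithin_of_mem_nhds (Iic_mem_nhds hb1))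
    exact mem_of_superset self_mem_nhdsWithin (fun x hx => hx.1)
  · intro t ht
    simp only
    rw [(hζ t ht.2).2 t ⟨ht.1, hτ t ht.2⟩]
    congr 2
    apply intervalIntegral.integral_congr
    intro s hs
    rw [Set.uIcc_of_le ht.1] at hs
    simp only
    rw [hag t ht.2 s hs]

/-! ### Part B: velocity averages -/

theorem w_pos (v : E3) : 0 < w v := Real.sqrt_pos.2 (by positivity)

theorem one_le_w (v : E3) : 1 ≤ w v := by
  unfold w; rw [Real.one_le_sqrt]; nlinarith [norm_nonneg v]

theorem norm_le_w (v : E3) : ‖v‖ ≤ w v := by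
  unfold w; apply Real.le_sqrt_of_sq_le; linarith

theorem w_le (v : E3) : w v ≤ 1 + ‖v‖ := by
  unfold w; rw [Real.sqrt_le_left (by positivity)]; nlinarith [norm_nonneg v]

theorem continuous_w : Continuous w := by unfold w; fun_prop

theorem w_lip (v u : E3) : |w v - w u| ≤ ‖v - u‖ := by
  have h1 := w_pos v
  have h2 := w_pos u
  have hs1 : w v ^ 2 = 1 + ‖v‖ ^ 2 := Real.sq_sqrt (by positivity)
  have hs2 : w u ^ 2 = 1 + ‖u‖ ^ 2 := Real.sq_sqrt (by positivity)
  have h3 : (w v - w u) * (w v + w u) = (‖v‖ - ‖u‖) * (‖v‖ + ‖u‖) := by nlinarith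
  have h4 : |w v - w u| * (w v + w u) = |‖v‖ - ‖u‖| * (‖v‖ + ‖u‖) := by
    have := congrArg abs h3
    rwa [abs_mul, abs_mul, abs_of_pos (by linarith : 0 < w v + w u),
      abs_of_nonneg (by positivity : 0 ≤ ‖v‖ + ‖u‖)] at this
  have h5 : |‖v‖ - ‖u‖| ≤ ‖v - u‖ := abs_norm_sub_norm_le v u
  have h6 := norm_le_w v
  have h7 := norm_le_w u
  have h8 : |w v - w u| * (w v + w u) ≤ ‖v - u‖ * (w v + w u) := by
    rw [h4]
    apply mul_le_mul h5 (by linarith) (by positivity) (norm_nonneg _)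
  exact le_of_mul_le_mul_right h8 (by linarith)

theorem abs_coord_le (v : E3) (i : Fin 3) : |v i| ≤ ‖v‖ := by
  have := PiLp.norm_apply_le v i
  simpa using this

theorem norm_pt (r : ℝ) : ‖pt r‖ = |r| := by simp [pt]

theorem pt_sub (r s : ℝ) : ‖pt r - pt s‖ = |r - s| := by
  have : pt r - pt s = pt (r - s) := by
    ext i; fin_cases i <;> simp [pt]
  rw [this, norm_pt]

theorem continuous_pt : Continuous pt := by
  rw [Metric.continuous_iff]
  intro b ε hε
  refine ⟨ε, hε, fun a ha => ?_⟩
  rwa [dist_eq_norm, pt_sub, ← Real.norm_eq_abs, ← dist_eq_norm]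

/-- Volume of the ball of radius `z`. -/
def VB (z : ℝ) : ℝ := (volume (Metric.closedBall (0:E3) z)).toReal

theorem VB_nonneg (z : ℝ) : 0 ≤ VB z := ENNReal.toReal_nonneg

theorem int_bound {φ : E3 → ℝ} {c z : ℝ} (h0 : ∀ v, z < ‖v‖ → φ v = 0) (hb : ∀ v, ‖v‖ ≤ z → |φ v| ≤ c) :
    |∫ v, φ v| ≤ c * VB z := by
  have : ∫ v, φ v = ∫ v in Metric.closedBall (0:E3) z, φ v := by
    rw [setIntegral_eq_integral_of_forall_compl_eq_zero]
    intro v hv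
    apply h0
    simpa using hv
  rw [this, ← Real.norm_eq_abs]
  refine norm_setIntegral_le_of_norm_le_const (isCompact_closedBall _ _).measure_lt_top ?_
  intro v hv
  rw [Real.norm_eq_abs]
  exact hb v (by simpa using hv)

/-- Static bounds on a distribution function. -/
structure StatF (z R F D : ℝ) (f : E3 → E3 → ℝ) : Prop where
  supp : ∀ x v, f x v ≠ 0 → ‖x‖ ≤ R ∧ ‖v‖ ≤ z
  nonneg : ∀ x v, 0 ≤ f x v
  le : ∀ x v, f x v ≤ F
  lip : ∀ x v y u, |f x v - f y u| ≤ D * ‖((x, v) - (y, u) : E3 × E3)‖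

theorem StatF.cont {z R F D : ℝ} {f : E3 → E3 → ℝ} (h : StatF z R F D f) :
    Continuous (fun p : E3 × E3 => f p.1 p.2) := by
  have : LipschitzWith (Real.toNNReal D) (fun p : E3 × E3 => f p.1 p.2) := by
    apply LipschitzWith.of_dist_le_mul
    intro p p'
    rw [Real.dist_eq, dist_eq_norm]
    refine (h.lip p.1 p.2 p'.1 p'.2).trans ?_
    exact mul_le_mul_of_nonneg_right (Real.le_coe_toNNReal D) (norm_nonneg _)
  exact this.continuous

/-- The velocity average with weight `g`. -/
def avg (g : E3 → ℝ) (f : E3 → E3 → ℝ) (r : ℝ) : ℝ := ∫ v : E3, g v * f (pt r) v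

theorem StatF.integrable {z R F D : ℝ} {f : E3 → E3 → ℝ} (h : StatF z R F D f) {g : E3 → ℝ}
    (hg : Continuous g) (x : E3) : Integrable (fun v => g v * f x v) := by
  apply Continuous.integrable_of_hasCompactSupport
  · exact hg.mul (h.cont.comp (by fun_prop : Continuous fun v : E3 => (x, v)))
  · apply HasCompactSupport.intro (isCompact_closedBall (0:E3) z)
    intro v hv
    have : f x v = 0 := by
      by_contra hne
      exact hv (by simpa using (h.supp x v hne).2)
    simp [this]

theorem StatF.zero_of_lt {z R F D : ℝ} {f : E3 → E3 → ℝ} (h : StatF z R F D f) (x v : E3)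
    (hv : z < ‖v‖) : f x v = 0 := by
  by_contra hne
  exact absurd (h.supp x v hne).2 (not_le.2 hv)

theorem avg_bound {z R F D G : ℝ} {f : E3 → E3 → ℝ} (h : StatF z R F D f) {g : E3 → ℝ}
    (hG : ∀ v, ‖v‖ ≤ z → |g v| ≤ G) (r : ℝ) : |avg g f r| ≤ G * F * VB z := by
  refine int_bound (fun v hv => by rw [h.zero_of_lt _ _ hv, mul_zero]) (fun v hv => ?_)
  rw [abs_mul, abs_of_nonneg (h.nonneg _ _)]
  have := hG v hv
  exact mul_le_mul this (h.le _ _) (h.nonneg _ _) ((abs_nonneg _).trans this)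

theorem avg_lip {z R F D G : ℝ} {f : E3 → E3 → ℝ} (h : StatF z R F D f) {g : E3 → ℝ}
    (hg : Continuous g) (hG : ∀ v, ‖v‖ ≤ z → |g v| ≤ G) (r s : ℝ) :
    |avg g f r - avg g f s| ≤ G * D * VB z * |r - s| := by
  unfold avg
  rw [← integral_sub (h.integrable hg _) (h.integrable hg _)]
  have := int_bound (z := z) (c := G * (D * |r - s|)) (φ := fun v => g v * f (pt r) v - g v * f (pt s) v)
    (fun v hv => by simp [h.zero_of_lt _ _ hv]) (fun v hv => by
      rw [← mul_sub, abs_mul]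
      have h1 := h.lip (pt r) v (pt s) v
      have h2 : ‖((pt r, v) - (pt s, v) : E3 × E3)‖ = |r - s| := by
        simp [Prod.norm_def, pt_sub]
      rw [h2] at h1
      have := hG v hv
      exact mul_le_mul this h1 (abs_nonneg _) ((abs_nonneg _).trans this))
  refine this.trans (le_of_eq (by ring))

theorem avg_diff {z R F D G D2 : ℝ} {f f' : E3 → E3 → ℝ} (h : StatF z R F D f)
    (h' : StatF z R F D f') (hd : ∀ x v, |f x v - f' x v| ≤ D2) {g : E3 → ℝ}
    (hg : Continuous g) (hG : ∀ v, ‖v‖ ≤ z → |g v| ≤ G) (r : ℝ) :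
    |avg g f r - avg g f' r| ≤ G * D2 * VB z := by
  unfold avg
  rw [← integral_sub (h.integrable hg _) (h'.integrable hg _)]
  refine int_bound
    (fun v hv => by simp [h.zero_of_lt _ _ hv, h'.zero_of_lt _ _ hv]) (fun v hv => by
      rw [← mul_sub, abs_mul]
      have := hG v hv
      exact mul_le_mul this (hd _ _) (abs_nonneg _) ((abs_nonneg _).trans this))

theorem avg_zero {z R F D : ℝ} {f : E3 → E3 → ℝ} (h : StatF z R F D f) {g : E3 → ℝ} {r : ℝ}
    (hr : R < r) : avg g f r = 0 := by
  unfold avg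
  have : ∀ v, f (pt r) v = 0 := by
    intro v
    by_contra hne
    have := (h.supp _ _ hne).1
    rw [norm_pt] at this
    linarith [le_abs_self r]
  simp [this]

theorem avg_cont {z R F D G : ℝ} {f : E3 → E3 → ℝ} (h : StatF z R F D f) {g : E3 → ℝ}
    (hg : Continuous g) (hG : ∀ v, ‖v‖ ≤ z → |g v| ≤ G) : Continuous (avg g f) := by
  have : LipschitzWith (Real.toNNReal (G * D * VB z)) (avg g f) := by
    apply LipschitzWith.of_dist_le_mul
    intro p p'
    rw [Real.dist_eq, Real.dist_eq]
    refine (avg_lip h hg hG p p').trans ?_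
    exact mul_le_mul_of_nonneg_right (Real.le_coe_toNNReal _) (abs_nonneg _)
  exact this.continuous

theorem avg_nonneg {z R F D : ℝ} {f : E3 → E3 → ℝ} (h : StatF z R F D f) {g : E3 → ℝ}
    (hg : ∀ v, 0 ≤ g v) (r : ℝ) : 0 ≤ avg g f r :=
  integral_nonneg (fun v => mul_nonneg (hg v) (h.nonneg _ _))

/-- The four weights. -/
def g1 : E3 → ℝ := fun v => (v 0) ^ 2 / w v
def g2 : E3 → ℝ := fun v => v 0
def g3 : E3 → ℝ := fun _ => 1

theorem cont_coord : Continuous (fun v : E3 => v 0) := by fun_prop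

theorem g1_cont : Continuous g1 := (cont_coord.pow 2).div continuous_w (fun v => (w_pos v).ne')
theorem g2_cont : Continuous g2 := cont_coord
theorem g3_cont : Continuous g3 := continuous_const

theorem w_bd (z : ℝ) (v : E3) (hv : ‖v‖ ≤ z) : |w v| ≤ 1 + z := by
  rw [abs_of_pos (w_pos v)]; linarith [w_le v]

theorem g2_bd (z : ℝ) (v : E3) (hv : ‖v‖ ≤ z) : |g2 v| ≤ 1 + z := by
  have := abs_coord_le v 0
  unfold g2; linarith

theorem g3_bd (z : ℝ) (v : E3) (hv : ‖v‖ ≤ z) : |g3 v| ≤ 1 + z := by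
  have := norm_nonneg v
  simp only [g3, abs_one]; linarith

theorem g1_bd (z : ℝ) (v : E3) (hv : ‖v‖ ≤ z) : |g1 v| ≤ 1 + z := by
  have h1 := abs_coord_le v 0
  have h2 := norm_le_w v
  have h3 := w_pos v
  unfold g1
  rw [abs_div, abs_of_pos h3, div_le_iff₀ h3, abs_pow]
  nlinarith [abs_nonneg (v 0), norm_nonneg v]

theorem g1_nonneg (v : E3) : 0 ≤ g1 v := div_nonneg (sq_nonneg _) (w_pos v).le

theorem rho_eq (lam e : ℝ → ℝ → ℝ) (f : ℝ → E3 → E3 → ℝ) (t r : ℝ) :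
    rho lam e f t r = avg w (f t) r + (1/2) * (rexp (lam t r) * e t r) ^ 2 := by
  unfold rho avg
  have : rexp (2 * lam t r) = rexp (lam t r) ^ 2 := by rw [← Real.exp_nat_mul]; norm_num
  rw [this]; ring

theorem prs_eq (lam e : ℝ → ℝ → ℝ) (f : ℝ → E3 → E3 → ℝ) (t r : ℝ) :
    prs lam e f t r = avg g1 (f t) r - (1/2) * (rexp (lam t r) * e t r) ^ 2 := by
  unfold prs avg g1
  have : rexp (2 * lam t r) = rexp (lam t r) ^ 2 := by rw [← Real.exp_nat_mul]; norm_num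
  rw [this]; ring

theorem kk_eq (f : ℝ → E3 → E3 → ℝ) (t r : ℝ) : kk f t r = avg g2 (f t) r := rfl

theorem Mch_eq (f : ℝ → E3 → E3 → ℝ) (t r : ℝ) : Mch f t r = avg g3 (f t) r := by
  simp [Mch, avg, g3]

/-! ### Part C: radial Lipschitz calculus and bounds on the characteristic field -/

/-- Bounded and Lipschitz on `(0,ρ]` with constant `c`. -/
structure LipB (c ρ : ℝ) (g : ℝ → ℝ) : Prop where
  bd : ∀ r, 0 < r → r ≤ ρ → |g r| ≤ c
  lip : ∀ r s, 0 < r → r ≤ ρ → 0 < s → s ≤ ρ → |g r - g s| ≤ c * |r - s|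

theorem LipB.mono {c c' ρ : ℝ} {g : ℝ → ℝ} (h : LipB c ρ g) (hc : c ≤ c') : LipB c' ρ g :=
  ⟨fun r h1 h2 => (h.bd r h1 h2).trans hc, fun r s h1 h2 h3 h4 =>
    (h.lip r s h1 h2 h3 h4).trans (mul_le_mul_of_nonneg_right hc (abs_nonneg _))⟩

theorem LipB.congr {c ρ : ℝ} {g g' : ℝ → ℝ} (h : LipB c ρ g) (hg : ∀ r, 0 < r → g' r = g r) :
    LipB c ρ g' :=
  ⟨fun r h1 h2 => by rw [hg r h1]; exact h.bd r h1 h2, fun r s h1 h2 h3 h4 => by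
    rw [hg r h1, hg s h3]; exact h.lip r s h1 h2 h3 h4⟩

theorem LipB.add {c c' ρ : ℝ} {g g' : ℝ → ℝ} (h : LipB c ρ g) (h' : LipB c' ρ g') :
    LipB (c + c') ρ (fun r => g r + g' r) := by
  refine ⟨fun r h1 h2 => (abs_add_le _ _).trans (add_le_add (h.bd r h1 h2) (h'.bd r h1 h2)),
    fun r s h1 h2 h3 h4 => ?_⟩
  have e1 := h.lip r s h1 h2 h3 h4
  have e2 := h'.lip r s h1 h2 h3 h4
  have : g r + g' r - (g s + g' s) = (g r - g s) + (g' r - g' s) := by ring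
  rw [this]
  refine (abs_add_le _ _).trans ?_
  linarith

theorem LipB.mul {c c' ρ : ℝ} {g g' : ℝ → ℝ} (h : LipB c ρ g) (h' : LipB c' ρ g') :
    LipB (2 * c * c') ρ (fun r => g r * g' r) := by
  refine ⟨fun r h1 h2 => ?_, fun r s h1 h2 h3 h4 => ?_⟩
  · rw [abs_mul]
    have e1 := h.bd r h1 h2
    have e2 := h'.bd r h1 h2
    have e3 := abs_nonneg (g r)
    have e4 := abs_nonneg (g' r)
    have : |g r| * |g' r| ≤ c * c' := mul_le_mul e1 e2 e4 (e3.trans e1)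
    have : 0 ≤ c * c' := mul_nonneg (e3.trans e1) (e4.trans e2)
    linarith
  · have e1 := h.lip r s h1 h2 h3 h4
    have e2 := h'.lip r s h1 h2 h3 h4
    have e3 := h.bd s h3 h4
    have e4 := h'.bd r h1 h2
    have e5 : g r * g' r - g s * g' s = (g r - g s) * g' r + g s * (g' r - g' s) := by ring
    rw [e5]
    refine (abs_add_le _ _).trans ?_
    rw [abs_mul, abs_mul]
    have a1 : |g r - g s| * |g' r| ≤ (c * |r - s|) * c' :=
      mul_le_mul e1 e4 (abs_nonneg _) ((abs_nonneg _).trans e1)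
    have a2 : |g s| * |g' r - g' s| ≤ c * (c' * |r - s|) :=
      mul_le_mul e3 e2 (abs_nonneg _) ((abs_nonneg _).trans e3)
    linarith

theorem LipB.const (c ρ : ℝ) : LipB |c| ρ (fun _ => c) :=
  ⟨fun _ _ _ => le_rfl, fun r s _ _ _ _ => by simp; positivity⟩

theorem LipB.id (ρ : ℝ) : LipB (ρ + 1) ρ (fun r => r) :=
  ⟨fun r h1 h2 => by rw [abs_of_pos h1]; linarith, fun r s h1 h2 _ _ => by
    nlinarith [abs_nonneg (r - s)]⟩

theorem LipB.of_deriv {c ρ : ℝ} {g g' : ℝ → ℝ} (hb : ∀ r, 0 < r → r ≤ ρ → |g r| ≤ c)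
    (hd : ∀ r, 0 < r → r ≤ ρ → HasDerivAt g (g' r) r) (hb' : ∀ r, 0 < r → r ≤ ρ → |g' r| ≤ c) :
    LipB c ρ g := by
  refine ⟨hb, fun r s h1 h2 h3 h4 => ?_⟩
  have := (convex_Ioc 0 ρ).norm_image_sub_le_of_norm_hasDerivWithin_le (f := g) (f' := g') (C := c)
    (fun x hx => (hd x hx.1 hx.2).hasDerivWithinAt) (fun x hx => hb' x hx.1 hx.2)
    (x := s) (y := r) ⟨h3, h4⟩ ⟨h1, h2⟩
  simpa [Real.norm_eq_abs] using this

/-- Extension of the Lipschitz bound to `[0,ρ]` by continuity. -/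
theorem LipB.ext0 {c ρ : ℝ} {g : ℝ → ℝ} (h : LipB c ρ g) (hg : ContinuousOn g (Set.Ici 0))
    (hρ : 0 < ρ) {r s : ℝ} (hr : 0 ≤ r) (hr' : r ≤ ρ) (hs : 0 ≤ s) (hs' : s ≤ ρ) :
    |g r - g s| ≤ c * |r - s| := by
  have key : ∀ s, 0 < s → s ≤ ρ → |g 0 - g s| ≤ c * |0 - s| := by
    intro s hs hs'
    have h1 : Tendsto g (𝓝[>] 0) (𝓝 (g 0)) :=
      (hg 0 Set.self_mem_Ici).mono_left (nhdsWithin_mono _ Set.Ioi_subset_Ici_self)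
    have h2 : Tendsto (fun u : ℝ => u) (𝓝[>] 0) (𝓝 0) := tendsto_nhdsWithin_of_tendsto_nhds tendsto_id
    have h3 : Tendsto (fun u => |g u - g s|) (𝓝[>] 0) (𝓝 |g 0 - g s|) := (h1.sub_const _).abs
    have h4 : Tendsto (fun u => c * |u - s|) (𝓝[>] 0) (𝓝 (c * |0 - s|)) :=
      ((h2.sub_const _).abs).const_mul c
    refine le_of_tendsto_of_tendsto h3 h4 ?_
    filter_upwards [Ioc_mem_nhdsGT hρ] with u hu
    exact h.lip u s hu.1 hu.2 hs hs'
  rcases hr.eq_or_lt with h0 | h0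
  · subst h0
    rcases hs.eq_or_lt with h1 | h1
    · subst h1; simp
    · exact key s h1 hs'
  · rcases hs.eq_or_lt with h1 | h1
    · subst h1
      rw [abs_sub_comm, abs_sub_comm r]
      exact key r h0 hr'
    · exact h.lip r s h0 hr' h1 hs'

theorem ftc_pos {φ : ℝ → ℝ} (hφ : ContinuousOn φ (Set.Ici 0)) {r : ℝ} (hr : 0 < r) :
    HasDerivAt (fun u => ∫ s in (0:ℝ)..u, φ s) (φ r) r := by
  refine intervalIntegral.integral_hasDerivAt_right ?_ ?_ ?_
  · apply ContinuousOn.intervalIntegrable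
    rw [Set.uIcc_of_le hr.le]
    exact hφ.mono (fun x hx => hx.1)
  · refine ⟨Set.Ici 0, Ici_mem_nhds hr, hφ.aestronglyMeasurable measurableSet_Ici⟩
  · exact hφ.continuousAt (Ici_mem_nhds hr)

theorem ii_of_cont {φ : ℝ → ℝ} (hφ : ContinuousOn φ (Set.Ici 0)) {a r : ℝ} (ha : 0 ≤ a) (hr : 0 ≤ r) :
    IntervalIntegrable φ volume a r := by
  apply ContinuousOn.intervalIntegrable
  exact hφ.mono (fun x hx => (le_min ha hr).trans hx.1)

theorem prim_bound {φ : ℝ → ℝ} {c r : ℝ} (hr : 0 ≤ r) (hb : ∀ s, 0 < s → s ≤ r → |φ s| ≤ c) :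
    |∫ s in (0:ℝ)..r, φ s| ≤ c * r := by
  have := intervalIntegral.norm_integral_le_of_norm_le_const (a := 0) (b := r) (f := φ) (C := c)
    (fun x hx => by rw [Set.uIoc_of_le hr] at hx; exact hb x hx.1 hx.2)
  simpa [abs_of_nonneg hr] using this

/-- `ε(r) = q r⁻² ∫₀ʳ s² e^{λ} M`. -/
def epsf (q : ℝ) (lam M : ℝ → ℝ) (r : ℝ) : ℝ :=
  q / r ^ 2 * ∫ s in (0:ℝ)..r, s ^ 2 * rexp (lam s) * M s

theorem exp_le_of {l z : ℝ} (h0 : 0 ≤ l) (h : rexp (2 * l) ≤ z) : rexp l ≤ z :=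
  (Real.exp_le_exp.2 (by linarith)).trans h

section eps
variable {q z R bb : ℝ} {lam M : ℝ → ℝ}

theorem eps_cont (hlam : ContinuousOn lam (Set.Ici 0)) (hM : Continuous M) :
    ContinuousOn (fun s => s ^ 2 * rexp (lam s) * M s) (Set.Ici 0) :=
  ((continuousOn_id.pow 2).mul hlam.rexp).mul hM.continuousOn

theorem eps_int_bound (hl0 : ∀ r, 0 ≤ r → 0 ≤ lam r)
    (hlz : ∀ r, 0 ≤ r → rexp (2 * lam r) ≤ z) (hMb : ∀ r, |M r| ≤ bb) {r : ℝ} (hr : 0 < r) :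
    |∫ s in (0:ℝ)..r, s ^ 2 * rexp (lam s) * M s| ≤ z * bb * r ^ 3 := by
  have := prim_bound (φ := fun s => s ^ 2 * rexp (lam s) * M s) (c := r ^ 2 * z * bb) hr.le
    (fun s hs hsr => by
      rw [abs_mul, abs_mul, abs_of_pos (Real.exp_pos _), abs_of_nonneg (sq_nonneg s)]
      have e1 := exp_le_of (hl0 s hs.le) (hlz s hs.le)
      have e2 := Real.exp_pos (lam s)
      have e3 : s ^ 2 ≤ r ^ 2 := by gcongr
      have := hMb s
      have hz : 0 ≤ z := e2.le.trans e1
      gcongr)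
  refine this.trans (le_of_eq (by ring))

theorem eps_bd (hl0 : ∀ r, 0 ≤ r → 0 ≤ lam r)
    (hlz : ∀ r, 0 ≤ r → rexp (2 * lam r) ≤ z) (hMb : ∀ r, |M r| ≤ bb) {r : ℝ} (hr : 0 < r) :
    |epsf q lam M r| ≤ |q| * (z * bb) * r := by
  unfold epsf
  have h := eps_int_bound hl0 hlz hMb hr
  rw [abs_mul, abs_div, abs_of_pos (by positivity : 0 < r ^ 2), div_mul_eq_mul_div,
    div_le_iff₀ (by positivity)]
  calc _ ≤ |q| * (z * bb * r ^ 3) := by gcongr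
    _ = _ := by ring

theorem eps_int_const (hlam : ContinuousOn lam (Set.Ici 0)) (hM : Continuous M) (hR : 0 ≤ R)
    (hM0 : ∀ r, R < r → M r = 0) {r : ℝ} (hr : R ≤ r) :
    ∫ s in (0:ℝ)..r, s ^ 2 * rexp (lam s) * M s = ∫ s in (0:ℝ)..R, s ^ 2 * rexp (lam s) * M s := by
  have hc := eps_cont hlam hM
  rw [← intervalIntegral.integral_add_adjacent_intervals (ii_of_cont hc le_rfl hR)
    (ii_of_cont hc hR (hR.trans hr))]
  have : ∫ s in R..r, s ^ 2 * rexp (lam s) * M s = 0 := by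
    apply intervalIntegral.integral_zero_ae
    refine Eventually.of_forall (fun s hs => ?_)
    rw [Set.uIoc_of_le hr] at hs
    rw [hM0 s hs.1, mul_zero]
  rw [this, add_zero]

theorem eps_bd2 (hlam : ContinuousOn lam (Set.Ici 0)) (hM : Continuous M)
    (hl0 : ∀ r, 0 ≤ r → 0 ≤ lam r)
    (hlz : ∀ r, 0 ≤ r → rexp (2 * lam r) ≤ z) (hMb : ∀ r, |M r| ≤ bb) (hR : 0 < R)
    (hM0 : ∀ r, R < r → M r = 0) {r : ℝ} (hr : 0 < r) :
    |epsf q lam M r| * r ^ 2 ≤ |q| * (z * bb) * R ^ 3 := by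
  have hbb : 0 ≤ bb := (abs_nonneg _).trans (hMb 0)
  have hz : 0 ≤ z := (Real.exp_pos _).le.trans (hlz 0 le_rfl)
  have h : |∫ s in (0:ℝ)..r, s ^ 2 * rexp (lam s) * M s| ≤ z * bb * R ^ 3 := by
    rcases le_total r R with h | h
    · refine (eps_int_bound hl0 hlz hMb hr).trans ?_
      gcongr
    · rw [eps_int_const hlam hM hR.le hM0 h]
      exact eps_int_bound hl0 hlz hMb hR
  unfold epsf
  rw [abs_mul, abs_div, abs_of_pos (by positivity : 0 < r ^ 2), div_mul_eq_mul_div,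
    div_mul_cancel₀ _ (by positivity : r ^ 2 ≠ 0)]
  calc _ ≤ |q| * (z * bb * R ^ 3) := by gcongr
    _ = _ := by ring

theorem eps_deriv (hlam : ContinuousOn lam (Set.Ici 0)) (hM : Continuous M) {r : ℝ} (hr : 0 < r) :
    HasDerivAt (epsf q lam M) (q * rexp (lam r) * M r - 2 * epsf q lam M r / r) r := by
  have h1 := ftc_pos (eps_cont hlam hM) hr
  have h2 : HasDerivAt (fun u : ℝ => q / u ^ 2) (- (2 * q) / r ^ 3) r := by
    have := (hasDerivAt_const r q).div (hasDerivAt_pow 2 r) (by positivity)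
    refine this.congr_deriv ?_
    field_simp
    norm_num
    ring
  refine (h2.mul h1).congr_deriv ?_
  unfold epsf
  field_simp
  ring

theorem eps_lip (hlam : ContinuousOn lam (Set.Ici 0)) (hM : Continuous M)
    (hl0 : ∀ r, 0 ≤ r → 0 ≤ lam r)
    (hlz : ∀ r, 0 ≤ r → rexp (2 * lam r) ≤ z) (hMb : ∀ r, |M r| ≤ bb) {ρ : ℝ} (hρ : 0 < ρ) :
    LipB (|q| * (z * bb) * (3 + ρ)) ρ (epsf q lam M) := by
  have hbb : 0 ≤ bb := (abs_nonneg _).trans (hMb 0)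
  have hz : 0 ≤ z := (Real.exp_pos _).le.trans (hlz 0 le_rfl)
  have hb1 : 0 ≤ |q| * (z * bb) := by positivity
  refine LipB.of_deriv (g' := fun r => q * rexp (lam r) * M r - 2 * epsf q lam M r / r)
    (fun r h1 h2 => ?_) (fun r h1 h2 => eps_deriv hlam hM h1) (fun r h1 h2 => ?_)
  · refine (eps_bd hl0 hlz hMb h1).trans ?_
    apply mul_le_mul_of_nonneg_left _ hb1
    linarith
  · refine (abs_sub _ _).trans ?_
    have e1 : |q * rexp (lam r) * M r| ≤ |q| * (z * bb) := by
      rw [abs_mul, abs_mul, abs_of_pos (Real.exp_pos _), mul_assoc]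
      have e1 := exp_le_of (hl0 r h1.le) (hlz r h1.le)
      have := hMb r
      gcongr
    have e2 : |2 * epsf q lam M r / r| ≤ 2 * (|q| * (z * bb)) := by
      rw [abs_div, abs_mul, abs_of_pos h1, abs_two, div_le_iff₀ h1, mul_assoc]
      have := eps_bd (q := q) hl0 hlz hMb h1
      linarith
    nlinarith
end eps

/-- The static bounds on the metric coefficients at one fixed time. -/
structure StatM (z ρ b : ℝ) (lam mu lamT e rh p k : ℝ → ℝ) : Prop where
  lamc : ContinuousOn lam (Set.Ici 0)
  muc : ContinuousOn mu (Set.Ici 0)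
  lamd : ∀ r, 0 < r → DifferentiableAt ℝ lam r
  mud : ∀ r, 0 < r → DifferentiableAt ℝ mu r
  lam0 : ∀ r, 0 ≤ r → 0 ≤ lam r
  lamz : ∀ r, 0 ≤ r → rexp (2 * lam r) ≤ z
  laminf : Tendsto lam atTop (𝓝 0)
  muinf : Tendsto mu atTop (𝓝 0)
  rhc : ContinuousOn rh (Set.Ici 0)
  rp : ∀ r, 0 < r → 0 ≤ rh r + p r
  rhb : LipB b ρ rh
  pb : LipB b ρ p
  kb : LipB b ρ k
  eb : LipB b ρ (fun r => rexp (lam r) * e r)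
  er : ∀ r, 0 < r → r ≤ ρ → |rexp (lam r) * e r| ≤ b * r
  hlam : ∀ r, 0 < r → rexp (-2 * lam r) = 1 - 2 * (4 * π * ∫ s in (0:ℝ)..r, s ^ 2 * rh s) / r
  hmu : ∀ r, 0 < r → deriv mu r = rexp (2 * lam r) *
    ((4 * π * ∫ s in (0:ℝ)..r, s ^ 2 * rh s) / r ^ 2 + 4 * π * r * p r)
  hlamT : ∀ r, lamT r = -(4 * π) * r * rexp (lam r + mu r) * k r

namespace StatM
variable {z ρ b : ℝ} {lam mu lamT e rh p k : ℝ → ℝ}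

theorem s2c (h : StatM z ρ b lam mu lamT e rh p k) :
    ContinuousOn (fun s => s ^ 2 * rh s) (Set.Ici 0) := (continuousOn_id.pow 2).mul h.rhc

theorem mderiv (h : StatM z ρ b lam mu lamT e rh p k) {r : ℝ} (hr : 0 < r) :
    HasDerivAt (fun u => 4 * π * ∫ s in (0:ℝ)..u, s ^ 2 * rh s) (4 * π * (r ^ 2 * rh r)) r :=
  (ftc_pos h.s2c hr).const_mul _

theorem lderiv (h : StatM z ρ b lam mu lamT e rh p k) {r : ℝ} (hr : 0 < r) :
    deriv lam r = rexp (2 * lam r) *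
      (4 * π * r * rh r - (4 * π * ∫ s in (0:ℝ)..r, s ^ 2 * rh s) / r ^ 2) := by
  have h1 : HasDerivAt (fun u => rexp (-2 * lam u)) (rexp (-2 * lam r) * (-2 * deriv lam r)) r :=
    ((h.lamd r hr).hasDerivAt.const_mul (-2)).exp
  have h2 := ((h.mderiv hr).const_mul 2).div (hasDerivAt_id r) hr.ne'
  have h3 := h2.const_sub 1
  have h4 : (fun u => rexp (-2 * lam u)) =ᶠ[𝓝 r] fun u =>
      1 - 2 * (4 * π * ∫ s in (0:ℝ)..u, s ^ 2 * rh s) / u := by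
    filter_upwards [lt_mem_nhds hr] with u hu using h.hlam u hu
  have h5 := (h3.congr_of_eventuallyEq h4).unique h1
  have h6 : rexp (2 * lam r) * rexp (-2 * lam r) = 1 := by rw [← Real.exp_add]; simp
  simp only [id] at h5
  set m := 4 * π * ∫ s in (0:ℝ)..r, s ^ 2 * rh s
  have h7 : rexp (-2 * lam r) * deriv lam r = 4 * π * r * rh r - m / r ^ 2 := by
    have : rexp (-2 * lam r) * (-2 * deriv lam r) = -2 * (4 * π * r * rh r - m / r ^ 2) := by
      rw [← h5]; field_simp
    linarith
  rw [← h7, ← mul_assoc, h6, one_mul]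

theorem mb (h : StatM z ρ b lam mu lamT e rh p k) {r : ℝ} (hr : 0 < r) (hr' : r ≤ ρ) :
    |4 * π * ∫ s in (0:ℝ)..r, s ^ 2 * rh s| ≤ 4 * π * b * r ^ 3 := by
  have := prim_bound (φ := fun s => s ^ 2 * rh s) (c := r ^ 2 * b) hr.le (fun s hs hsr => by
      rw [abs_mul, abs_of_nonneg (sq_nonneg s)]
      have := h.rhb.bd s hs (hsr.trans hr')
      gcongr)
  rw [abs_mul, abs_of_pos (by positivity)]
  calc _ ≤ 4 * π * (r ^ 2 * b * r) := by gcongr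
    _ = _ := by ring

theorem bnn (h : StatM z ρ b lam mu lamT e rh p k) (hρ : 0 < ρ) : 0 ≤ b :=
  (abs_nonneg _).trans (h.rhb.bd ρ hρ le_rfl)

theorem mb2 (h : StatM z ρ b lam mu lamT e rh p k) {r : ℝ} (hr : 0 < r) (hr' : r ≤ ρ) :
    |(4 * π * ∫ s in (0:ℝ)..r, s ^ 2 * rh s) / r ^ 2| ≤ 4 * π * b * r := by
  rw [abs_div, abs_of_pos (by positivity : 0 < r ^ 2), div_le_iff₀ (by positivity)]
  refine (h.mb hr hr').trans (le_of_eq (by ring))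

theorem expb (h : StatM z ρ b lam mu lamT e rh p k) {r X c : ℝ} (hr : 0 < r) (hX : |X| ≤ c) :
    |rexp (2 * lam r) * X| ≤ z * c := by
  rw [abs_mul, abs_of_pos (Real.exp_pos _)]
  have h1 := h.lamz r hr.le
  have h2 := Real.exp_pos (2 * lam r)
  exact mul_le_mul h1 hX (abs_nonneg _) (h2.le.trans h1)

theorem mu'b (h : StatM z ρ b lam mu lamT e rh p k) {r : ℝ} (hr : 0 < r) (hr' : r ≤ ρ) :
    |deriv mu r| ≤ z * (8 * π * b * r) := by
  rw [h.hmu r hr]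
  apply h.expb hr
  refine (abs_add_le _ _).trans ?_
  have h1 := h.mb2 hr hr'
  have h2 : |4 * π * r * p r| ≤ 4 * π * r * b := by
    rw [abs_mul, abs_of_pos (by positivity)]
    have := h.pb.bd r hr hr'
    gcongr
  linarith

theorem lam'b (h : StatM z ρ b lam mu lamT e rh p k) {r : ℝ} (hr : 0 < r) (hr' : r ≤ ρ) :
    |deriv lam r| ≤ z * (8 * π * b * r) := by
  rw [h.lderiv hr]
  apply h.expb hr
  refine (abs_sub _ _).trans ?_
  have h1 := h.mb2 hr hr'
  have h2 : |4 * π * r * rh r| ≤ 4 * π * r * b := by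
    rw [abs_mul, abs_of_pos (by positivity)]
    have := h.rhb.bd r hr hr'
    gcongr
  linarith

theorem sum_nonpos (h : StatM z ρ b lam mu lamT e rh p k) {r : ℝ} (hr : 0 ≤ r) :
    lam r + mu r ≤ 0 := by
  have hmono : MonotoneOn (fun r => lam r + mu r) (Set.Ici 0) := by
    apply monotoneOn_of_deriv_nonneg (convex_Ici 0) (h.lamc.add h.muc)
    · rw [interior_Ici]
      exact fun r hr => ((h.lamd r hr).add (h.mud r hr)).differentiableWithinAt
    · rw [interior_Ici]
      intro r hr
      have hr : 0 < r := hr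
      rw [deriv_add (h.lamd r hr) (h.mud r hr), h.lderiv hr, h.hmu r hr, ← mul_add]
      apply mul_nonneg (Real.exp_pos _).le
      have := mul_nonneg (by positivity : 0 ≤ 4 * π * r) (h.rp r hr)
      linarith
  have hlim : Tendsto (fun r => lam r + mu r) atTop (𝓝 0) := by
    simpa using h.laminf.add h.muinf
  refine ge_of_tendsto hlim ?_
  filter_upwards [eventually_ge_atTop r] with s hs
  exact hmono hr (hr.trans hs : (0:ℝ) ≤ s) hs

theorem lipE (h : StatM z ρ b lam mu lamT e rh p k) (hρ : 0 < ρ) (σ κ : ℝ) (hσ : |σ| ≤ 1) (hκ : |κ| ≤ 1)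
    (hle : ∀ r, 0 < r → κ * mu r + σ * lam r ≤ 0) :
    LipB (1 + z * (16 * π * b * ρ)) ρ (fun r => rexp (κ * mu r + σ * lam r)) := by
  have hb := h.bnn hρ
  have hz : 0 ≤ z := (Real.exp_pos _).le.trans (h.lamz 0 le_rfl)
  have hnn : 0 ≤ z * (16 * π * b * ρ) := by positivity
  refine LipB.of_deriv (g' := fun r => rexp (κ * mu r + σ * lam r) * (κ * deriv mu r + σ * deriv lam r))
    (fun r h1 h2 => ?_) (fun r h1 h2 => ?_) (fun r h1 h2 => ?_)
  · rw [abs_of_pos (Real.exp_pos _)]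
    have := Real.exp_le_one_iff.2 (hle r h1)
    linarith
  · exact (((h.mud r h1).hasDerivAt.const_mul κ).add ((h.lamd r h1).hasDerivAt.const_mul σ)).exp
  · rw [abs_mul, abs_of_pos (Real.exp_pos _)]
    have e1 := Real.exp_le_one_iff.2 (hle r h1)
    have e0 := Real.exp_pos (κ * mu r + σ * lam r)
    have e2 : |κ * deriv mu r + σ * deriv lam r| ≤ z * (16 * π * b * ρ) := by
      refine (abs_add_le _ _).trans ?_
      rw [abs_mul, abs_mul]
      have a1 := h.mu'b h1 h2
      have a2 := h.lam'b h1 h2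
      have a3 : |κ| * |deriv mu r| ≤ 1 * (z * (8 * π * b * r)) :=
        mul_le_mul hκ a1 (abs_nonneg _) zero_le_one
      have a4 : |σ| * |deriv lam r| ≤ 1 * (z * (8 * π * b * r)) :=
        mul_le_mul hσ a2 (abs_nonneg _) zero_le_one
      have a5 : z * (8 * π * b * r) ≤ z * (8 * π * b * ρ) := by gcongr
      linarith
    nlinarith [abs_nonneg (κ * deriv mu r + σ * deriv lam r)]

theorem lipP (h : StatM z ρ b lam mu lamT e rh p k) (hρ : 0 < ρ) :
    LipB (1 + z * (16 * π * b * ρ)) ρ (fun r => rexp (lam r + mu r)) :=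
  (h.lipE hρ 1 1 (by simp) (by simp) (fun r hr => by have := h.sum_nonpos hr.le; linarith)).congr
    (fun r _ => by ring_nf)

theorem mu_nonpos (h : StatM z ρ b lam mu lamT e rh p k) {r : ℝ} (hr : 0 ≤ r) : mu r ≤ 0 := by
  have := h.sum_nonpos hr
  have := h.lam0 r hr
  linarith

theorem lipMu (h : StatM z ρ b lam mu lamT e rh p k) (hρ : 0 < ρ) :
    LipB (1 + z * (16 * π * b * ρ)) ρ (fun r => rexp (mu r)) :=
  (h.lipE hρ 0 1 (by simp) (by simp) (fun r hr => by have := h.mu_nonpos hr.le; linarith)).congr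
    (fun r _ => by ring_nf)

theorem lipMi (h : StatM z ρ b lam mu lamT e rh p k) (hρ : 0 < ρ) :
    LipB (1 + z * (16 * π * b * ρ)) ρ (fun r => rexp (mu r - lam r)) :=
  (h.lipE hρ (-1) 1 (by simp) (by simp) (fun r hr => by
    have := h.mu_nonpos hr.le; have := h.lam0 r hr.le; linarith)).congr
    (fun r _ => by ring_nf)

theorem lipm (h : StatM z ρ b lam mu lamT e rh p k) (hρ : 0 < ρ) :
    LipB (4 * π * b * (3 + ρ)) ρ (fun r => (4 * π * ∫ s in (0:ℝ)..r, s ^ 2 * rh s) / r ^ 2) := by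
  have hb := h.bnn hρ
  refine LipB.of_deriv (g' := fun r => 4 * π * rh r - 2 * ((4 * π * ∫ s in (0:ℝ)..r, s ^ 2 * rh s) / r ^ 2) / r)
    (fun r h1 h2 => (h.mb2 h1 h2).trans ?_) (fun r h1 h2 => ?_) (fun r h1 h2 => ?_)
  · gcongr; linarith
  · refine ((h.mderiv h1).div (hasDerivAt_pow 2 r) (by positivity)).congr_deriv ?_
    field_simp
    norm_num
    ring
  · refine (abs_sub _ _).trans ?_
    have e1 : |4 * π * rh r| ≤ 4 * π * b := by
      rw [abs_mul, abs_of_pos (by positivity)]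
      have := h.rhb.bd r h1 h2
      gcongr
    have e2 : |2 * ((4 * π * ∫ s in (0:ℝ)..r, s ^ 2 * rh s) / r ^ 2) / r| ≤ 8 * π * b := by
      rw [abs_div, abs_mul, abs_of_pos h1, abs_two, div_le_iff₀ h1]
      have := h.mb2 h1 h2
      linarith
    have : 0 ≤ 4 * π * b * ρ := by positivity
    linarith

end StatM

/-! ### Part E: Lipschitz bounds for the characteristic field -/

theorem unit_diff (x y : E3) (hx : x ≠ 0) (hy : y ≠ 0) :
    ‖y‖ * ‖(1 / ‖x‖) • x - (1 / ‖y‖) • y‖ ≤ 2 * ‖x - y‖ := by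
  have hx' : ‖x‖ ≠ 0 := norm_ne_zero_iff.2 hx
  have hy' : ‖y‖ ≠ 0 := norm_ne_zero_iff.2 hy
  have h1 : ‖y‖ • ((1 / ‖x‖) • x - (1 / ‖y‖) • y) = ((‖y‖ - ‖x‖) * (1 / ‖x‖)) • x + (x - y) := by
    rw [smul_sub, smul_smul, smul_smul, sub_mul, sub_smul, mul_one_div_cancel hy', one_smul,
      mul_one_div_cancel hx', one_smul]
    abel
  have h2 := congrArg norm h1
  rw [norm_smul, norm_norm] at h2
  rw [h2]
  refine (norm_add_le _ _).trans ?_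
  have h3 : ‖((‖y‖ - ‖x‖) * (1 / ‖x‖)) • x‖ = |‖y‖ - ‖x‖| := by
    rw [norm_smul, norm_mul, Real.norm_eq_abs, Real.norm_eq_abs,
      abs_of_nonneg (by positivity : 0 ≤ 1 / ‖x‖)]
    field_simp
  have h4 := abs_norm_sub_norm_le y x
  rw [norm_sub_rev] at h4
  linarith

theorem unit_norm (x : E3) (hx : x ≠ 0) : ‖(1 / ‖x‖) • x‖ = 1 := by
  have hx' : ‖x‖ ≠ 0 := norm_ne_zero_iff.2 hx
  rw [norm_smul, Real.norm_eq_abs, abs_of_nonneg (by positivity : 0 ≤ 1 / ‖x‖)]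
  field_simp

theorem smul_unit_diff {g g' c d : ℝ} (x y : E3) (hx : x ≠ 0) (hy : y ≠ 0) (h : |g - g'| ≤ d)
    (h' : |g'| ≤ c * ‖y‖) :
    ‖g • ((1 / ‖x‖) • x) - g' • ((1 / ‖y‖) • y)‖ ≤ d + 2 * c * ‖x - y‖ := by
  have hy' : 0 < ‖y‖ := norm_pos_iff.2 hy
  have hc : 0 ≤ c := by
    by_contra hc
    have := abs_nonneg g'
    nlinarith
  have e1 : g • ((1 / ‖x‖) • x) - g' • ((1 / ‖y‖) • y) = (g - g') • ((1 / ‖x‖) • x) +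
      g' • ((1 / ‖x‖) • x - (1 / ‖y‖) • y) := by
    rw [sub_smul, smul_sub]; abel
  rw [e1]
  refine (norm_add_le _ _).trans ?_
  rw [norm_smul (g - g'), norm_smul g', unit_norm x hx, Real.norm_eq_abs, Real.norm_eq_abs, mul_one]
  have h1 := unit_diff x y hx hy
  have h2 : |g'| * ‖(1 / ‖x‖) • x - (1 / ‖y‖) • y‖ ≤ c * ‖y‖ * ‖(1 / ‖x‖) • x - (1 / ‖y‖) • y‖ :=
    mul_le_mul_of_nonneg_right h' (norm_nonneg _)
  nlinarith

theorem F1_norm {E : ℝ} (hE : |E| ≤ 1) (v : E3) : ‖(E / w v) • v‖ ≤ 1 := by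
  have h1 := w_pos v
  rw [norm_smul, Real.norm_eq_abs, abs_div, abs_of_pos h1, div_mul_eq_mul_div, div_le_one h1]
  have h2 := norm_le_w v
  nlinarith [norm_nonneg v, abs_nonneg E]

theorem F1_diff {E E' c : ℝ} (hE : |E'| ≤ 1) (hd : |E - E'| ≤ c) (v u : E3) :
    ‖(E / w v) • v - (E' / w u) • u‖ ≤ c + 2 * ‖v - u‖ := by
  have h1 := w_pos v
  have h2 := w_pos u
  have e1 : (E / w v) • v - (E' / w u) • u =
      ((E - E') / w v) • v + ((E' / w v) • (v - u) + (E' * (w u - w v) / (w v * w u)) • u) := by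
    have : E' * (w u - w v) / (w v * w u) = E' / w v - E' / w u := by field_simp
    rw [this, sub_smul, sub_div, sub_smul, smul_sub]; abel
  rw [e1]
  refine (norm_add_le _ _).trans (add_le_add ?_ ((norm_add_le _ _).trans ?_))
  · rw [norm_smul, Real.norm_eq_abs, abs_div, abs_of_pos h1, div_mul_eq_mul_div, div_le_iff₀ h1]
    have := norm_le_w v
    have := abs_nonneg (E - E')
    exact mul_le_mul hd (norm_le_w v) (norm_nonneg _) (by linarith)
  · have a1 : ‖(E' / w v) • (v - u)‖ ≤ ‖v - u‖ := by
      rw [norm_smul, Real.norm_eq_abs, abs_div, abs_of_pos h1]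
      have : |E'| / w v ≤ 1 := by rw [div_le_one h1]; linarith [one_le_w v]
      nlinarith [norm_nonneg (v - u)]
    have a2 : ‖(E' * (w u - w v) / (w v * w u)) • u‖ ≤ ‖v - u‖ := by
      rw [norm_smul, Real.norm_eq_abs, abs_div, abs_mul, abs_mul, abs_of_pos h1, abs_of_pos h2,
        div_mul_eq_mul_div, div_le_iff₀ (by positivity)]
      have b1 : |w u - w v| ≤ ‖v - u‖ := by rw [abs_sub_comm]; exact w_lip v u
      have b2 : |E'| * |w u - w v| ≤ 1 * ‖v - u‖ := mul_le_mul hE b1 (abs_nonneg _) zero_le_one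
      have b3 : ‖u‖ ≤ w v * w u := by nlinarith [one_le_w v, norm_le_w u]
      calc _ ≤ (1 * ‖v - u‖) * (w v * w u) := mul_le_mul b2 b3 (norm_nonneg _) (by positivity)
        _ = _ := by ring
    linarith

/-- Radial coefficient bounds. -/
structure RadC (c ρ : ℝ) (A : ℝ → ℝ) : Prop where
  lip : ∀ r s, 0 < r → r ≤ ρ → 0 < s → s ≤ ρ → |A r - A s| ≤ c * |r - s|
  lin : ∀ r, 0 < r → r ≤ ρ → |A r| ≤ c * r

theorem RadC.mono {c c' ρ : ℝ} {A : ℝ → ℝ} (h : RadC c ρ A) (hc : c ≤ c') : RadC c' ρ A :=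
  ⟨fun r s h1 h2 h3 h4 => (h.lip r s h1 h2 h3 h4).trans (by gcongr),
   fun r h1 h2 => (h.lin r h1 h2).trans (by gcongr)⟩

/-- The momentum field in terms of radial coefficients. -/
def gF (A B E : ℝ → ℝ) (x v : E3) : ℝ :=
  A ‖x‖ * ((inner ℝ x v : ℝ) / ‖x‖) + B ‖x‖ * w v - E ‖x‖

theorem gF_bd {c ρ Y : ℝ} {A B E : ℝ → ℝ} (hA : RadC c ρ A) (hB : RadC c ρ B) (hE : RadC c ρ E)
    {x v : E3} (hx : x ≠ 0) (hxρ : ‖x‖ ≤ ρ) (hv : ‖v‖ ≤ Y) :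
    |gF A B E x v| ≤ c * (2 + 2 * Y) * ‖x‖ := by
  have hx' : 0 < ‖x‖ := norm_pos_iff.2 hx
  have h1 := hA.lin _ hx' hxρ
  have h2 := hB.lin _ hx' hxρ
  have h3 := hE.lin _ hx' hxρ
  have h0 : 0 ≤ c * ‖x‖ := (abs_nonneg _).trans h1
  have h4 : |(inner ℝ x v : ℝ) / ‖x‖| ≤ Y := by
    rw [abs_div, abs_of_pos hx', div_le_iff₀ hx']
    have := abs_real_inner_le_norm x v
    nlinarith
  have h5 := w_bd Y v hv
  unfold gF
  have a1 : |A ‖x‖ * ((inner ℝ x v : ℝ) / ‖x‖)| ≤ c * ‖x‖ * Y := by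
    rw [abs_mul]; exact mul_le_mul h1 h4 (abs_nonneg _) h0
  have a2 : |B ‖x‖ * w v| ≤ c * ‖x‖ * (1 + Y) := by
    rw [abs_mul]; exact mul_le_mul h2 h5 (abs_nonneg _) h0
  refine (abs_sub _ _).trans ?_
  have := abs_add_le (A ‖x‖ * ((inner ℝ x v : ℝ) / ‖x‖)) (B ‖x‖ * w v)
  nlinarith

theorem gF_diff {c ρ Y : ℝ} {A B E : ℝ → ℝ} (hA : RadC c ρ A) (hB : RadC c ρ B) (hE : RadC c ρ E)
    {x v y u : E3} (hx : x ≠ 0) (hxρ : ‖x‖ ≤ ρ) (hv : ‖v‖ ≤ Y)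
    (hy : y ≠ 0) (hyρ : ‖y‖ ≤ ρ) {δ : ℝ} (h1 : ‖x - y‖ ≤ δ) (h2 : ‖v - u‖ ≤ δ) :
    |gF A B E x v - gF A B E y u| ≤ c * (4 * Y + 2 * ρ + 2) * δ := by
  have hx' : 0 < ‖x‖ := norm_pos_iff.2 hx
  have hy' : 0 < ‖y‖ := norm_pos_iff.2 hy
  have hδ : 0 ≤ δ := (norm_nonneg _).trans h1
  have hY : 0 ≤ Y := (norm_nonneg _).trans hv
  have hr : |‖x‖ - ‖y‖| ≤ δ := (abs_norm_sub_norm_le x y).trans h1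
  have b1 := hA.lin _ hy' hyρ
  have b2 := hB.lin _ hy' hyρ
  have h0 : 0 ≤ c * ‖y‖ := (abs_nonneg _).trans b1
  have hc : 0 ≤ c := by
    by_contra hc
    nlinarith
  have hcρ : c * ‖y‖ ≤ c * ρ := by gcongr
  have l1 : |A ‖x‖ - A ‖y‖| ≤ c * δ := (hA.lip _ _ hx' hxρ hy' hyρ).trans (by gcongr)
  have l2 : |B ‖x‖ - B ‖y‖| ≤ c * δ := (hB.lip _ _ hx' hxρ hy' hyρ).trans (by gcongr)
  have l3 : |E ‖x‖ - E ‖y‖| ≤ c * δ := (hE.lip _ _ hx' hxρ hy' hyρ).trans (by gcongr)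
  have i1 : A ‖x‖ * ((inner ℝ x v : ℝ) / ‖x‖) - A ‖y‖ * ((inner ℝ y u : ℝ) / ‖y‖) =
      inner ℝ (A ‖x‖ • ((1 / ‖x‖) • x) - A ‖y‖ • ((1 / ‖y‖) • y)) v
        + A ‖y‖ * inner ℝ ((1 / ‖y‖) • y) (v - u) := by
    simp only [inner_sub_left, inner_sub_right, inner_smul_left, RCLike.conj_to_real]
    ring
  have i2 : |A ‖x‖ * ((inner ℝ x v : ℝ) / ‖x‖) - A ‖y‖ * ((inner ℝ y u : ℝ) / ‖y‖)| ≤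
      3 * c * δ * Y + c * ρ * δ := by
    rw [i1]
    refine (abs_add_le _ _).trans (add_le_add ?_ ?_)
    · refine (abs_real_inner_le_norm _ _).trans ?_
      have := smul_unit_diff (c := c) x y hx hy l1 b1
      have t : c * δ + 2 * c * ‖x - y‖ ≤ 3 * c * δ := by nlinarith
      exact mul_le_mul (this.trans t) hv (norm_nonneg _) (by positivity)
    · rw [abs_mul]
      have t := abs_real_inner_le_norm ((1 / ‖y‖) • y) (v - u)
      rw [unit_norm y hy, one_mul] at t
      exact mul_le_mul (b1.trans hcρ) (t.trans h2) (abs_nonneg _) (h0.trans hcρ)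
  have i3 : |B ‖x‖ * w v - B ‖y‖ * w u| ≤ c * δ * (1 + Y) + c * ρ * δ := by
    have : B ‖x‖ * w v - B ‖y‖ * w u = (B ‖x‖ - B ‖y‖) * w v + B ‖y‖ * (w v - w u) := by ring
    rw [this]
    refine (abs_add_le _ _).trans (add_le_add ?_ ?_)
    · rw [abs_mul]; exact mul_le_mul l2 (w_bd Y v hv) (abs_nonneg _) (by positivity)
    · rw [abs_mul]
      exact mul_le_mul (b2.trans hcρ) ((w_lip v u).trans h2) (abs_nonneg _) (h0.trans hcρ)
  unfold gF
  have e : ∀ a b d a' b' d' : ℝ, a + b - d - (a' + b' - d') = (a - a') + (b - b') - (d - d') := by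
    intros; ring
  rw [e]
  refine (abs_sub _ _).trans ?_
  refine (add_le_add (abs_add_le _ _) le_rfl).trans ?_
  nlinarith

theorem F2_eq (q : ℝ) (lam mu lamT e : ℝ → ℝ → ℝ) (s : ℝ) {x v : E3} (hx : x ≠ 0) :
    F2 q lam mu lamT e s x v = -(gF (lamT s) (fun r => rexp (mu s r - lam s r) * deriv (mu s) r)
      (fun r => q * rexp (mu s r + lam s r) * e s r) x v • ((1 / ‖x‖) • x)) := by
  unfold F2 gF
  rw [if_neg hx, smul_smul, ← neg_smul]
  congr 1
  ring

theorem exists_field_consts (q z ρ b Y : ℝ) (hρ : 0 < ρ) (hb : 0 ≤ b) (hz : 0 ≤ z) (hY : 0 ≤ Y) :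
    ∃ B K : ℝ, 0 ≤ B ∧ 0 ≤ K ∧ ∀ (lam mu lamT e : ℝ → ℝ → ℝ) (s : ℝ) (rh p k : ℝ → ℝ),
      StatM z ρ b (lam s) (mu s) (lamT s) (e s) rh p k →
      (∀ x v : E3, ‖x‖ ≤ ρ → ‖v‖ ≤ Y → ‖Fchar q lam mu lamT e s (x, v)‖ ≤ B) ∧
      (∀ x v y u : E3, ‖x‖ ≤ ρ → ‖v‖ ≤ Y → ‖y‖ ≤ ρ → ‖u‖ ≤ Y →
        ‖Fchar q lam mu lamT e s (x, v) - Fchar q lam mu lamT e s (y, u)‖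
          ≤ K * ‖((x, v) - (y, u) : E3 × E3)‖) := by
  set c0 := 1 + z * (16 * π * b * ρ) with hc0
  set cA := 2 * |-(4 * π)| * (2 * (ρ + 1) * (2 * c0 * b)) + 4 * π * b with hcA
  set cB := 2 * c0 * (4 * π * b * (3 + ρ) + 2 * |4 * π| * (2 * (ρ + 1) * b)) + 8 * π * b with hcB
  set cE := 2 * |q| * (2 * c0 * b) + |q| * b with hcE
  have hc0' : 0 ≤ c0 := by positivity
  have hcA' : 0 ≤ cA := by positivity
  have hcB' : 0 ≤ cB := by positivity
  have hcE' : 0 ≤ cE := by positivity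
  set c := c0 + cA + cB + cE with hc
  have hcn : 0 ≤ c := by positivity
  refine ⟨1 + c * (2 + 2 * Y) * ρ, c + 2 + c * (4 * Y + 2 * ρ + 2) + 2 * (c * (2 + 2 * Y)),
    by positivity, by positivity, ?_⟩
  intro lam mu lamT e s rh p k h
  have hlE : ∀ r, 0 < r → |rexp (lam s r + mu s r)| ≤ 1 := fun r hr => by
    rw [abs_of_pos (Real.exp_pos _)]; exact Real.exp_le_one_iff.2 (h.sum_nonpos hr.le)
  have hA : RadC c ρ (lamT s) := by
    have h1 : LipB (2 * |-(4 * π)| * (2 * (ρ + 1) * (2 * c0 * b))) ρ (lamT s) :=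
      ((LipB.const (-(4 * π)) ρ).mul ((LipB.id ρ).mul ((h.lipP hρ).mul h.kb))).congr
        (fun r hr => by rw [h.hlamT r]; ring)
    refine RadC.mono (c := cA) ⟨(h1.mono (by rw [hcA]; linarith [(by positivity : 0 ≤ 4 * π * b)])).lip, fun r h2 h3 => ?_⟩ (by linarith)
    rw [h.hlamT r, abs_mul, abs_mul, abs_mul, abs_neg, abs_of_pos h2,
      abs_of_pos (by positivity : 0 < 4 * π)]
    have e1 := hlE r h2
    have e2 := h.kb.bd r h2 h3
    calc _ ≤ 4 * π * r * 1 * b := by gcongr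
      _ = 4 * π * b * r := by ring
      _ ≤ _ := by
        apply mul_le_mul_of_nonneg_right _ h2.le
        rw [hcA]; have : 0 ≤ 2 * |-(4 * π)| * (2 * (ρ + 1) * (2 * c0 * b)) := by positivity
        linarith
  have hBeq : ∀ r, 0 < r → rexp (mu s r - lam s r) * deriv (mu s) r = rexp (lam s r + mu s r) *
      ((4 * π * ∫ s in (0:ℝ)..r, s ^ 2 * rh s) / r ^ 2 + 4 * π * (r * p r)) := fun r hr => by
    rw [h.hmu r hr, ← mul_assoc, ← Real.exp_add]
    congr 2 <;> ring
  have hB : RadC c ρ (fun r => rexp (mu s r - lam s r) * deriv (mu s) r) := by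
    have h1 : LipB (2 * c0 * (4 * π * b * (3 + ρ) + 2 * |4 * π| * (2 * (ρ + 1) * b))) ρ
        (fun r => rexp (mu s r - lam s r) * deriv (mu s) r) :=
      ((h.lipP hρ).mul ((h.lipm hρ).add ((LipB.const (4 * π) ρ).mul ((LipB.id ρ).mul h.pb)))).congr
        hBeq
    refine RadC.mono (c := cB) ⟨(h1.mono (by rw [hcB]; linarith [(by positivity : 0 ≤ 8 * π * b)])).lip, fun r h2 h3 => ?_⟩ (by linarith)
    rw [hBeq r h2, abs_mul]
    have e1 := hlE r h2
    have e2 := h.pb.bd r h2 h3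
    have e3 := h.mb2 h2 h3
    have e4 : |4 * π * (r * p r)| ≤ 4 * π * (r * b) := by
      rw [abs_mul (4 * π), abs_mul r, abs_of_pos h2, abs_of_pos (by positivity : 0 < 4 * π)]
      gcongr
    have e5 := (abs_add_le ((4 * π * ∫ s in (0:ℝ)..r, s ^ 2 * rh s) / r ^ 2) (4 * π * (r * p r))).trans
      (add_le_add e3 e4)
    calc _ ≤ 1 * (4 * π * b * r + 4 * π * (r * b)) := by gcongr
      _ = 8 * π * b * r := by ring
      _ ≤ _ := by
        apply mul_le_mul_of_nonneg_right _ h2.le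
        rw [hcB]; have : 0 ≤ 2 * c0 * (4 * π * b * (3 + ρ) + 2 * |4 * π| * (2 * (ρ + 1) * b)) := by positivity
        linarith
  have hEeq : ∀ r, 0 < r → q * rexp (mu s r + lam s r) * e s r =
      q * (rexp (mu s r) * (rexp (lam s r) * e s r)) := fun r hr => by
    rw [Real.exp_add]; ring
  have hE : RadC c ρ (fun r => q * rexp (mu s r + lam s r) * e s r) := by
    have h1 : LipB (2 * |q| * (2 * c0 * b)) ρ (fun r => q * rexp (mu s r + lam s r) * e s r) :=
      ((LipB.const q ρ).mul ((h.lipMu hρ).mul h.eb)).congr hEeq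
    refine RadC.mono (c := cE) ⟨(h1.mono (by rw [hcE]; linarith [(by positivity : 0 ≤ |q| * b)])).lip, fun r h2 h3 => ?_⟩ (by linarith)
    rw [hEeq r h2, abs_mul, abs_mul, abs_of_pos (Real.exp_pos _)]
    have e1 := Real.exp_le_one_iff.2 (h.mu_nonpos h2.le)
    have e2 := h.er r h2 h3
    calc _ ≤ |q| * (1 * (b * r)) := by gcongr
      _ = |q| * b * r := by ring
      _ ≤ _ := by
        apply mul_le_mul_of_nonneg_right _ h2.le
        rw [hcE]; have : 0 ≤ 2 * |q| * (2 * c0 * b) := by positivity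
        linarith
  have hM1 : ∀ r, 0 ≤ r → |rexp (mu s r - lam s r)| ≤ 1 := fun r hr => by
    rw [abs_of_pos (Real.exp_pos _)]
    exact Real.exp_le_one_iff.2 (by linarith [h.mu_nonpos hr, h.lam0 r hr])
  have hF2b : ∀ x v : E3, ‖x‖ ≤ ρ → ‖v‖ ≤ Y → ‖F2 q lam mu lamT e s x v‖ ≤ c * (2 + 2 * Y) * ‖x‖ := by
    intro x v hx hv
    by_cases hx0 : x = 0
    · simp [F2, hx0]
    · rw [F2_eq _ _ _ _ _ _ hx0, norm_neg, norm_smul, unit_norm x hx0, mul_one, Real.norm_eq_abs]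
      exact gF_bd hA hB hE hx0 hx hv
  constructor
  · intro x v hx hv
    have e1 : ‖F1 lam mu s x v‖ ≤ 1 := F1_norm (hM1 _ (norm_nonneg x)) v
    have e2 := hF2b x v hx hv
    have e3 : c * (2 + 2 * Y) * ‖x‖ ≤ c * (2 + 2 * Y) * ρ := by gcongr
    have e4 : 0 ≤ c * (2 + 2 * Y) * ρ := by positivity
    unfold Fchar
    rw [Prod.norm_def]
    apply max_le <;> simp only <;> linarith
  · intro x v y u hx hv hy hu
    set δ := ‖((x, v) - (y, u) : E3 × E3)‖ with hδ
    have d1 : ‖x - y‖ ≤ δ := by rw [hδ]; exact norm_fst_le ((x, v) - (y, u) : E3 × E3)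
    have d2 : ‖v - u‖ ≤ δ := by rw [hδ]; exact norm_snd_le ((x, v) - (y, u) : E3 × E3)
    have hδ0 : 0 ≤ δ := norm_nonneg _
    have p1 : 0 ≤ (c + 2) * δ := by positivity
    have p2 : 0 ≤ c * (4 * Y + 2 * ρ + 2) * δ := by positivity
    have p3 : 0 ≤ c * (2 + 2 * Y) * δ := by positivity
    unfold Fchar
    rw [Prod.mk_sub_mk, Prod.norm_def]
    apply max_le
    · simp only
      have hlip := (h.lipMi hρ).ext0 ((h.muc.sub h.lamc).rexp) hρ (norm_nonneg x) hx (norm_nonneg y) hy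
      have hl2 : |rexp (mu s ‖x‖ - lam s ‖x‖) - rexp (mu s ‖y‖ - lam s ‖y‖)| ≤ c * δ := by
        refine hlip.trans ?_
        have : |‖x‖ - ‖y‖| ≤ δ := (abs_norm_sub_norm_le x y).trans d1
        have : c0 ≤ c := by linarith
        gcongr
      have := F1_diff (hM1 _ (norm_nonneg y)) hl2 v u
      unfold F1
      linarith
    · simp only
      by_cases hx0 : x = 0
      · have e1 := hF2b y u hy hu
        have e2 : F2 q lam mu lamT e s x v = 0 := by simp [F2, hx0]
        rw [e2, zero_sub, norm_neg]
        have e3 : ‖y‖ ≤ δ := by simpa [hx0] using d1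
        have e4 : c * (2 + 2 * Y) * ‖y‖ ≤ c * (2 + 2 * Y) * δ := by gcongr
        linarith
      · by_cases hy0 : y = 0
        · have e1 := hF2b x v hx hv
          have e2 : F2 q lam mu lamT e s y u = 0 := by simp [F2, hy0]
          rw [e2, sub_zero]
          have e3 : ‖x‖ ≤ δ := by simpa [hy0] using d1
          have e4 : c * (2 + 2 * Y) * ‖x‖ ≤ c * (2 + 2 * Y) * δ := by gcongr
          linarith
        · rw [F2_eq _ _ _ _ _ _ hx0, F2_eq _ _ _ _ _ _ hy0, ← neg_sub', norm_neg]
          have e1 := smul_unit_diff x y hx0 hy0 (gF_diff hA hB hE hx0 hx hv hy0 hy d1 d2)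
            (gF_bd hA hB hE hy0 hy hu)
          have e2 : 2 * (c * (2 + 2 * Y)) * ‖x - y‖ ≤ 2 * (c * (2 + 2 * Y)) * δ := by gcongr
          linarith

/-! ### Curves -/

/-- A phase space box. -/
def Box (a b : ℝ) : Set (E3 × E3) := {p | ‖p.1‖ ≤ a ∧ ‖p.2‖ ≤ b}

theorem Box.near {a b d : ℝ} {p p' : E3 × E3} (h : p ∈ Box a b) (hd : ‖p' - p‖ ≤ d) :
    p' ∈ Box (a + d) (b + d) := by
  have h1 : ‖p'.1 - p.1‖ ≤ d := (norm_fst_le (p' - p)).trans hd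
  have h2 : ‖p'.2 - p.2‖ ≤ d := (norm_snd_le (p' - p)).trans hd
  have h3 := norm_sub_norm_le p'.1 p.1
  have h4 := norm_sub_norm_le p'.2 p.2
  exact ⟨by linarith [h.1], by linarith [h.2]⟩

theorem Box.mono {a b a' b' : ℝ} {p : E3 × E3} (h : p ∈ Box a b) (ha : a ≤ a') (hb : b ≤ b') :
    p ∈ Box a' b' := ⟨h.1.trans ha, h.2.trans hb⟩

theorem stay {y v : ℝ → E3 × E3} {c d B B' : ℝ} (hy : ∀ s ∈ Set.uIcc c d, HasDerivAt y (v s) s)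
    (hv : ∀ s ∈ Set.uIcc c d, ‖y s - y c‖ ≤ 1 → ‖v s‖ ≤ B) (hB : B < B') (hB' : 0 ≤ B')
    (hd : B' * |d - c| ≤ 1) : ‖y d - y c‖ ≤ B' * |d - c| := by
  rcases eq_or_ne d c with rfl | hne
  · simp
  have hpos : 0 < |d - c| := abs_pos.2 (sub_ne_zero.2 hne)
  have hmem : ∀ σ ∈ Set.Icc (0:ℝ) 1, c + σ * (d - c) ∈ Set.uIcc c d := by
    intro σ hσ
    rw [Set.mem_uIcc]
    rcases le_total c d with h | h
    · left; constructor <;> nlinarith [hσ.1, hσ.2]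
    · right; constructor <;> nlinarith [hσ.1, hσ.2]
  have hder : ∀ σ ∈ Set.Icc (0:ℝ) 1, HasDerivAt (fun σ => y (c + σ * (d - c)) - y c)
      ((d - c) • v (c + σ * (d - c))) σ := by
    intro σ hσ
    have h1 : HasDerivAt (fun σ : ℝ => c + σ * (d - c)) (d - c) σ := by
      simpa using ((hasDerivAt_id σ).mul_const (d - c)).const_add c
    exact (HasDerivAt.scomp σ (hy _ (hmem σ hσ)) h1).sub_const _
  have := image_norm_le_of_norm_deriv_right_lt_deriv_boundary'
    (f := fun σ => y (c + σ * (d - c)) - y c) (f' := fun σ => (d - c) • v (c + σ * (d - c)))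
    (a := 0) (b := 1) (B := fun σ => B' * |d - c| * σ) (B' := fun _ => B' * |d - c|)
    (fun σ hσ => (hder σ hσ).continuousAt.continuousWithinAt)
    (fun σ hσ => (hder σ ⟨hσ.1, hσ.2.le⟩).hasDerivWithinAt)
    (by simp) (by fun_prop)
    (fun σ hσ => by
      have := (hasDerivAt_id σ).const_mul (B' * |d - c|)
      simpa using this.hasDerivWithinAt)
    (by
      intro σ hσ he
      have h1 : ‖y (c + σ * (d - c)) - y c‖ ≤ 1 := by
        rw [he]
        have : B' * |d - c| * σ ≤ B' * |d - c| * 1 := by gcongr; exact hσ.2.le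
        linarith
      have h2 := hv _ (hmem σ ⟨hσ.1, hσ.2.le⟩) h1
      rw [norm_smul, Real.norm_eq_abs, mul_comm]
      exact mul_lt_mul_of_pos_right (h2.trans_lt hB) hpos)
    (Set.right_mem_Icc.2 zero_le_one)
  simpa using this

theorem compare {G : ℝ → E3 × E3 → E3 × E3} {S : Set (E3 × E3)} {K s : ℝ} (hK : 0 ≤ K) (hs : 0 ≤ s)
    (hG : ∀ t ∈ Set.Icc (0:ℝ) s, ∀ p ∈ S, ∀ p' ∈ S, ‖G t p - G t p'‖ ≤ K * ‖p - p'‖)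
    {y y' : ℝ → E3 × E3}
    (hy : ∀ t ∈ Set.Icc (0:ℝ) s, HasDerivAt y (G t (y t)) t)
    (hy' : ∀ t ∈ Set.Icc (0:ℝ) s, HasDerivAt y' (G t (y' t)) t)
    (hS : ∀ t ∈ Set.Icc (0:ℝ) s, y t ∈ S) (hS' : ∀ t ∈ Set.Icc (0:ℝ) s, y' t ∈ S) :
    ‖y 0 - y' 0‖ ≤ rexp (K * s) * ‖y s - y' s‖ := by
  have hm : ∀ σ ∈ Set.Icc (0:ℝ) s, s - σ ∈ Set.Icc (0:ℝ) s := fun σ h =>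
    ⟨by linarith [h.2], by linarith [h.1]⟩
  have hr : ∀ (u : ℝ → E3 × E3), (∀ t ∈ Set.Icc (0:ℝ) s, HasDerivAt u (G t (u t)) t) →
      ∀ σ ∈ Set.Icc (0:ℝ) s, HasDerivAt (fun σ => u (s - σ)) (-(G (s - σ) (u (s - σ)))) σ := by
    intro u hu σ hσ
    have h1 : HasDerivAt (fun σ : ℝ => s - σ) (-1) σ := by
      simpa using (hasDerivAt_id σ).const_sub s
    have h2 := HasDerivAt.scomp σ (hu _ (hm σ hσ)) h1
    rw [neg_one_smul] at h2
    exact h2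
  have := dist_le_of_trajectories_ODE_of_mem (v := fun σ p => -(G (s - σ) p)) (s := fun _ => S)
    (K := K.toNNReal) (a := 0) (b := s) (δ := dist (y s) (y' s))
    (f := fun σ => y (s - σ)) (g := fun σ => y' (s - σ))
    (by
      intro σ hσ
      refine LipschitzOnWith.of_dist_le_mul fun p hp p' hp' => ?_
      rw [dist_neg_neg, dist_eq_norm, dist_eq_norm, Real.coe_toNNReal K hK]
      exact hG _ (hm σ ⟨hσ.1, hσ.2.le⟩) p hp p' hp')
    (fun σ hσ => (hr y hy σ hσ).continuousAt.continuousWithinAt)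
    (fun σ hσ => (hr y hy σ ⟨hσ.1, hσ.2.le⟩).hasDerivWithinAt)
    (fun σ hσ => hS _ (hm σ ⟨hσ.1, hσ.2.le⟩))
    (fun σ hσ => (hr y' hy' σ hσ).continuousAt.continuousWithinAt)
    (fun σ hσ => (hr y' hy' σ ⟨hσ.1, hσ.2.le⟩).hasDerivWithinAt)
    (fun σ hσ => hS' _ (hm σ ⟨hσ.1, hσ.2.le⟩))
    (by simp) s (Set.right_mem_Icc.2 hs)
  simp only [sub_self, sub_zero, Real.coe_toNNReal K hK, dist_eq_norm] at this
  linarith [mul_comm (rexp (K * s)) ‖y s - y' s‖]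

/-- One transport step: bounds of `f` transported along the flow. -/
theorem transport {f0 : E3 → E3 → ℝ} {r0 u0 R z B B' K L0 F τ : ℝ}
    {G : ℝ → E3 × E3 → E3 × E3} {Zf : ℝ → ℝ → E3 × E3 → E3 × E3} {f : ℝ → E3 → E3 → ℝ}
    (hs0 : ∀ x v, f0 x v ≠ 0 → ‖x‖ ≤ r0 ∧ ‖v‖ ≤ u0) (hn0 : ∀ x v, 0 ≤ f0 x v)
    (hF0 : ∀ x v, f0 x v ≤ F) (hL0 : ∀ p p' : E3 × E3, |f0 p.1 p.2 - f0 p'.1 p'.2| ≤ L0 * ‖p - p'‖)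
    (hL : 0 ≤ L0)
    (hR : r0 + 1 ≤ R) (hz : u0 + 1 ≤ z) (hBB : B < B') (hB' : 0 ≤ B') (hK : 0 ≤ K)
    (hτB : B' * τ ≤ 1) (hτK : K * τ ≤ 1)
    (hGb : ∀ t, 0 ≤ t → t < τ → ∀ p ∈ Box (R + 2) (z + 2), ‖G t p‖ ≤ B)
    (hGl : ∀ t, 0 ≤ t → t < τ → ∀ p ∈ Box (R + 2) (z + 2), ∀ p' ∈ Box (R + 2) (z + 2),
      ‖G t p - G t p'‖ ≤ K * ‖p - p'‖)
    (hZ0 : ∀ t, 0 ≤ t → t < τ → ∀ p, Zf t t p = p)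
    (hZ : ∀ t, 0 ≤ t → t < τ → ∀ p, ∀ s, 0 ≤ s → s < τ →
      HasDerivAt (fun σ => Zf σ t p) (G s (Zf s t p)) s)
    (hf : ∀ t, 0 ≤ t → t < τ → ∀ x v, f t x v = f0 (Zf 0 t (x, v)).1 (Zf 0 t (x, v)).2) :
    (∀ t, 0 ≤ t → t < τ → ∀ x v, f t x v ≠ 0 → ‖x‖ ≤ R ∧ ‖v‖ ≤ u0 + B' * t) ∧
    (∀ t, 0 ≤ t → t < τ → ∀ x v y u,
      |f t x v - f t y u| ≤ max F (3 * L0) * ‖((x, v) - (y, u) : E3 × E3)‖) ∧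
    (∀ s t, 0 ≤ s → s < τ → 0 ≤ t → t < τ → ∀ x v,
      |f t x v - f s x v| ≤ 3 * L0 * B' * |t - s|) := by
  have hBt : ∀ t s, 0 ≤ t → t < τ → 0 ≤ s → s < τ → B' * |t - s| ≤ 1 := by
    intro t s h1 h2 h3 h4
    have : |t - s| ≤ τ := by rw [abs_le]; constructor <;> linarith
    exact (mul_le_mul_of_nonneg_left this hB').trans hτB
  have hA : ∀ t, 0 ≤ t → t < τ → ∀ x v, f t x v ≠ 0 → ‖x‖ ≤ R ∧ ‖v‖ ≤ u0 + B' * t := by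
    intro t ht htτ x v hne
    rw [hf t ht htτ] at hne
    have h0 := hs0 _ _ hne
    have h1 : ∀ s ∈ Set.uIcc 0 t, 0 ≤ s ∧ s < τ := by
      intro s hs; rw [Set.uIcc_of_le ht] at hs; exact ⟨hs.1, hs.2.trans_lt htτ⟩
    have hb : (Zf 0 t (x, v)) ∈ Box r0 u0 := h0
    have h2 := stay (y := fun σ => Zf σ t (x, v)) (v := fun s => G s (Zf s t (x, v))) (c := 0) (d := t)
      (fun s hs => hZ t ht htτ _ s (h1 s hs).1 (h1 s hs).2)
      (fun s hs hn => hGb s (h1 s hs).1 (h1 s hs).2 _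
        (Box.mono (Box.near hb hn) (by linarith) (by linarith))) hBB hB' (hBt _ _ ht htτ le_rfl (ht.trans_lt htτ))
    have h3 := hBt t 0 ht htτ le_rfl (ht.trans_lt htτ)
    rw [hZ0 t ht htτ] at h2
    have h4 := Box.near hb h2
    rw [sub_zero, abs_of_nonneg ht] at h4 h3
    exact ⟨by linarith [h4.1], h4.2⟩
  have hS : ∀ t, 0 ≤ t → t < τ → ∀ p ∈ Box (R + 1) (z + 1), ∀ s, 0 ≤ s → s < τ →
      Zf s t p ∈ Box (R + 2) (z + 2) ∧ ‖Zf s t p - p‖ ≤ B' * |s - t| := by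
    intro t ht htτ p hp s hs hsτ
    have h1 : ∀ σ ∈ Set.uIcc t s, 0 ≤ σ ∧ σ < τ := by
      intro σ hσ; rw [Set.mem_uIcc] at hσ
      rcases hσ with h | h
      · exact ⟨ht.trans h.1, h.2.trans_lt hsτ⟩
      · exact ⟨hs.trans h.1, h.2.trans_lt htτ⟩
    have h2 := stay (y := fun σ => Zf σ t p) (v := fun s => G s (Zf s t p)) (c := t) (d := s)
      (fun s hs => hZ t ht htτ _ s (h1 s hs).1 (h1 s hs).2)
      (fun s hs hn => hGb s (h1 s hs).1 (h1 s hs).2 _ (by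
        rw [hZ0 t ht htτ] at hn
        exact Box.mono (Box.near hp hn) (by linarith) (by linarith))) hBB hB' (hBt _ _ hs hsτ ht htτ)
    rw [hZ0 t ht htτ] at h2
    exact ⟨Box.mono (Box.near hp (h2.trans (hBt _ _ hs hsτ ht htτ))) (by linarith) (by linarith), h2⟩
  have hexp : ∀ s, 0 ≤ s → s < τ → rexp (K * s) ≤ 3 := by
    intro s _ hs
    have : K * s ≤ 1 := (mul_le_mul_of_nonneg_left hs.le hK).trans hτK
    have := Real.exp_le_exp.2 this
    linarith [Real.exp_one_lt_d9]
  have hzB : ∀ t, 0 ≤ t → t < τ → u0 + B' * t ≤ z := by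
    intro t ht htτ
    have := hBt t 0 ht htτ le_rfl (ht.trans_lt htτ)
    rw [sub_zero, abs_of_nonneg ht] at this
    linarith
  have hFle : ∀ t, 0 ≤ t → t < τ → ∀ x v, 0 ≤ f t x v ∧ f t x v ≤ F := by
    intro t ht htτ x v; rw [hf t ht htτ]; exact ⟨hn0 _ _, hF0 _ _⟩
  refine ⟨hA, ?_, ?_⟩
  · intro t ht htτ
    have key : ∀ p p' : E3 × E3, f t p.1 p.2 ≠ 0 →
        |f t p.1 p.2 - f t p'.1 p'.2| ≤ max F (3 * L0) * ‖p - p'‖ := by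
      intro p p' hne
      have h1 := hA t ht htτ _ _ hne
      have hp : p ∈ Box R z := ⟨h1.1, h1.2.trans (hzB t ht htτ)⟩
      rcases le_total ‖p - p'‖ 1 with h | h
      · have hp' : p' ∈ Box (R + 1) (z + 1) := Box.near hp (by rwa [norm_sub_rev])
        have hp1 : p ∈ Box (R + 1) (z + 1) := Box.mono hp (by linarith) (by linarith)
        have hcmp := compare (G := G) (S := Box (R + 2) (z + 2)) (y := fun σ => Zf σ t p)
          (y' := fun σ => Zf σ t p') hK ht
          (fun σ hσ => hGl σ hσ.1 (hσ.2.trans_lt htτ))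
          (fun σ hσ => hZ t ht htτ _ σ hσ.1 (hσ.2.trans_lt htτ))
          (fun σ hσ => hZ t ht htτ _ σ hσ.1 (hσ.2.trans_lt htτ))
          (fun σ hσ => (hS t ht htτ p hp1 σ hσ.1 (hσ.2.trans_lt htτ)).1)
          (fun σ hσ => (hS t ht htτ p' hp' σ hσ.1 (hσ.2.trans_lt htτ)).1)
        rw [hZ0 t ht htτ, hZ0 t ht htτ] at hcmp
        rw [hf t ht htτ, hf t ht htτ]
        calc _ ≤ L0 * ‖Zf 0 t p - Zf 0 t p'‖ := hL0 _ _
          _ ≤ L0 * (3 * ‖p - p'‖) := by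
              gcongr
              exact hcmp.trans (by gcongr; exact hexp t ht htτ)
          _ = 3 * L0 * ‖p - p'‖ := by ring
          _ ≤ _ := by gcongr; exact le_max_right _ _
      · have h2 := hFle t ht htτ p.1 p.2
        have h3 := hFle t ht htτ p'.1 p'.2
        have h4 : |f t p.1 p.2 - f t p'.1 p'.2| ≤ F := by
          rw [abs_le]; constructor <;> linarith
        have h5 : 0 ≤ F := h2.1.trans h2.2
        have h6 : F ≤ max F (3 * L0) := le_max_left _ _
        nlinarith
    intro x v y u
    by_cases h1 : f t x v = 0
    · by_cases h2 : f t y u = 0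
      · rw [h1, h2]; simp only [sub_self, abs_zero]
        have : 0 ≤ max F (3 * L0) := le_max_of_le_right (by positivity)
        positivity
      · have := key (y, u) (x, v) h2
        rwa [abs_sub_comm, norm_sub_rev] at this
    · exact key (x, v) (y, u) h1
  · have key : ∀ s t, 0 ≤ s → s < τ → 0 ≤ t → t < τ → s ≤ t → ∀ x v,
        |f t x v - f s x v| ≤ 3 * L0 * B' * |t - s| := by
      intro s t hs hsτ ht htτ hst x v
      by_cases hp : (x, v) ∈ Box R z
      · have hp1 : (x, v) ∈ Box (R + 1) (z + 1) := Box.mono hp (by linarith) (by linarith)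
        have hcmp := compare (G := G) (S := Box (R + 2) (z + 2)) (y := fun σ => Zf σ t (x, v))
          (y' := fun σ => Zf σ s (x, v)) hK hs
          (fun σ hσ => hGl σ hσ.1 (hσ.2.trans_lt hsτ))
          (fun σ hσ => hZ t ht htτ _ σ hσ.1 (hσ.2.trans_lt hsτ))
          (fun σ hσ => hZ s hs hsτ _ σ hσ.1 (hσ.2.trans_lt hsτ))
          (fun σ hσ => (hS t ht htτ _ hp1 σ hσ.1 (hσ.2.trans_lt hsτ)).1)
          (fun σ hσ => (hS s hs hsτ _ hp1 σ hσ.1 (hσ.2.trans_lt hsτ)).1)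
        rw [hZ0 s hs hsτ] at hcmp
        have h3 := (hS t ht htτ _ hp1 s hs hsτ).2
        rw [abs_sub_comm] at h3
        rw [hf t ht htτ, hf s hs hsτ]
        calc _ ≤ L0 * ‖Zf 0 t (x, v) - Zf 0 s (x, v)‖ := hL0 _ _
          _ ≤ L0 * (3 * (B' * |t - s|)) := by
              gcongr
              exact hcmp.trans (mul_le_mul (hexp s hs hsτ) h3 (norm_nonneg _) (by norm_num))
          _ = _ := by ring
      · have h0 : ∀ t, 0 ≤ t → t < τ → f t x v = 0 := by
          intro t ht htτ
          by_contra hne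
          have h1 := hA t ht htτ _ _ hne
          exact hp ⟨h1.1, h1.2.trans (hzB t ht htτ)⟩
        rw [h0 t ht htτ, h0 s hs hsτ]; simp only [sub_self, abs_zero]
        positivity
    intro s t hs hsτ ht htτ x v
    rcases le_total s t with h | h
    · exact key s t hs hsτ ht htτ h x v
    · have := key t s ht htτ hs hsτ h x v
      rwa [abs_sub_comm, abs_sub_comm s t] at this

/-! ### Field slices -/

/-- Data of one iterate at one time. -/
structure FS (q z R F D : ℝ) (lam e : ℝ → ℝ) (f : E3 → E3 → ℝ) : Prop where
  sf : StatF z R F D f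
  lamc : ContinuousOn lam (Set.Ici 0)
  ec : ContinuousOn e (Set.Ici 0)
  l0 : ∀ r, 0 ≤ r → 0 ≤ lam r
  lz : ∀ r, 0 ≤ r → rexp (2 * lam r) ≤ z
  he : ∀ r, 0 < r → rexp (lam r) * e r = epsf q lam (avg g3 f) r

/-- Bound of averages. -/
def cbb (z F : ℝ) : ℝ := (1 + z) * F * VB z
/-- Bound of the field. -/
def cb1 (q z F : ℝ) : ℝ := |q| * (z * cbb z F)
/-- Lipschitz bound of the field on `(0,R+2]`. -/
def cl1 (q z R F : ℝ) : ℝ := cb1 q z F * (3 + (R + 2))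
/-- The total static constant. -/
def cb (q z R F D : ℝ) : ℝ :=
  (cbb z F + (1 + z) * D * VB z) + 2 * |(1/2 : ℝ)| * (2 * cl1 q z R F * cl1 q z R F)
    + cl1 q z R F + cb1 q z F

namespace FS
variable {q z R F D : ℝ} {lam e : ℝ → ℝ} {f : E3 → E3 → ℝ}

theorem hz (h : FS q z R F D lam e f) : 0 ≤ z := (Real.exp_pos _).le.trans (h.lz 0 le_rfl)
theorem hF (h : FS q z R F D lam e f) : 0 ≤ F := (h.sf.nonneg 0 0).trans (h.sf.le 0 0)
theorem hbb (h : FS q z R F D lam e f) : 0 ≤ cbb z F := by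
  have := h.hz; have := h.hF; have := VB_nonneg z; unfold cbb; positivity
theorem hb1 (h : FS q z R F D lam e f) : 0 ≤ cb1 q z F := by
  have := h.hz; have := h.hbb; unfold cb1; positivity
theorem hl1 (h : FS q z R F D lam e f) (hR : 0 < R) : 0 ≤ cl1 q z R F := by
  have := h.hb1; unfold cl1; positivity
theorem Mb (h : FS q z R F D lam e f) (r : ℝ) : |avg g3 f r| ≤ cbb z F :=
  avg_bound h.sf (g3_bd z) r
theorem Mc (h : FS q z R F D lam e f) : Continuous (avg g3 f) := avg_cont h.sf g3_cont (g3_bd z)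
theorem M0 (h : FS q z R F D lam e f) (r : ℝ) (hr : R < r) : avg g3 f r = 0 := avg_zero h.sf hr

theorem eb (h : FS q z R F D lam e f) {r : ℝ} (hr : 0 < r) : |rexp (lam r) * e r| ≤ cb1 q z F * r := by
  rw [h.he r hr]; exact eps_bd h.l0 h.lz h.Mb hr

theorem eb2 (h : FS q z R F D lam e f) (hR : 0 < R) {r : ℝ} (hr : 0 < r) :
    |rexp (lam r) * e r| * r ^ 2 ≤ cb1 q z F * R ^ 3 := by
  rw [h.he r hr]; exact eps_bd2 h.lamc h.Mc h.l0 h.lz h.Mb hR h.M0 hr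

theorem el (h : FS q z R F D lam e f) (hR : 0 < R) :
    LipB (cl1 q z R F) (R + 2) (fun r => rexp (lam r) * e r) :=
  (eps_lip h.lamc h.Mc h.l0 h.lz h.Mb (by linarith)).congr h.he

theorem ecc (h : FS q z R F D lam e f) : ContinuousOn (fun r => rexp (lam r) * e r) (Set.Ici 0) :=
  h.lamc.rexp.mul h.ec

theorem avgL (h : FS q z R F D lam e f) {g : E3 → ℝ} (hg : Continuous g)
    (hb : ∀ v, ‖v‖ ≤ z → |g v| ≤ 1 + z) (hD : 0 ≤ D) :
    LipB (cbb z F + (1 + z) * D * VB z) (R + 2) (avg g f) := by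
  have h1 := h.hbb
  have h2 : 0 ≤ (1 + z) * D * VB z := by have := h.hz; have := VB_nonneg z; positivity
  refine ⟨fun r _ _ => (avg_bound h.sf hb r).trans (by unfold cbb; unfold cbb at h1; linarith),
    fun r s _ _ _ _ => (avg_lip h.sf hg hb r s).trans (by gcongr; linarith)⟩

theorem statM {lamP eP : ℝ → ℝ} {fP : E3 → E3 → ℝ} (h : FS q z R F D lam e f)
    (hP : FS q z R F D lamP eP fP) (hR : 0 < R) (hD : 0 ≤ D) {mu lamT : ℝ → ℝ}
    (muc : ContinuousOn mu (Set.Ici 0))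
    (lamd : ∀ r, 0 < r → DifferentiableAt ℝ lam r)
    (mud : ∀ r, 0 < r → DifferentiableAt ℝ mu r)
    (laminf : Tendsto lam atTop (𝓝 0))
    (muinf : Tendsto mu atTop (𝓝 0))
    (hlam : ∀ r, 0 < r → rexp (-2 * lam r) = 1 - 2 * (4 * π * ∫ s in (0:ℝ)..r, s ^ 2 *
      (avg w f s + (1/2) * (rexp (lamP s) * eP s) ^ 2)) / r)
    (hmu : ∀ r, 0 < r → deriv mu r = rexp (2 * lam r) *
      ((4 * π * ∫ s in (0:ℝ)..r, s ^ 2 * (avg w f s + (1/2) * (rexp (lamP s) * eP s) ^ 2)) / r ^ 2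
        + 4 * π * r * (avg g1 f r - (1/2) * (rexp (lamP r) * eP r) ^ 2)))
    (hlamT : ∀ r, lamT r = -(4 * π) * r * rexp (lam r + mu r) * avg g2 f r) :
    StatM z (R + 2) (cb q z R F D) lam mu lamT e
      (fun r => avg w f r + (1/2) * (rexp (lamP r) * eP r) ^ 2)
      (fun r => avg g1 f r - (1/2) * (rexp (lamP r) * eP r) ^ 2) (avg g2 f) := by
  have hl := hP.el hR
  have hsq : LipB (2 * |(1/2 : ℝ)| * (2 * cl1 q z R F * cl1 q z R F)) (R + 2)
      (fun r => (1/2) * (rexp (lamP r) * eP r) ^ 2) :=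
    ((LipB.const (1/2) (R + 2)).mul (hl.mul hl)).congr (fun r _ => by ring)
  have hsq' : LipB (2 * |(1/2 : ℝ)| * (2 * cl1 q z R F * cl1 q z R F)) (R + 2)
      (fun r => -((1/2) * (rexp (lamP r) * eP r) ^ 2)) :=
    ⟨fun r h1 h2 => by rw [abs_neg]; exact hsq.bd r h1 h2, fun r s h1 h2 h3 h4 => by
      have := hsq.lip r s h1 h2 h3 h4
      rw [← abs_neg] at this
      rwa [show ∀ a b : ℝ, -a - -b = -(a - b) from fun a b => by ring]⟩
  have n1 := h.hl1 hR
  have n2 := h.hb1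
  have n3 := h.hbb
  have n4 : 0 ≤ (1 + z) * D * VB z := by have := h.hz; have := VB_nonneg z; positivity
  have n5 : 0 ≤ 2 * |(1/2 : ℝ)| * (2 * cl1 q z R F * cl1 q z R F) := by positivity
  refine ⟨h.lamc, muc, lamd, mud, h.l0, h.lz, laminf, muinf, ?_, ?_, ?_, ?_, ?_, ?_, ?_, hlam, hmu, hlamT⟩
  · exact (avg_cont h.sf continuous_w (w_bd z)).continuousOn.add
      (continuousOn_const.mul (hP.ecc.pow 2))
  · intro r _
    have e1 := avg_nonneg h.sf (fun v => (w_pos v).le) r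
    have e2 := avg_nonneg h.sf g1_nonneg r
    linarith
  · exact ((h.avgL continuous_w (w_bd z) hD).add hsq).mono (by unfold cb; linarith)
  · exact (((h.avgL g1_cont (g1_bd z) hD).add hsq').mono (by unfold cb; linarith)).congr
      (fun r _ => by ring)
  · exact (h.avgL g2_cont (g2_bd z) hD).mono (by unfold cb; linarith)
  · exact (h.el hR).mono (by unfold cb; linarith)
  · intro r hr _
    refine (h.eb hr).trans ?_
    gcongr
    unfold cb; linarith

end FS

/-! ### Time differences -/

theorem exp_diff_le {a b z : ℝ} (ha : rexp a ≤ z) (hb : rexp b ≤ z) :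
    |rexp a - rexp b| ≤ z * |a - b| := by
  have key : ∀ a b : ℝ, b ≤ a → rexp a ≤ z → |rexp a - rexp b| ≤ z * |a - b| := by
    intro a b h ha
    rw [abs_of_nonneg (by linarith [Real.exp_le_exp.2 h]), abs_of_nonneg (by linarith)]
    have h1 := Real.add_one_le_exp (b - a)
    have h2 : rexp b = rexp a * rexp (b - a) := by rw [← Real.exp_add]; congr 1; ring
    have h3 := Real.exp_pos a
    rw [h2]
    nlinarith
  rcases le_total b a with h | h
  · exact key a b h ha
  · rw [abs_sub_comm, abs_sub_comm a b]; exact key b a h hb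

theorem exp_diff_ge {a b z : ℝ} (ha : rexp (2 * a) ≤ z) (hb : rexp (2 * b) ≤ z) :
    |a - b| ≤ z / 2 * |rexp (-2 * a) - rexp (-2 * b)| := by
  have key : ∀ a b : ℝ, b ≤ a → rexp (2 * a) ≤ z → |a - b| ≤ z / 2 * |rexp (-2 * a) - rexp (-2 * b)| := by
    intro a b h ha
    have h0 : rexp (-2 * a) ≤ rexp (-2 * b) := Real.exp_le_exp.2 (by linarith)
    rw [abs_sub_comm (rexp _), abs_of_nonneg (by linarith : (0:ℝ) ≤ rexp (-2 * b) - _), abs_of_nonneg (by linarith)]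
    have h1 := Real.add_one_le_exp (2 * (a - b))
    have h2 : rexp (2 * a) * rexp (-2 * b) = rexp (2 * (a - b)) := by
      rw [← Real.exp_add]; congr 1; ring
    have h3 : rexp (2 * a) * rexp (-2 * a) = 1 := by
      rw [← Real.exp_add]; simp
    have h4 : rexp (2 * a) * (rexp (-2 * b) - rexp (-2 * a)) ≤ z * (rexp (-2 * b) - rexp (-2 * a)) := by
      gcongr
    nlinarith
  rcases le_total b a with h | h
  · exact key a b h ha
  · rw [abs_sub_comm, abs_sub_comm (rexp _)]; exact key b a h hb

theorem int_exp_bound {φ : ℝ → ℝ} {A C W r : ℝ} (hr : 0 ≤ r) (_hW : 0 < W) (hC : 0 ≤ C)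
    (hb : ∀ s, 0 < s → s ≤ r → |φ s| ≤ A + C * (W * rexp (W * s))) :
    |∫ s in (0:ℝ)..r, φ s| ≤ A * r + C * rexp (W * r) := by
  have hi : ∫ s in (0:ℝ)..r, (A + C * (W * rexp (W * s))) = A * r + C * (rexp (W * r) - 1) := by
    have hd : ∀ s ∈ Set.uIcc 0 r, HasDerivAt (fun s => A * s + C * rexp (W * s))
        (A + C * (W * rexp (W * s))) s := by
      intro s _
      have h1 : HasDerivAt (fun s => W * s) W s := by simpa using (hasDerivAt_id s).const_mul W
      have h2 := (h1.exp).const_mul C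
      have h3 : HasDerivAt (fun s => A * s) A s := by simpa using (hasDerivAt_id s).const_mul A
      exact (h3.add h2).congr_deriv (by ring)
    rw [intervalIntegral.integral_eq_sub_of_hasDerivAt hd (by apply Continuous.intervalIntegrable; fun_prop)]
    simp; ring
  have := intervalIntegral.norm_integral_le_of_norm_le (μ := volume) (f := φ)
    (g := fun s => A + C * (W * rexp (W * s))) hr
    (Eventually.of_forall fun s hs => hb s hs.1 hs.2)
    (by apply Continuous.intervalIntegrable; fun_prop)
  rw [hi, Real.norm_eq_abs] at this
  nlinarith

/-- Constants. -/
def cA3 (z D2 : ℝ) : ℝ := (1 + z) * D2 * VB z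
def cA1 (z D2 : ℝ) : ℝ := z * cA3 z D2
def cA2 (z F : ℝ) : ℝ := cbb z F * z

theorem eps_time {q z R F D D2 W Δ : ℝ} {lam e lam' e' : ℝ → ℝ} {f f' : E3 → E3 → ℝ}
    (h : FS q z R F D lam e f) (h' : FS q z R F D lam' e' f') (hR : 0 < R) (hW : 0 < W)
    (hΔ : 0 ≤ Δ) (hD2 : 0 ≤ D2) (hf : ∀ x v, |f x v - f' x v| ≤ D2 * Δ)
    (hl : ∀ r, 0 < r → r ≤ R → |lam r - lam' r| ≤ W * Δ * rexp (W * r)) {r : ℝ} (hr : 0 < r) :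
    |rexp (lam r) * e r - rexp (lam' r) * e' r|
      ≤ |q| * (cA1 z D2 * R + cA2 z F * rexp (W * min r R)) * Δ := by
  have hz := h.hz
  have hV := VB_nonneg z
  have hbb := h.hbb
  have hA3 : 0 ≤ cA3 z D2 := by unfold cA3; positivity
  have hA1 : 0 ≤ cA1 z D2 := by unfold cA1; positivity
  have hA2 : 0 ≤ cA2 z F := by unfold cA2; positivity
  have hfac : ∀ s, |avg g3 f s - avg g3 f' s| ≤ cA3 z D2 * Δ := fun s =>
    (avg_diff h.sf h'.sf hf g3_cont (g3_bd z) s).trans (le_of_eq (by unfold cA3; ring))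
  have hIntg : ∀ r, 0 < r → r ≤ R → |(∫ s in (0:ℝ)..r, s ^ 2 * rexp (lam s) * avg g3 f s) -
      ∫ s in (0:ℝ)..r, s ^ 2 * rexp (lam' s) * avg g3 f' s|
      ≤ r ^ 2 * (cA1 z D2 * R + cA2 z F * rexp (W * r)) * Δ := by
    intro r hr hrR
    rw [← intervalIntegral.integral_sub (ii_of_cont (eps_cont h.lamc h.Mc) le_rfl hr.le)
      (ii_of_cont (eps_cont h'.lamc h'.Mc) le_rfl hr.le)]
    have := int_exp_bound (φ := fun s => s ^ 2 * rexp (lam s) * avg g3 f s -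
      s ^ 2 * rexp (lam' s) * avg g3 f' s) (A := r ^ 2 * cA1 z D2 * Δ) (C := r ^ 2 * cA2 z F * Δ)
      hr.le hW (by positivity) (by
        intro s hs hsr
        have e1 : |rexp (lam s)| ≤ z := by
          rw [abs_of_pos (Real.exp_pos _)]; exact exp_le_of (h.l0 s hs.le) (h.lz s hs.le)
        have e2 : |rexp (lam s) - rexp (lam' s)| ≤ z * (W * Δ * rexp (W * s)) :=
          (exp_diff_le (exp_le_of (h.l0 s hs.le) (h.lz s hs.le))
            (exp_le_of (h'.l0 s hs.le) (h'.lz s hs.le))).trans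
            (mul_le_mul_of_nonneg_left (hl s hs (hsr.trans hrR)) hz)
        have e3 := h'.Mb s
        have e4 := hfac s
        have e5 : s ^ 2 ≤ r ^ 2 := by gcongr
        have : s ^ 2 * rexp (lam s) * avg g3 f s - s ^ 2 * rexp (lam' s) * avg g3 f' s
          = s ^ 2 * (rexp (lam s) * (avg g3 f s - avg g3 f' s)
            + (rexp (lam s) - rexp (lam' s)) * avg g3 f' s) := by ring
        rw [this, abs_mul, abs_of_nonneg (sq_nonneg s)]
        calc _ ≤ r ^ 2 * (z * (cA3 z D2 * Δ) + z * (W * Δ * rexp (W * s)) * cbb z F) := by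
              refine mul_le_mul e5 ((abs_add_le _ _).trans (add_le_add ?_ ?_)) (abs_nonneg _) (sq_nonneg _)
              · rw [abs_mul]; exact mul_le_mul e1 e4 (abs_nonneg _) hz
              · rw [abs_mul]; exact mul_le_mul e2 e3 (abs_nonneg _) (by positivity)
          _ = _ := by unfold cA1 cA2; ring)
    refine this.trans ?_
    have : r ^ 2 * cA1 z D2 * Δ * r ≤ r ^ 2 * cA1 z D2 * Δ * R := by gcongr
    nlinarith
  have hall : |(∫ s in (0:ℝ)..r, s ^ 2 * rexp (lam s) * avg g3 f s) -
      ∫ s in (0:ℝ)..r, s ^ 2 * rexp (lam' s) * avg g3 f' s|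
      ≤ r ^ 2 * (cA1 z D2 * R + cA2 z F * rexp (W * min r R)) * Δ := by
    rcases le_total r R with hc | hc
    · rw [min_eq_left hc]; exact hIntg r hr hc
    · rw [min_eq_right hc, eps_int_const h.lamc h.Mc hR.le h.M0 hc,
        eps_int_const h'.lamc h'.Mc hR.le h'.M0 hc]
      refine (hIntg R hR le_rfl).trans ?_
      gcongr
  rw [h.he r hr, h'.he r hr]
  unfold epsf
  rw [← mul_sub, abs_mul, abs_div, abs_of_pos (by positivity : 0 < r ^ 2), div_mul_eq_mul_div,
    div_le_iff₀ (by positivity)]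
  calc _ ≤ |q| * (r ^ 2 * (cA1 z D2 * R + cA2 z F * rexp (W * min r R)) * Δ) := by gcongr
    _ = _ := by ring

def ca1 (q z R F D2 : ℝ) : ℝ := 8 * π * (R ^ 2 * cA3 z D2 + cb1 q z F * R ^ 3 * (|q| * (cA1 z D2 * R)))
def ca2 (q z R F : ℝ) : ℝ := 8 * π * (cb1 q z F * R ^ 3 * (|q| * cA2 z F))

theorem h_time {q z R F D D2 W Δ : ℝ} {lam e lam' e' : ℝ → ℝ} {f f' fn fn' : E3 → E3 → ℝ}
    (h : FS q z R F D lam e f) (h' : FS q z R F D lam' e' f') (hR : 0 < R) (hW : 0 < W)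
    (hΔ : 0 ≤ Δ) (hD2 : 0 ≤ D2) (hf : ∀ x v, |f x v - f' x v| ≤ D2 * Δ)
    (hl : ∀ r, 0 < r → r ≤ R → |lam r - lam' r| ≤ W * Δ * rexp (W * r))
    (hn : StatF z R F D fn) (hn' : StatF z R F D fn') (hfn : ∀ x v, |fn x v - fn' x v| ≤ D2 * Δ)
    {r : ℝ} (hr : 0 < r) :
    |(1 - 2 * (4 * π * ∫ s in (0:ℝ)..r, s ^ 2 * (avg w fn s + (1/2) * (rexp (lam s) * e s) ^ 2)) / r)
      - (1 - 2 * (4 * π * ∫ s in (0:ℝ)..r, s ^ 2 * (avg w fn' s + (1/2) * (rexp (lam' s) * e' s) ^ 2)) / r)|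
      ≤ (ca1 q z R F D2 + ca2 q z R F * rexp (W * min r R)) * Δ := by
  have hz := h.hz
  have hV := VB_nonneg z
  have hbb := h.hbb
  have hb1 := h.hb1
  have hA3 : 0 ≤ cA3 z D2 := by unfold cA3; positivity
  have hA1 : 0 ≤ cA1 z D2 := by unfold cA1; positivity
  have hA2 : 0 ≤ cA2 z F := by unfold cA2; positivity
  have hc : ContinuousOn (fun s => s ^ 2 * (avg w fn s + (1/2) * (rexp (lam s) * e s) ^ 2)) (Set.Ici 0) :=
    (continuousOn_id.pow 2).mul ((avg_cont hn continuous_w (w_bd z)).continuousOn.add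
      (continuousOn_const.mul (h.ecc.pow 2)))
  have hc' : ContinuousOn (fun s => s ^ 2 * (avg w fn' s + (1/2) * (rexp (lam' s) * e' s) ^ 2)) (Set.Ici 0) :=
    (continuousOn_id.pow 2).mul ((avg_cont hn' continuous_w (w_bd z)).continuousOn.add
      (continuousOn_const.mul (h'.ecc.pow 2)))
  have hIntg := prim_bound (r := r) (φ := fun s => s ^ 2 * (avg w fn s + (1/2) * (rexp (lam s) * e s) ^ 2)
      - s ^ 2 * (avg w fn' s + (1/2) * (rexp (lam' s) * e' s) ^ 2))
      (c := (R ^ 2 * cA3 z D2 + cb1 q z F * R ^ 3 *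
        (|q| * (cA1 z D2 * R + cA2 z F * rexp (W * min r R)))) * Δ) hr.le (by
    intro s hs hsr
    have e1 : |s ^ 2 * (avg w fn s - avg w fn' s)| ≤ R ^ 2 * (cA3 z D2 * Δ) := by
      rcases le_or_gt s R with hsR | hsR
      · rw [abs_mul, abs_of_nonneg (sq_nonneg s)]
        have := avg_diff hn hn' hfn continuous_w (w_bd z) s
        refine mul_le_mul (by gcongr) (this.trans (le_of_eq (by unfold cA3; ring))) (abs_nonneg _) (sq_nonneg _)
      · rw [avg_zero hn hsR, avg_zero hn' hsR]; simp; positivity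
    have e2 := eps_time h h' hR hW hΔ hD2 hf hl hs
    have e3 := h.eb2 hR hs
    have e4 := h'.eb2 hR hs
    set x := rexp (lam s) * e s
    set y := rexp (lam' s) * e' s
    have e5 : rexp (W * min s R) ≤ rexp (W * min r R) := by
      apply Real.exp_le_exp.2; gcongr
    have e6 : |x - y| ≤ |q| * (cA1 z D2 * R + cA2 z F * rexp (W * min r R)) * Δ := by
      refine e2.trans ?_; gcongr
    have e7 : |(1/2) * (s ^ 2 * (x + y))| ≤ cb1 q z F * R ^ 3 := by
      rw [abs_mul, abs_mul, abs_of_nonneg (sq_nonneg s), abs_of_pos (by norm_num : (0:ℝ) < 1/2)]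
      have := mul_le_mul_of_nonneg_left (abs_add_le x y) (sq_nonneg s)
      linarith
    have : s ^ 2 * (avg w fn s + (1/2) * x ^ 2) - s ^ 2 * (avg w fn' s + (1/2) * y ^ 2)
      = s ^ 2 * (avg w fn s - avg w fn' s) + ((1/2) * (s ^ 2 * (x + y))) * (x - y) := by ring
    rw [this]
    refine (abs_add_le _ _).trans ?_
    rw [abs_mul ((1/2) * (s ^ 2 * (x + y)))]
    have e8 := mul_le_mul e7 e6 (abs_nonneg _) (by positivity)
    linarith)
  rw [intervalIntegral.integral_sub (ii_of_cont hc le_rfl hr.le) (ii_of_cont hc' le_rfl hr.le)] at hIntg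
  set I1 := ∫ s in (0:ℝ)..r, s ^ 2 * (avg w fn s + (1/2) * (rexp (lam s) * e s) ^ 2)
  set I2 := ∫ s in (0:ℝ)..r, s ^ 2 * (avg w fn' s + (1/2) * (rexp (lam' s) * e' s) ^ 2)
  have : (1 - 2 * (4 * π * I1) / r) - (1 - 2 * (4 * π * I2) / r) = -(8 * π * (I1 - I2) / r) := by
    field_simp; ring
  rw [this, abs_neg, abs_div, abs_mul, abs_of_pos (by positivity : 0 < 8 * π), abs_of_pos hr,
    div_le_iff₀ hr]
  calc _ ≤ 8 * π * ((R ^ 2 * cA3 z D2 + cb1 q z F * R ^ 3 *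
        (|q| * (cA1 z D2 * R + cA2 z F * rexp (W * min r R)))) * Δ * r) := by gcongr
    _ = _ := by unfold ca1 ca2; ring

/-! ### The constants, the level predicate, and the induction step -/

/-- The constants of the argument. -/
structure Cs where
  (r0 u0 q0 F L0 z R B B' K W L τ : ℝ)

namespace Cs
def D (c : Cs) : ℝ := max c.F (3 * c.L0)
def D2 (c : Cs) : ℝ := 3 * c.L0 * c.B'
def b8 (c : Cs) (q : ℝ) : ℝ := ca1 q c.z c.R c.F c.D2 + ca2 q c.z c.R c.F * rexp (c.W * c.R)
end Cs

/-- Relations among the data and the constants. -/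
structure Ok (q : ℝ) (f0 : E3 → E3 → ℝ) (lam0 e0 : ℝ → ℝ) (c : Cs) : Prop where
  hs0 : ∀ x v, f0 x v ≠ 0 → ‖x‖ ≤ c.r0 ∧ ‖v‖ ≤ c.u0
  hn0 : ∀ x v, 0 ≤ f0 x v
  hF0 : ∀ x v, f0 x v ≤ c.F
  hL0 : ∀ p p' : E3 × E3, |f0 p.1 p.2 - f0 p'.1 p'.2| ≤ c.L0 * ‖p - p'‖
  hL : 0 ≤ c.L0
  hr0 : 0 ≤ c.r0
  hu0 : 0 ≤ c.u0
  hR : c.r0 + 1 ≤ c.R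
  hz : c.u0 + 1 ≤ c.z
  hz' : c.q0 + 1 ≤ c.z
  hBB : c.B < c.B'
  hB : 0 ≤ c.B
  hK : 0 ≤ c.K
  hτ : 0 < c.τ
  hτB : c.B' * c.τ ≤ 1
  hτK : c.K * c.τ ≤ 1
  hτ8 : c.q0 * c.b8 q * c.τ ≤ 1 / 2
  hτL : c.L * c.τ ≤ 1
  hLB : c.B' ≤ c.L
  hL8 : 2 * c.q0 ^ 2 * c.b8 q ≤ c.L
  hW : 0 < c.W
  hW' : c.z / 2 * (ca1 q c.z c.R c.F c.D2 + ca2 q c.z c.R c.F) ≤ c.W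
  hfield : ∀ (lam mu lamT e : ℝ → ℝ → ℝ) (s : ℝ) (rh p k : ℝ → ℝ),
      StatM c.z (c.R + 2) (cb q c.z c.R c.F c.D) (lam s) (mu s) (lamT s) (e s) rh p k →
      (∀ x v : E3, ‖x‖ ≤ c.R + 2 → ‖v‖ ≤ c.z + 2 → ‖Fchar q lam mu lamT e s (x, v)‖ ≤ c.B) ∧
      (∀ x v y u : E3, ‖x‖ ≤ c.R + 2 → ‖v‖ ≤ c.z + 2 → ‖y‖ ≤ c.R + 2 → ‖u‖ ≤ c.z + 2 →
        ‖Fchar q lam mu lamT e s (x, v) - Fchar q lam mu lamT e s (y, u)‖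
          ≤ c.K * ‖((x, v) - (y, u) : E3 × E3)‖)
  hq0 : ∀ r, 0 ≤ r → rexp (2 * lam0 r) ≤ c.q0
  l00 : lam0 0 = 0
  e00 : e0 0 = 0
  hb1 : ∀ r, 0 < r → rexp (-2 * lam0 r) = 1 - 2 * (4 * π * ∫ s in (0:ℝ)..r, s ^ 2 *
      (avg w f0 s + (1/2) * (rexp (lam0 s) * e0 s) ^ 2)) / r
  hb2 : ∀ r, 0 < r → rexp (lam0 r) * e0 r = epsf q lam0 (avg g3 f0) r

/-- The bounds carried through the induction. -/
structure Lvl (q : ℝ) (lam0 e0 : ℝ → ℝ) (c : Cs) (lam mu lamT e : ℝ → ℝ → ℝ)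
    (f : ℝ → E3 → E3 → ℝ) : Prop where
  fs : ∀ t, 0 ≤ t → t < c.τ → FS q c.z c.R c.F c.D (lam t) (e t) (f t)
  ft : ∀ s t, 0 ≤ s → s < c.τ → 0 ≤ t → t < c.τ → ∀ x v, |f t x v - f s x v| ≤ c.D2 * |t - s|
  fv : ∀ t, 0 ≤ t → t < c.τ → ∀ x v, f t x v ≠ 0 → ‖v‖ ≤ c.u0 + c.L * t
  lq : ∀ t, 0 ≤ t → t < c.τ → ∀ r, 0 ≤ r → rexp (2 * lam t r) ≤ c.q0 + c.L * t
  lt : ∀ s t, 0 ≤ s → s < c.τ → 0 ≤ t → t < c.τ → ∀ r, 0 < r → r ≤ c.R →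
    |lam t r - lam s r| ≤ c.W * |t - s| * rexp (c.W * r)
  i0 : ∀ r, 0 ≤ r → lam 0 r = lam0 r
  i0e : ∀ r, 0 ≤ r → e 0 r = e0 r
  sm : ∀ t, 0 ≤ t → t < c.τ → ∃ rh p k,
    StatM c.z (c.R + 2) (cb q c.z c.R c.F c.D) (lam t) (mu t) (lamT t) (e t) rh p k

theorem slice_cont {I : Set ℝ} {g : ℝ → ℝ → ℝ} {t : ℝ} (ht : t ∈ I)
    (h : ContinuousOn (fun p : ℝ × ℝ => g p.1 p.2) (I ×ˢ Set.Ici (0:ℝ))) :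
    ContinuousOn (g t) (Set.Ici 0) := by
  have : ContinuousOn (fun r : ℝ => (t, r)) (Set.Ici 0) := by fun_prop
  exact h.comp this (fun r hr => ⟨ht, hr⟩)

theorem slice_diff {I : Set ℝ} {g : ℝ → ℝ → ℝ} {t : ℝ} (ht : t ∈ I) (h : C2On I g) {r : ℝ}
    (hr : 0 < r) : DifferentiableAt ℝ (g t) r := by
  have h1 : ContDiffOn ℝ 2 (g t) (Set.Ici 0) := by
    have h2 : ContDiffOn ℝ 2 (fun r : ℝ => (t, r)) (Set.Ici 0) :=
      (contDiff_const.prodMk contDiff_id).contDiffOn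
    exact ContDiffOn.comp (g := fun p : ℝ × ℝ => g p.1 p.2) h h2 (fun r hr => ⟨ht, hr⟩)
  exact (h1.differentiableOn (by norm_num)).differentiableAt (Ici_mem_nhds hr)

theorem mem_Iv {τ t : ℝ} {T : ℝ≥0∞} (hT : ENNReal.ofReal τ ≤ T) (h0 : 0 ≤ t) (ht : t < τ) : t ∈ Iv T :=
  ⟨h0, ((ENNReal.ofReal_lt_ofReal_iff (h0.trans_lt ht)).2 ht).trans_le hT⟩

theorem mqm_eq (lam e : ℝ → ℝ → ℝ) (f : ℝ → E3 → E3 → ℝ) (t r : ℝ) :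
    mqm lam e f t r = 4 * π * ∫ s in (0:ℝ)..r, s ^ 2 *
      (avg w (f t) s + (1/2) * (rexp (lam t s) * e t s) ^ 2) := by
  unfold mqm
  congr 2
  funext s
  rw [rho_eq]

theorem int_congr0 {φ ψ : ℝ → ℝ} {r : ℝ} (hr : 0 ≤ r) (h : ∀ s, 0 ≤ s → φ s = ψ s) :
    ∫ s in (0:ℝ)..r, φ s = ∫ s in (0:ℝ)..r, ψ s := by
  apply intervalIntegral.integral_congr
  intro s hs
  rw [Set.uIcc_of_le hr] at hs
  exact h s hs.1

theorem step {q : ℝ} {f0 : E3 → E3 → ℝ} {lam0 mu0 e0 : ℝ → ℝ} {c : Cs} (hc : Ok q f0 lam0 e0 c)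
    {fI : ℕ → ℝ → E3 → E3 → ℝ} {lamI muI lamTI eI : ℕ → ℝ → ℝ → ℝ}
    {T : ℕ → ℝ≥0∞} {Z : ℕ → ℝ → ℝ → E3 × E3 → E3 × E3}
    (hscheme : IsScheme q f0 lam0 mu0 e0 fI lamI muI lamTI eI T Z)
    (hreg : ∀ n : ℕ, 0 < T n ∧
      RegMetric3 (Iv (T n)) (lamI n) (muI n) (lamTI n) ∧
      RegField (Iv (T n)) (eI n) ∧ RegDist (Iv (T n)) (fI n)) (n : ℕ)
    (hT : ENNReal.ofReal c.τ ≤ T n) (hv : Lvl q lam0 e0 c (lamI n) (muI n) (lamTI n) (eI n) (fI n)) :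
    ENNReal.ofReal c.τ ≤ T (n + 1) ∧
    Lvl q lam0 e0 c (lamI (n + 1)) (muI (n + 1)) (lamTI (n + 1)) (eI (n + 1)) (fI (n + 1)) := by
  obtain ⟨-, -, -, -, -, hlamT, hZ0, hZ, hf, hTs, hlam, hlam0, hmu, -, he, he0⟩ := hscheme
  have hB'0 : 0 ≤ c.B' := hc.hB.trans hc.hBB.le
  have hD0 : 0 ≤ c.D := le_max_of_le_right (by have := hc.hL; positivity)
  have hD20 : 0 ≤ c.D2 := by have := hc.hL; unfold Cs.D2; positivity
  have hRp : 0 < c.R := by linarith [hc.hr0, hc.hR]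
  have hL0 : 0 ≤ c.L := hB'0.trans hc.hLB
  have hq1 : 1 ≤ c.q0 := by have := hc.hq0 0 le_rfl; rw [hc.l00] at this; simpa using this
  obtain ⟨hA, hLip, hTim⟩ := transport (G := Fchar q (lamI n) (muI n) (lamTI n) (eI n))
    (Zf := Z (n + 1)) (f := fI (n + 1)) (τ := c.τ) hc.hs0 hc.hn0 hc.hF0 hc.hL0 hc.hL hc.hR hc.hz hc.hBB hB'0 hc.hK
    hc.hτB hc.hτK
    (fun t h0 ht p hp => by
      obtain ⟨rh, pp, k, hs⟩ := hv.sm t h0 ht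
      exact (hc.hfield _ _ _ _ t rh pp k hs).1 p.1 p.2 hp.1 hp.2)
    (fun t h0 ht p hp p' hp' => by
      obtain ⟨rh, pp, k, hs⟩ := hv.sm t h0 ht
      exact (hc.hfield _ _ _ _ t rh pp k hs).2 p.1 p.2 p'.1 p'.2 hp.1 hp.2 hp'.1 hp'.2)
    (fun t h0 ht p => hZ0 n t (mem_Iv hT h0 ht) p)
    (fun t h0 ht p s hs0 hs => hZ n t (mem_Iv hT h0 ht) p s (mem_Iv hT hs0 hs))
    (fun t h0 ht x v => hf n t (mem_Iv hT h0 ht) x v)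
  have hBt : ∀ t, 0 ≤ t → t < c.τ → c.B' * t ≤ 1 := fun t _ ht =>
    (mul_le_mul_of_nonneg_left ht.le hB'0).trans hc.hτB
  have hLt : ∀ t, 0 ≤ t → t < c.τ → c.L * t ≤ 1 := fun t _ ht =>
    (mul_le_mul_of_nonneg_left ht.le hL0).trans hc.hτL
  have hsf : ∀ t, 0 ≤ t → t < c.τ → StatF c.z c.R c.F c.D (fI (n + 1) t) := by
    intro t h0 ht
    refine ⟨fun x v hne => ?_, fun x v => ?_, fun x v => ?_, hLip t h0 ht⟩
    · have := hA t h0 ht x v hne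
      exact ⟨this.1, this.2.trans (by linarith [hBt t h0 ht, hc.hz])⟩
    · rw [hf n t (mem_Iv hT h0 ht)]; exact hc.hn0 _ _
    · rw [hf n t (mem_Iv hT h0 ht)]; exact hc.hF0 _ _
  have hf00 : fI (n + 1) 0 = f0 := by
    funext x v
    rw [hf n 0 (mem_Iv hT le_rfl hc.hτ), hZ0 n 0 (mem_Iv hT le_rfl hc.hτ)]
  -- the metric function
  let h : ℝ → ℝ → ℝ := fun t r => 1 - 2 * (4 * π * ∫ s in (0:ℝ)..r, s ^ 2 *
      (avg w (fI (n + 1) t) s + (1/2) * (rexp (lamI n t s) * eI n t s) ^ 2)) / r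
  have hdiff : ∀ s t, 0 ≤ s → s < c.τ → 0 ≤ t → t < c.τ → ∀ r, 0 < r → |h t r - h s r| ≤
      (ca1 q c.z c.R c.F c.D2 + ca2 q c.z c.R c.F * rexp (c.W * min r c.R)) * |t - s| := by
    intro s t hs0 hs ht0 ht r hr
    exact h_time (hv.fs t ht0 ht) (hv.fs s hs0 hs) hRp hc.hW (abs_nonneg _) hD20
      (hv.ft s t hs0 hs ht0 ht) (hv.lt s t hs0 hs ht0 ht) (hsf t ht0 ht) (hsf s hs0 hs)
      (hTim s t hs0 hs ht0 ht) hr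
  have hz0 : 0 ≤ c.z := by linarith [hc.hz, hc.hu0]
  have hF0 : 0 ≤ c.F := (hc.hn0 0 0).trans (hc.hF0 0 0)
  have hV := VB_nonneg c.z
  have hca2 : 0 ≤ ca2 q c.z c.R c.F := by
    have h1 := (hv.fs 0 le_rfl hc.hτ).hb1
    have h2 := (hv.fs 0 le_rfl hc.hτ).hbb
    unfold ca2 cA2; positivity
  have hca1 : 0 ≤ ca1 q c.z c.R c.F c.D2 := by
    have h1 := (hv.fs 0 le_rfl hc.hτ).hb1
    unfold ca1 cA1 cA3; positivity
  have hb80 : 0 ≤ c.b8 q := by unfold Cs.b8; positivity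
  have h0eq : ∀ r, 0 < r → h 0 r = rexp (-2 * lam0 r) := by
    intro r hr
    rw [hc.hb1 r hr]
    simp only [h]
    rw [hf00, int_congr0 hr.le (fun s hs => by rw [hv.i0 s hs, hv.i0e s hs])]
  have h0ge : ∀ r, 0 < r → 1 / c.q0 ≤ h 0 r := by
    intro r hr
    rw [h0eq r hr, show -2 * lam0 r = -(2 * lam0 r) by ring, Real.exp_neg, ← one_div]
    exact one_div_le_one_div_of_le (Real.exp_pos _) (hc.hq0 r hr.le)
  have hge : ∀ t, 0 ≤ t → t < c.τ → ∀ r, 0 < r → 1 / c.q0 - c.b8 q * t ≤ h t r := by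
    intro t h0 ht r hr
    have e1 := hdiff 0 t le_rfl hc.hτ h0 ht r hr
    have e2 : rexp (c.W * min r c.R) ≤ rexp (c.W * c.R) := by
      apply Real.exp_le_exp.2; have := hc.hW.le; gcongr; exact min_le_right _ _
    have e3 : (ca1 q c.z c.R c.F c.D2 + ca2 q c.z c.R c.F * rexp (c.W * min r c.R)) * |t - 0|
        ≤ c.b8 q * t := by
      rw [sub_zero, abs_of_nonneg h0]; unfold Cs.b8; gcongr
    have e4 := (abs_le.1 (e1.trans e3)).1
    linarith [h0ge r hr]
  have hx : ∀ t, 0 ≤ t → t < c.τ → c.q0 * (c.b8 q * t) ≤ 1 / 2 := by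
    intro t h0 ht
    have : c.q0 * c.b8 q * t ≤ c.q0 * c.b8 q * c.τ := by gcongr
    linarith [hc.hτ8]
  have hpos : ∀ t, 0 ≤ t → t < c.τ → ∀ r, 0 < r → 0 < h t r := by
    intro t h0 ht r hr
    refine lt_of_lt_of_le ?_ (hge t h0 ht r hr)
    have e1 := hx t h0 ht
    rw [sub_pos, lt_div_iff₀ (by linarith)]
    linarith
  have hT' : ENNReal.ofReal c.τ ≤ T (n + 1) := by
    refine le_of_forall_lt fun a ha => ?_
    obtain ⟨b, hab, hb⟩ := exists_between ha
    refine hab.trans_le ?_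
    rw [hTs n]
    have hbt : b ≠ ⊤ := (hb.trans_le le_top).ne
    have hbr : b.toReal < c.τ := (ENNReal.lt_ofReal_iff_toReal_lt hbt).1 hb
    refine le_sSup ⟨b.toReal, (ENNReal.ofReal_toReal hbt).symm,
      mem_Iv hT ENNReal.toReal_nonneg hbr, fun s hs r hr => ?_⟩
    have := hpos s hs.1 (hs.2.trans_lt hbr) r hr
    rw [mqm_eq]
    simp only [h, sub_pos, div_lt_one hr] at this
    exact this
  have hI : ∀ t, 0 ≤ t → t < c.τ → t ∈ Iv (T (n + 1)) := fun t h0 ht => mem_Iv hT' h0 ht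
  have hle1 : ∀ t, 0 ≤ t → t < c.τ → ∀ r, 0 < r → h t r ≤ 1 := by
    intro t h0 ht r hr
    have : 0 ≤ ∫ s in (0:ℝ)..r, s ^ 2 *
      (avg w (fI (n + 1) t) s + (1/2) * (rexp (lamI n t s) * eI n t s) ^ 2) := by
      apply intervalIntegral.integral_nonneg hr.le
      intro s _
      have := avg_nonneg (hsf t h0 ht) (fun v => (w_pos v).le) s
      positivity
    have h2 : 0 ≤ 2 * (4 * π * ∫ s in (0:ℝ)..r, s ^ 2 *
      (avg w (fI (n + 1) t) s + (1/2) * (rexp (lamI n t s) * eI n t s) ^ 2)) / r := by positivity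
    simp only [h]; linarith
  have hlh : ∀ t, 0 ≤ t → t < c.τ → ∀ r, 0 < r → rexp (-2 * lamI (n + 1) t r) = h t r := by
    intro t h0 ht r hr
    rw [hlam n t (hI t h0 ht) r hr, mqm_eq]
  have hl0 : ∀ t, 0 ≤ t → t < c.τ → ∀ r, 0 ≤ r → 0 ≤ lamI (n + 1) t r := by
    intro t h0 ht r hr
    rcases hr.eq_or_lt with rfl | hr
    · rw [hlam0 n t (hI t h0 ht)]
    · have e1 := hle1 t h0 ht r hr
      rw [← hlh t h0 ht r hr, Real.exp_le_one_iff] at e1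
      linarith
  have hlq : ∀ t, 0 ≤ t → t < c.τ → ∀ r, 0 ≤ r → rexp (2 * lamI (n + 1) t r) ≤ c.q0 + c.L * t := by
    intro t h0 ht r hr
    have hLt0 : 0 ≤ c.L * t := by positivity
    rcases hr.eq_or_lt with rfl | hr
    · rw [hlam0 n t (hI t h0 ht), mul_zero, Real.exp_zero]; linarith
    · have e1 := hge t h0 ht r hr
      rw [← hlh t h0 ht r hr] at e1
      have e2 : rexp (2 * lamI (n + 1) t r) * rexp (-2 * lamI (n + 1) t r) = 1 := by
        rw [← Real.exp_add]; simp
      have e3 := hx t h0 ht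
      set x := c.b8 q * t with hxd
      have hx0 : 0 ≤ x := by positivity
      have e4 : 1 ≤ (c.q0 + 2 * c.q0 ^ 2 * x) * (1 / c.q0 - x) := by
        have : (c.q0 + 2 * c.q0 ^ 2 * x) * (1 / c.q0 - x) = 1 + (c.q0 * x) * (1 - 2 * (c.q0 * x)) := by
          field_simp; ring
        rw [this]
        have : 0 ≤ (c.q0 * x) * (1 - 2 * (c.q0 * x)) := mul_nonneg (by positivity) (by linarith)
        linarith
      have e5 : (c.q0 + 2 * c.q0 ^ 2 * x) * (1 / c.q0 - x) ≤ (c.q0 + 2 * c.q0 ^ 2 * x) * rexp (-2 * lamI (n + 1) t r) :=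
        mul_le_mul_of_nonneg_left e1 (by positivity)
      have e6 : rexp (2 * lamI (n + 1) t r) ≤ c.q0 + 2 * c.q0 ^ 2 * x := by
        have := (e4.trans e5)
        rw [← e2] at this
        exact le_of_mul_le_mul_right this (Real.exp_pos _)
      have e7 : 2 * c.q0 ^ 2 * x ≤ c.L * t := by
        rw [hxd, ← mul_assoc]; exact mul_le_mul_of_nonneg_right hc.hL8 h0
      linarith
  have hlz : ∀ t, 0 ≤ t → t < c.τ → ∀ r, 0 ≤ r → rexp (2 * lamI (n + 1) t r) ≤ c.z := by
    intro t h0 ht r hr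
    linarith [hlq t h0 ht r hr, hLt t h0 ht, hc.hz']
  obtain ⟨-, ⟨⟨hC2l, hC2m, hil, him, -⟩, -⟩, ⟨hEc, -⟩, -⟩ := hreg (n + 1)
  have hfs : ∀ t, 0 ≤ t → t < c.τ →
      FS q c.z c.R c.F c.D (lamI (n + 1) t) (eI (n + 1) t) (fI (n + 1) t) := by
    intro t h0 ht
    refine ⟨hsf t h0 ht, slice_cont (hI t h0 ht) hC2l.continuousOn, slice_cont (hI t h0 ht) hEc,
      hl0 t h0 ht, hlz t h0 ht, fun r hr => ?_⟩
    rw [he n t (hI t h0 ht) r hr]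
    unfold epsf
    have e1 : rexp (lamI (n + 1) t r) * rexp (-(lamI (n + 1) t r)) = 1 := by
      rw [← Real.exp_add]; simp
    simp only [Mch_eq]
    calc _ = (rexp (lamI (n + 1) t r) * rexp (-(lamI (n + 1) t r))) * (q / r ^ 2 *
        ∫ s in (0:ℝ)..r, s ^ 2 * rexp (lamI (n + 1) t s) * avg g3 (fI (n + 1) t) s) := by ring
      _ = _ := by rw [e1, one_mul]
  have hi0 : ∀ r, 0 ≤ r → lamI (n + 1) 0 r = lam0 r := by
    intro r hr
    rcases hr.eq_or_lt with rfl | hr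
    · rw [hlam0 n 0 (hI 0 le_rfl hc.hτ), hc.l00]
    · have e1 := hlh 0 le_rfl hc.hτ r hr
      rw [h0eq r hr, Real.exp_eq_exp] at e1
      linarith
  refine ⟨hT', hfs, hTim, ?_, hlq, ?_, hi0, ?_, ?_⟩
  · intro t h0 ht x v hne
    refine (hA t h0 ht x v hne).2.trans ?_
    have := mul_le_mul_of_nonneg_right hc.hLB h0
    linarith
  · intro s t hs0 hs ht0 ht r hr hrR
    have e1 := exp_diff_ge (hlz t ht0 ht r hr.le) (hlz s hs0 hs r hr.le)
    rw [hlh t ht0 ht r hr, hlh s hs0 hs r hr] at e1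
    have e2 := hdiff s t hs0 hs ht0 ht r hr
    rw [min_eq_left hrR] at e2
    have e3 : 1 ≤ rexp (c.W * r) := Real.one_le_exp (by have := hc.hW; positivity)
    have e4 : ca1 q c.z c.R c.F c.D2 ≤ ca1 q c.z c.R c.F c.D2 * rexp (c.W * r) :=
      le_mul_of_one_le_right hca1 e3
    calc _ ≤ c.z / 2 * |h t r - h s r| := e1
      _ ≤ c.z / 2 * ((ca1 q c.z c.R c.F c.D2 * rexp (c.W * r) + ca2 q c.z c.R c.F * rexp (c.W * r)) * |t - s|) := by
          refine mul_le_mul_of_nonneg_left (e2.trans ?_) (by positivity)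
          gcongr
      _ = c.z / 2 * (ca1 q c.z c.R c.F c.D2 + ca2 q c.z c.R c.F) * |t - s| * rexp (c.W * r) := by ring
      _ ≤ _ := by
          gcongr
          exact hc.hW'
  · intro r hr
    rcases hr.eq_or_lt with rfl | hr
    · rw [he0 n 0 (hI 0 le_rfl hc.hτ), hc.e00]
    · have e1 := (hfs 0 le_rfl hc.hτ).he r hr
      have e2 := hc.hb2 r hr
      have e3 : epsf q (lamI (n + 1) 0) (avg g3 (fI (n + 1) 0)) r = epsf q lam0 (avg g3 f0) r := by
        unfold epsf
        rw [hf00, int_congr0 hr.le (fun s hs => by rw [hi0 s hs])]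
      rw [e3, ← e2, hi0 r hr.le] at e1
      exact mul_left_cancel₀ (Real.exp_pos _).ne' e1
  · intro t h0 ht
    refine ⟨_, _, _, (hfs t h0 ht).statM (hv.fs t h0 ht) hRp hD0
      (slice_cont (hI t h0 ht) hC2m.continuousOn) (fun r hr => slice_diff (hI t h0 ht) hC2l hr)
      (fun r hr => slice_diff (hI t h0 ht) hC2m hr) (hil t (hI t h0 ht)) (him t (hI t h0 ht))
      (hlh t h0 ht) ?_ ?_⟩
    · intro r hr
      rw [hmu n t (hI t h0 ht) r hr, mqm_eq, prs_eq]
    · intro r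
      rw [hlamT (n + 1) t r, kk_eq]

/-! ### Initial data -/

theorem supp_bdd {f0 : E3 → E3 → ℝ} (h : HasCompactSupport (fun z : E3 × E3 => f0 z.1 z.2)) :
    ∃ C : ℝ, ∀ x v, f0 x v ≠ 0 → ‖x‖ ≤ C ∧ ‖v‖ ≤ C := by
  obtain ⟨C, hC⟩ := h.isCompact.isBounded.exists_norm_le
  refine ⟨C, fun x v hne => ?_⟩
  have hm : (x, v) ∈ tsupport (fun z : E3 × E3 => f0 z.1 z.2) := subset_tsupport _ hne
  have := hC _ hm
  exact ⟨(norm_fst_le (x, v)).trans this, (norm_snd_le (x, v)).trans this⟩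

theorem le_suppMom {f0 : E3 → E3 → ℝ} (h : HasCompactSupport (fun z : E3 × E3 => f0 z.1 z.2))
    {x v : E3} (hne : f0 x v ≠ 0) : ‖x‖ ≤ suppRad f0 ∧ ‖v‖ ≤ suppMom f0 := by
  obtain ⟨C, hC⟩ := supp_bdd h
  constructor
  · exact le_csSup ⟨C, by rintro _ ⟨x, v, hn, rfl⟩; exact (hC x v hn).1⟩ ⟨x, v, hne, rfl⟩
  · exact le_csSup ⟨C, by rintro _ ⟨x, v, hn, rfl⟩; exact (hC x v hn).2⟩ ⟨x, v, hne, rfl⟩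

theorem suppMom_nonneg (f0 : E3 → E3 → ℝ) : 0 ≤ suppMom f0 :=
  Real.sSup_nonneg (by rintro _ ⟨x, v, _, rfl⟩; exact norm_nonneg _)
theorem suppRad_nonneg (f0 : E3 → E3 → ℝ) : 0 ≤ suppRad f0 :=
  Real.sSup_nonneg (by rintro _ ⟨x, v, _, rfl⟩; exact norm_nonneg _)
theorem supNorm_nonneg (f0 : E3 → E3 → ℝ) : 0 ≤ supNorm f0 :=
  Real.iSup_nonneg (fun _ => abs_nonneg _)

theorem le_supNorm {f0 : E3 → E3 → ℝ} (h : HasCompactSupport (fun z : E3 × E3 => f0 z.1 z.2))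
    (hc : Continuous (fun z : E3 × E3 => f0 z.1 z.2)) (x v : E3) : f0 x v ≤ supNorm f0 := by
  obtain ⟨C, hC⟩ := h.exists_bound_of_continuous hc
  refine (le_abs_self _).trans (le_ciSup (f := fun z : E3 × E3 => |f0 z.1 z.2|)
    ⟨C, ?_⟩ (x, v))
  rintro _ ⟨p, rfl⟩; exact hC p

theorem le_q0max {lam0 : ℝ → ℝ} (hc : Continuous lam0) (hl : Tendsto lam0 atTop (𝓝 0)) {r : ℝ}
    (hr : 0 ≤ r) : rexp (2 * lam0 r) ≤ q0max lam0 := by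
  have hb : ∃ N, ∀ s, N ≤ s → lam0 s ≤ 1 :=
    eventually_atTop.1 ((hl.eventually (gt_mem_nhds zero_lt_one)).mono fun _ h => le_of_lt h)
  obtain ⟨N, hN⟩ := hb
  obtain ⟨C, hC⟩ := (isCompact_Icc (a := (0:ℝ)) (b := N)).exists_bound_of_continuousOn hc.continuousOn
  refine le_csSup ⟨rexp (2 * max 1 C), ?_⟩ ⟨r, hr, rfl⟩
  rintro _ ⟨s, hs, rfl⟩
  apply Real.exp_le_exp.2
  have : lam0 s ≤ max 1 C := by
    rcases le_total N s with h | h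
    · exact (hN s h).trans (le_max_left _ _)
    · exact ((le_abs_self _).trans (hC s ⟨hs, h⟩)).trans (le_max_right _ _)
  linarith

theorem ftc_zero {Φ φ : ℝ → ℝ} (hΦ : Continuous Φ) (h0 : Φ 0 = 0)
    (hφ : ContinuousOn φ (Set.Ici 0)) (hd : ∀ r, 0 < r → HasDerivAt Φ (φ r) r) {r : ℝ} (hr : 0 < r) :
    Φ r = ∫ s in (0:ℝ)..r, φ s := by
  rw [intervalIntegral.integral_eq_sub_of_hasDerivAt_of_le hr.le hΦ.continuousOn
    (fun s hs => hd s hs.1) (ii_of_cont hφ le_rfl hr.le), h0, sub_zero]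

theorem init_forms {q z R F D : ℝ} {f0 : E3 → E3 → ℝ} {lam0 mu0 e0 : ℝ → ℝ}
    (hdata : InitialData q f0 lam0 mu0 e0) (hf : StatF z R F D f0) :
    (∀ r, 0 < r → rexp (-2 * lam0 r) = 1 - 2 * (4 * π * ∫ s in (0:ℝ)..r, s ^ 2 *
      (avg w f0 s + (1/2) * (rexp (lam0 s) * e0 s) ^ 2)) / r) ∧
    (∀ r, 0 < r → rexp (lam0 r) * e0 r = epsf q lam0 (avg g3 f0) r) ∧
    (∀ r, 0 < r → deriv mu0 r = rexp (2 * lam0 r) *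
      ((4 * π * ∫ s in (0:ℝ)..r, s ^ 2 * (avg w f0 s + (1/2) * (rexp (lam0 s) * e0 s) ^ 2)) / r ^ 2
        + 4 * π * r * (avg g1 f0 r - (1/2) * (rexp (lam0 r) * e0 r) ^ 2))) := by
  obtain ⟨-, -, -, -, -, hl, hm, he, l00, e00, -, -, -, Eq1, Eq2, Eq3⟩ := hdata
  have hlc := hl.continuous
  have hec := he.continuous
  have hld : Differentiable ℝ lam0 := hl.differentiable (by simp)
  have hed : Differentiable ℝ e0 := he.differentiable (by simp)
  have hsq : ∀ r, (1/2 : ℝ) * rexp (2 * lam0 r) * (e0 r) ^ 2 = (1/2) * (rexp (lam0 r) * e0 r) ^ 2 := by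
    intro r
    have : rexp (2 * lam0 r) = rexp (lam0 r) ^ 2 := by rw [← Real.exp_nat_mul]; norm_num
    rw [this]; ring
  have hA : ∀ r, 0 < r → rexp (-2 * lam0 r) = 1 - 2 * (4 * π * ∫ s in (0:ℝ)..r, s ^ 2 *
      (avg w f0 s + (1/2) * (rexp (lam0 s) * e0 s) ^ 2)) / r := by
    intro r hr
    have hac := avg_cont hf continuous_w (w_bd z)
    have h1 := ftc_zero (Φ := fun r => r * (1 - rexp (-2 * lam0 r)))
      (φ := fun s => 8 * π * (s ^ 2 * (avg w f0 s + (1/2) * (rexp (lam0 s) * e0 s) ^ 2)))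
      (by fun_prop) (by simp) (Continuous.continuousOn (by fun_prop)) (fun s hs => by
        have d1 : HasDerivAt (fun u => rexp (-2 * lam0 u)) (rexp (-2 * lam0 s) * (-2 * deriv lam0 s)) s :=
          ((hld s).hasDerivAt.const_mul (-2)).exp
        have d2 := (hasDerivAt_id s).mul (d1.const_sub 1)
        refine d2.congr_deriv ?_
        have := Eq1 s hs
        rw [hsq s] at this
        have h3 : avg w f0 s = ∫ v : E3, w v * f0 (pt s) v := rfl
        rw [h3]
        simp only [id]
        linarith) hr
    rw [intervalIntegral.integral_const_mul] at h1
    have hr' : r ≠ 0 := hr.ne'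
    set I := ∫ s in (0:ℝ)..r, s ^ 2 * (avg w f0 s + (1/2) * (rexp (lam0 s) * e0 s) ^ 2)
    set E := rexp (-2 * lam0 r)
    have h2 : 2 * (4 * π * I) / r = 1 - E := by
      rw [div_eq_iff hr']; linarith
    rw [h2]; ring
  refine ⟨hA, fun r hr => ?_, fun r hr => ?_⟩
  · have hac := avg_cont hf g3_cont (g3_bd z)
    have h1 := ftc_zero (Φ := fun s => s ^ 2 * Real.exp (lam0 s) * e0 s)
      (φ := fun s => q * (s ^ 2 * rexp (lam0 s) * avg g3 f0 s))
      (by fun_prop) (by simp) (Continuous.continuousOn (by fun_prop)) (fun s hs => by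
        have d1 : DifferentiableAt ℝ (fun s => s ^ 2 * Real.exp (lam0 s) * e0 s) s := by
          have := hld s; have := hed s; fun_prop
        refine d1.hasDerivAt.congr_deriv ?_
        rw [Eq3 s hs]
        have : avg g3 f0 s = ∫ v : E3, f0 (pt s) v := by simp [avg, g3]
        rw [this]; ring) hr
    rw [intervalIntegral.integral_const_mul] at h1
    unfold epsf
    rw [div_mul_eq_mul_div, ← h1]
    field_simp
  · have h1 := Eq2 r hr
    rw [hsq r] at h1
    have h2 := hA r hr
    have h3 : avg g1 f0 r = ∫ v : E3, (v 0) ^ 2 / w v * f0 (pt r) v := rfl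
    rw [h3]
    set I := ∫ s in (0:ℝ)..r, s ^ 2 * (avg w f0 s + (1/2) * (rexp (lam0 s) * e0 s) ^ 2)
    set P := (∫ v : E3, (v 0) ^ 2 / w v * f0 (pt r) v) - (1/2) * (rexp (lam0 r) * e0 r) ^ 2
    have h4 : rexp (2 * lam0 r) * rexp (-2 * lam0 r) = 1 := by rw [← Real.exp_add]; simp
    have h5 : 2 * r * (rexp (-2 * lam0 r) * deriv mu0 r) = 2 * r * (4 * π * I / r ^ 2 + 4 * π * r * P) := by
      have : 2 * r * (rexp (-2 * lam0 r) * deriv mu0 r) = 8 * π * r ^ 2 * P + 1 - rexp (-2 * lam0 r) := by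
        linarith
      rw [this, h2]; field_simp; ring
    have h6 := mul_left_cancel₀ (by positivity : 2 * r ≠ 0) h5
    rw [← h6, ← mul_assoc, h4, one_mul]

theorem exists_ok {q : ℝ} {f0 : E3 → E3 → ℝ} {lam0 mu0 e0 : ℝ → ℝ}
    (hdata : InitialData q f0 lam0 mu0 e0) :
    ∃ c : Cs, Ok q f0 lam0 e0 c ∧ c.u0 = suppMom f0 ∧ c.q0 = q0max lam0 ∧
      StatF c.z c.R c.F c.D f0 := by
  have hdata' := hdata
  obtain ⟨hfs, hfn, hfc, -, -, hl, hm, he, l00, e00, hli, hmi, hei, Eq1, Eq2, Eq3⟩ := hdata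
  obtain ⟨Lc, hLc⟩ := hfs.lipschitzWith_of_hasCompactSupport hfc (by simp)
  have hq0 : ∀ r, 0 ≤ r → rexp (2 * lam0 r) ≤ q0max lam0 := fun r hr => le_q0max hl.continuous hli hr
  have hq1 : 1 ≤ q0max lam0 := by have := hq0 0 le_rfl; rw [l00] at this; simpa using this
  set u0 := suppMom f0 with hu0
  set r0 := suppRad f0 with hr0
  set q0 := q0max lam0 with hq0d
  set F := supNorm f0 with hFd
  have u0n : 0 ≤ u0 := suppMom_nonneg f0
  have r0n : 0 ≤ r0 := suppRad_nonneg f0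
  have Fn : 0 ≤ F := supNorm_nonneg f0
  set L0 : ℝ := (Lc : ℝ) with hL0
  have L0n : 0 ≤ L0 := Lc.2
  have hLip : ∀ p p' : E3 × E3, |f0 p.1 p.2 - f0 p'.1 p'.2| ≤ L0 * ‖p - p'‖ := by
    intro p p'
    have := hLc.dist_le_mul p p'
    rwa [Real.dist_eq, dist_eq_norm] at this
  set z := u0 + q0 + 1 with hz
  set R := r0 + 1 with hR
  set D := max F (3 * L0) with hD
  have Dn : 0 ≤ D := le_max_of_le_left Fn
  have zn : 0 ≤ z := by positivity
  have hsf : StatF z R F D f0 := by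
    refine ⟨fun x v hne => ?_, hfn, fun x v => le_supNorm hfc hfs.continuous x v, fun x v y u => ?_⟩
    · have := le_suppMom hfc hne
      exact ⟨this.1.trans (by linarith), this.2.trans (by linarith)⟩
    · refine (hLip (x, v) (y, u)).trans ?_
      gcongr
      exact le_trans (by linarith) (le_max_right F (3 * L0))
  have hcb : 0 ≤ cb q z R F D := by
    have := VB_nonneg z
    have : 0 ≤ cbb z F := by unfold cbb; positivity
    have : 0 ≤ cb1 q z F := by unfold cb1; positivity
    have : 0 ≤ cl1 q z R F := by unfold cl1; positivity
    unfold cb; positivity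
  obtain ⟨B, K, hB, hK, hfield⟩ := exists_field_consts q z (R + 2) (cb q z R F D) (z + 2)
    (by positivity) hcb zn (by positivity)
  set B' := B + 1 with hB'
  set D2 := 3 * L0 * B' with hD2
  set W := max 1 (z / 2 * (ca1 q z R F D2 + ca2 q z R F)) with hW
  set b8 := ca1 q z R F D2 + ca2 q z R F * rexp (W * R) with hb8
  set L := max B' (2 * q0 ^ 2 * b8) with hL
  set d := 1 + B' + K + 2 * |q0 * b8| + |L| with hd
  have hdp : 0 < d := by positivity
  have hdiv : ∀ x, x ≤ d → x * (1 / d) ≤ 1 := by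
    intro x hx
    rw [mul_one_div, div_le_one hdp]; exact hx
  have B'n : 0 ≤ B' := by positivity
  have a1 := abs_nonneg (q0 * b8)
  have a2 := abs_nonneg L
  have a3 := le_abs_self (q0 * b8)
  have a4 := le_abs_self L
  obtain ⟨i1, i2, -⟩ := init_forms hdata' hsf
  refine ⟨⟨r0, u0, q0, F, L0, z, R, B, B', K, W, L, 1 / d⟩, ?_, rfl, rfl, hsf⟩
  exact
    { hs0 := fun x v hne => le_suppMom hfc hne
      hn0 := hfn
      hF0 := hsf.le
      hL0 := hLip
      hL := L0n
      hr0 := r0n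
      hu0 := u0n
      hR := le_rfl
      hz := by show u0 + 1 ≤ z; linarith
      hz' := by show q0 + 1 ≤ z; linarith
      hBB := by show B < B'; linarith
      hB := hB
      hK := hK
      hτ := by show 0 < 1 / d; positivity
      hτB := hdiv B' (by linarith)
      hτK := hdiv K (by linarith)
      hτ8 := by
        show q0 * b8 * (1 / d) ≤ 1 / 2
        have := hdiv (2 * (q0 * b8)) (by linarith)
        linarith
      hτL := hdiv L (by linarith)
      hLB := le_max_left _ _
      hL8 := le_max_right _ _
      hW := lt_of_lt_of_le one_pos (le_max_left _ _)
      hW' := le_max_right _ _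
      hfield := hfield
      hq0 := hq0
      l00 := l00
      e00 := e00
      hb1 := i1
      hb2 := i2 }

theorem base {q : ℝ} {f0 : E3 → E3 → ℝ} {lam0 mu0 e0 : ℝ → ℝ} {c : Cs} (hc : Ok q f0 lam0 e0 c)
    (hdata : InitialData q f0 lam0 mu0 e0) (hsf : StatF c.z c.R c.F c.D f0)
    {fI : ℕ → ℝ → E3 → E3 → ℝ} {lamI muI lamTI eI : ℕ → ℝ → ℝ → ℝ}
    {T : ℕ → ℝ≥0∞} {Z : ℕ → ℝ → ℝ → E3 × E3 → E3 × E3}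
    (hscheme : IsScheme q f0 lam0 mu0 e0 fI lamI muI lamTI eI T Z) :
    ENNReal.ofReal c.τ ≤ T 0 ∧
    Lvl q lam0 e0 c (lamI 0) (muI 0) (lamTI 0) (eI 0) (fI 0) := by
  obtain ⟨hf, hlam, hmu, he, hT, hlamT, -⟩ := hscheme
  obtain ⟨i1, i2, i3⟩ := init_forms hdata hsf
  obtain ⟨-, -, -, -, -, hl, hm, hec, l00, e00, hli, hmi, -⟩ := hdata
  have hB'0 : 0 ≤ c.B' := hc.hB.trans hc.hBB.le
  have hL0 : 0 ≤ c.L := hB'0.trans hc.hLB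
  have hD0 : 0 ≤ c.D := le_max_of_le_right (by have := hc.hL; positivity)
  have hD20 : 0 ≤ c.D2 := by have := hc.hL; unfold Cs.D2; positivity
  have hRp : 0 < c.R := by linarith [hc.hr0, hc.hR]
  have hfe : ∀ t, fI 0 t = f0 := fun t => by funext x v; exact hf t x v
  have hle : ∀ t, lamI 0 t = lam0 := fun t => by funext r; exact hlam t r
  have hme : ∀ t, muI 0 t = mu0 := fun t => by funext r; exact hmu t r
  have hee : ∀ t, eI 0 t = e0 := fun t => by funext r; exact he t r
  have hpos : ∀ r, 0 ≤ r → 0 ≤ lam0 r := by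
    intro r hr
    rcases hr.eq_or_lt with rfl | hr
    · rw [l00]
    · have e1 := i1 r hr
      have : 0 ≤ ∫ s in (0:ℝ)..r, s ^ 2 * (avg w f0 s + (1/2) * (rexp (lam0 s) * e0 s) ^ 2) := by
        apply intervalIntegral.integral_nonneg hr.le
        intro s _
        have := avg_nonneg hsf (fun v => (w_pos v).le) s
        positivity
      have h2 : 0 ≤ 2 * (4 * π * ∫ s in (0:ℝ)..r, s ^ 2 *
        (avg w f0 s + (1/2) * (rexp (lam0 s) * e0 s) ^ 2)) / r := by positivity
      have h3 : rexp (-2 * lam0 r) ≤ 1 := by linarith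
      rw [Real.exp_le_one_iff] at h3
      linarith
  have hfs : FS q c.z c.R c.F c.D lam0 e0 f0 :=
    ⟨hsf, hl.continuous.continuousOn, hec.continuous.continuousOn, hpos,
      fun r hr => (hc.hq0 r hr).trans (by linarith [hc.hz']), i2⟩
  refine ⟨by rw [hT]; exact le_top, ?_, ?_, ?_, ?_, ?_, ?_, ?_, ?_⟩
  · intro t _ _; rw [hfe, hle, hee]; exact hfs
  · intro s t _ _ _ _ x v; rw [hf, hf, sub_self, abs_zero]; positivity
  · intro t h0 _ x v hne
    rw [hf] at hne
    have : 0 ≤ c.L * t := by positivity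
    linarith [(hc.hs0 x v hne).2]
  · intro t h0 _ r hr
    rw [hlam]
    have : 0 ≤ c.L * t := by positivity
    linarith [hc.hq0 r hr]
  · intro s t _ _ _ _ r _ _
    rw [hlam, hlam, sub_self, abs_zero]
    have := hc.hW; positivity
  · intro r _; exact hlam 0 r
  · intro r _; exact he 0 r
  · intro t _ _
    rw [hle, hme, hee]
    refine ⟨_, _, _, hfs.statM hfs hRp hD0 hm.continuous.continuousOn
      (fun r _ => hl.differentiable (by simp) r) (fun r _ => hm.differentiable (by simp) r) hli hmi i1 i3 ?_⟩
    intro r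
    rw [hlamT 0 t r, hle, hme, kk_eq, hfe]

/-! ### Conclusion -/

theorem all_levels {q : ℝ} {f0 : E3 → E3 → ℝ} {lam0 mu0 e0 : ℝ → ℝ} {c : Cs}
    (hc : Ok q f0 lam0 e0 c)
    (hdata : InitialData q f0 lam0 mu0 e0) (hsf : StatF c.z c.R c.F c.D f0)
    {fI : ℕ → ℝ → E3 → E3 → ℝ} {lamI muI lamTI eI : ℕ → ℝ → ℝ → ℝ}
    {T : ℕ → ℝ≥0∞} {Z : ℕ → ℝ → ℝ → E3 × E3 → E3 × E3}
    (hscheme : IsScheme q f0 lam0 mu0 e0 fI lamI muI lamTI eI T Z)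
    (hreg : ∀ n : ℕ, 0 < T n ∧
      RegMetric3 (Iv (T n)) (lamI n) (muI n) (lamTI n) ∧
      RegField (Iv (T n)) (eI n) ∧ RegDist (Iv (T n)) (fI n)) (n : ℕ) :
    ENNReal.ofReal c.τ ≤ T n ∧
    Lvl q lam0 e0 c (lamI n) (muI n) (lamTI n) (eI n) (fI n) := by
  induction n with
  | zero => exact base hc hdata hsf hscheme
  | succ n ih => exact step hc hscheme hreg n ih.1 ih.2

theorem SolOn.ge_linear {a C : ℝ} {Φ : ℝ → ℝ → ℝ} {T : ℝ} {z : ℝ → ℝ} (hC : 0 ≤ C) (ha : 1 ≤ a)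
    (hΦ : ContDiff ℝ 1 (fun p : ℝ × ℝ => Φ p.1 p.2))
    (hpos : ∀ s x, 0 ≤ Φ s x) (hexp : ∀ s x, 0 ≤ s → 1 ≤ x → rexp x ≤ Φ s x)
    (h : SolOn a C Φ T z) {t : ℝ} (ht : t ∈ Set.Ico 0 T) : a + C * t ≤ z t := by
  have hsub : Set.Icc 0 t ⊆ Set.Ico 0 T := fun x hx => ⟨hx.1, hx.2.trans_lt ht.2⟩
  have hI : IntervalIntegrable (fun s => Φ s (z s)) volume 0 t := by
    apply ContinuousOn.intervalIntegrable
    rw [Set.uIcc_of_le ht.1]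
    exact (h.contΦ hΦ).mono hsub
  have h1 : ∫ _ in (0:ℝ)..t, (1:ℝ) ≤ ∫ s in (0:ℝ)..t, Φ s (z s) := by
    apply intervalIntegral.integral_mono_on ht.1 (by simp) hI
    intro s hs
    have hz : 1 ≤ z s := ha.trans (h.ge hC hpos (hsub hs))
    have := hexp s (z s) hs.1 hz
    have := Real.add_one_le_exp (z s)
    linarith
  simp only [intervalIntegral.integral_const, sub_zero, smul_eq_mul, mul_one] at h1
  rw [h.2 t ht]
  have := mul_le_mul_of_nonneg_left h1 hC
  linarith

theorem exp_le_source {C r0 F s x : ℝ} (hC : 1 ≤ C) (hr : 0 ≤ r0) (hF : 0 ≤ F) (hs : 0 ≤ s)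
    (hx : 1 ≤ x) :
    rexp x ≤ rexp (C * (1 + r0 + s) ^ 8 * (1 + F) ^ 3 * (1 + x) ^ 35) := by
  apply Real.exp_le_exp.2
  have h1 : 1 ≤ (1 + r0 + s) ^ 8 := one_le_pow₀ (by linarith)
  have h2 : 1 ≤ (1 + F) ^ 3 := one_le_pow₀ (by linarith)
  have h3 : 1 + x ≤ (1 + x) ^ 35 := le_self_pow₀ (by linarith) (by norm_num)
  generalize (1 + r0 + s) ^ 8 = a at *
  generalize (1 + F) ^ 3 = b at *
  generalize (1 + x) ^ 35 = y at *
  have h4 : 1 ≤ C * a := one_le_mul_of_one_le_of_one_le hC h1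
  have h5 : 1 ≤ C * a * b := one_le_mul_of_one_le_of_one_le h4 h2
  have h6 : 1 * y ≤ C * a * b * y := mul_le_mul_of_nonneg_right h5 (by linarith)
  linarith

/-- Proposition 4.2: uniform bounds on the iterates.  With
`u₀, q₀, r₀` as indicated and `z₀` the maximal solution of the integral equation
`z₀(t) = u₀ + q₀ + C∫₀ᵗ exp(C(1+r₀+s)⁸(1+‖f̊‖_∞)³(1+z₀(s))³⁵) ds` on `[0,T⁰)`,
one has `Pₙ(t) + Qₙ(t) ≤ z₀(t)` and `Tₙ ≥ T⁰` for all `n`; in particular the `Pₙ`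
and `Qₙ` are uniformly bounded on compact subintervals of `[0,T⁰)`. -/
theorem iterates_uniformly_bounded
    (q : ℝ) (f0 : E3 → E3 → ℝ) (lam0 mu0 e0 : ℝ → ℝ)
    (hdata : InitialData q f0 lam0 mu0 e0)
    (fI : ℕ → ℝ → E3 → E3 → ℝ) (lamI muI lamTI eI : ℕ → ℝ → ℝ → ℝ)
    (T : ℕ → ℝ≥0∞) (Z : ℕ → ℝ → ℝ → E3 × E3 → E3 × E3)
    (hscheme : IsScheme q f0 lam0 mu0 e0 fI lamI muI lamTI eI T Z)
    (hreg : ∀ n : ℕ, 0 < T n ∧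
      RegMetric3 (Iv (T n)) (lamI n) (muI n) (lamTI n) ∧
      RegField (Iv (T n)) (eI n) ∧ RegDist (Iv (T n)) (fI n)) :
    ∃ C : ℝ, 0 < C ∧ ∃ T0 : ℝ, 0 < T0 ∧ ∃ z0 : ℝ → ℝ,
      ContinuousOn z0 (Set.Ico 0 T0) ∧
      (∀ t ∈ Set.Ico (0:ℝ) T0,
        z0 t = suppMom f0 + q0max lam0 +
          C * ∫ s in (0:ℝ)..t,
            Real.exp (C * (1 + suppRad f0 + s) ^ 8 * (1 + supNorm f0) ^ 3
              * (1 + z0 s) ^ 35)) ∧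
      -- maximality of z₀
      (∀ T' : ℝ, ∀ z : ℝ → ℝ, ContinuousOn z (Set.Ico 0 T') →
        (∀ t ∈ Set.Ico (0:ℝ) T',
          z t = suppMom f0 + q0max lam0 +
            C * ∫ s in (0:ℝ)..t,
              Real.exp (C * (1 + suppRad f0 + s) ^ 8 * (1 + supNorm f0) ^ 3
                * (1 + z s) ^ 35)) → T' ≤ T0) ∧
      -- the uniform bound
      (∀ n : ℕ, ∀ t : ℝ, t ∈ Set.Ico (0:ℝ) T0 → ENNReal.ofReal t < T n →
        Pmax fI n t + Qmax lamI n t ≤ z0 t) ∧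
      (∀ n : ℕ, ENNReal.ofReal T0 ≤ T n) ∧
      -- uniform boundedness on compact subintervals
      (∀ δ : ℝ, 0 < δ → δ < T0 → ∃ B : ℝ, ∀ n : ℕ, ∀ t ∈ Set.Icc (0:ℝ) δ,
        Pmax fI n t ≤ B ∧ Qmax lamI n t ≤ B) := by


  obtain ⟨c, hc, hu, hq, hsf⟩ := exists_ok hdata
  have hall := all_levels hc hdata hsf hscheme hreg
  have hL : 0 ≤ c.L := (hc.hB.trans hc.hBB.le).trans hc.hLB
  have hq1 : 1 ≤ c.q0 := by have := hc.hq0 0 le_rfl; rw [hc.l00] at this; simpa using this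
  have hu0 : 0 ≤ c.u0 := hc.hu0
  have hτ := hc.hτ
  have hi : 0 < 1 / c.τ := by positivity
  have hP : ∀ n t, 0 ≤ t → t < c.τ → Pmax fI n t ≤ c.u0 + c.L * t := by
    intro n t h0 ht
    refine Real.sSup_le ?_ (by positivity)
    rintro _ ⟨s, hs, x, v, hne, rfl⟩
    have h1 := (hall n).2.fv s hs.1 (hs.2.trans_lt ht) x v hne
    have h2 := mul_le_mul_of_nonneg_left hs.2 hL
    linarith
  have hQ : ∀ n t, 0 ≤ t → t < c.τ → Qmax lamI n t ≤ c.q0 + c.L * t := by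
    intro n t h0 ht
    refine Real.sSup_le ?_ (by positivity)
    rintro _ ⟨s, hs, r, hr, rfl⟩
    have h1 := (hall n).2.lq s hs.1 (hs.2.trans_lt ht) r hr
    have h2 := mul_le_mul_of_nonneg_left hs.2 hL
    linarith
  set C : ℝ := 1 + 2 * c.L + 1 / c.τ with hCd
  have hC1 : 1 ≤ C := by linarith
  have hC0 : 0 < C := by linarith
  have hCτ : 1 / C ≤ c.τ := by
    rw [div_le_iff₀ hC0]
    have h1 : c.τ * (1 / c.τ) = 1 := mul_one_div_cancel hτ.ne'
    have h2 : 0 ≤ c.τ * (1 + 2 * c.L) := by positivity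
    rw [hCd]; linarith
  have ha : 1 ≤ suppMom f0 + q0max lam0 := by rw [← hu, ← hq]; linarith
  set Φ : ℝ → ℝ → ℝ := fun s x => Real.exp (C * (1 + suppRad f0 + s) ^ 8 * (1 + supNorm f0) ^ 3
    * (1 + x) ^ 35) with hΦd
  have hΦ : ContDiff ℝ 1 (fun p : ℝ × ℝ => Φ p.1 p.2) := by
    simp only [hΦd]; fun_prop
  have hpos : ∀ s x, 0 ≤ Φ s x := fun s x => (Real.exp_pos _).le
  have hexp : ∀ s x, 0 ≤ s → 1 ≤ x → rexp x ≤ Φ s x := fun s x hs hx =>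
    exp_le_source hC1 (suppRad_nonneg f0) (supNorm_nonneg f0) hs hx
  obtain ⟨T0, hT0, hT0C, z, hz, hmax⟩ := SolOn.exists_max hC1 ha hΦ hpos hexp
  have hT0τ : T0 ≤ c.τ := hT0C.trans hCτ
  refine ⟨C, hC0, T0, hT0, z, hz.1, hz.2, fun T' z' h1 h2 => hmax T' z' ⟨h1, h2⟩, ?_, ?_, ?_⟩
  · intro n t ht _
    have h1 := hP n t ht.1 (ht.2.trans_le hT0τ)
    have h2 := hQ n t ht.1 (ht.2.trans_le hT0τ)
    have h3 := hz.ge_linear hC0.le ha hΦ hpos hexp ht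
    rw [← hu, ← hq] at h3
    have h4 : (2 * c.L) * t ≤ C * t := mul_le_mul_of_nonneg_right (by linarith) ht.1
    linarith
  · intro n
    exact (ENNReal.ofReal_le_ofReal hT0τ).trans (hall n).1
  · intro δ h0 hδ
    refine ⟨c.u0 + c.q0 + c.L * δ, fun n t ht => ?_⟩
    have hlt : t < c.τ := (ht.2.trans_lt hδ).trans_le hT0τ
    have h1 := hP n t ht.1 hlt
    have h2 := hQ n t ht.1 hlt
    have h3 := mul_le_mul_of_nonneg_left ht.2 hL
    constructor <;> linarith

end EVM
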